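/- Let H ∈ (0, 1/2], let W^H be a fractional Brownian motion with Hurst parameter H on a probability space (Ω, F, P), let x₀ ∈ ℝ and T > 0, and let b : ℝ → ℝ be measurable and locally bounded. Suppose the process X = (X_t)_{t∈[0,T]} has P-a.s. continuous sample paths, is adapted to the natural filtration of W^H, and satisfies X_t = x₀ + W^H_t + ∫₀^t b(X_s) ds for all 0 ≤ t ≤ T, P-a.s. Then the law of (X_t)_{t∈[0,T]} is equivalent to (mutually absolutely continuous with) the law of (x₀ + W^H_t)_{t∈[0,T]}. -/

import Mathlib

open MeasureTheory ProbabilityTheory Real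

/-- Covariance function of fractional Brownian motion with Hurst parameter `H`,
for times `s, t ≥ 0`. -/
noncomputable def fbmCov (H s t : ℝ) : ℝ :=
  (s ^ (2 * H) + t ^ (2 * H) - |t - s| ^ (2 * H)) / 2

/-- `W` is a fractional Brownian motion with Hurst parameter `H` on `(Ω, F, P)`:
each `W t` is measurable, `P`-a.s. the sample paths are continuous on `[0, ∞)` with
`W 0 = 0`, and all finite-dimensional distributions are centered Gaussian with covariance
`fbmCov H`, expressed through one-dimensional distributions of linear combinations. -/
def IsFractionalBM {Ω : Type*} [MeasurableSpace Ω] (P : Measure Ω) (H : ℝ)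
    (W : ℝ → Ω → ℝ) : Prop :=
  (∀ t : ℝ, Measurable (W t)) ∧
  (∀ᵐ ω ∂P, ContinuousOn (fun t => W t ω) (Set.Ici 0) ∧ W 0 ω = 0) ∧
  (∀ (n : ℕ) (t : Fin n → ℝ), (∀ i, 0 ≤ t i) → ∀ c : Fin n → ℝ,
    P.map (fun ω => ∑ i, c i * W (t i) ω) =
      gaussianReal 0 (∑ i, ∑ j, c i * c j * fbmCov H (t i) (t j)).toNNReal)

/-- The law of the process `(Z t)_{t ∈ [0,T]}`: the pushforward of `P` under the map sending
`ω` to the path `t ↦ Z t ω`, as a measure on the space of functions `[0,T] → ℝ` equipped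
with the product σ-algebra. -/
noncomputable def processLaw {Ω : Type*} [MeasurableSpace Ω] (P : Measure Ω) (T : ℝ)
    (Z : ℝ → Ω → ℝ) : Measure (Set.Icc (0 : ℝ) T → ℝ) :=
  P.map (fun ω => fun t : Set.Icc (0 : ℝ) T => Z t ω)

open MeasureTheory ProbabilityTheory Real

namespace FBMProof

section Cov
variable {Ω : Type*} [MeasurableSpace Ω] {P : Measure Ω} [IsProbabilityMeasure P]
  {H : ℝ} {W : ℝ → Ω → ℝ}

lemma fbm_gaussian_vec (hW : IsFractionalBM P H W) (n : ℕ) (t : Fin n → ℝ) (ht : ∀ i, 0 ≤ t i) :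
    HasGaussianLaw (fun ω i => W (t i) ω) P := by
  have hm : Measurable (fun ω i => W (t i) ω) := measurable_pi_lambda _ fun i => hW.1 _
  constructor
  constructor
  intro L
  have hL : ∀ x, L x = ∑ i, L (Pi.single i 1) * x i := by
    intro x
    conv_lhs => rw [← Finset.univ_sum_single x]
    rw [map_sum]
    refine Finset.sum_congr rfl fun i _ => ?_
    have : (Pi.single i (x i) : Fin n → ℝ) = x i • Pi.single i 1 := by
      rw [← Pi.single_smul]; simp
    rw [this, map_smul, smul_eq_mul, mul_comm]
  have hmap : (P.map (fun ω i => W (t i) ω)).map L =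
      gaussianReal 0 (∑ i, ∑ j, L (Pi.single i 1) * L (Pi.single j 1)
        * fbmCov H (t i) (t j)).toNNReal := by
    rw [Measure.map_map (by fun_prop) hm, ← hW.2.2 n t ht]
    congr 1
    ext ω
    exact hL _
  have : IsGaussian ((P.map (fun ω i => W (t i) ω)).map L) := by rw [hmap]; infer_instance
  rw [IsGaussian.eq_gaussianReal _ this]
  rw [integral_map (by fun_prop) (by fun_prop), variance_map (by fun_prop) (by fun_prop)]
  rfl

lemma fbm_gaussian (hW : IsFractionalBM P H W) {t : ℝ} (ht : 0 ≤ t) : HasGaussianLaw (W t) P :=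
  (fbm_gaussian_vec hW 1 (fun _ => t) (fun _ => ht)).eval (X := fun _ => W t) 0

lemma fbm_map (hW : IsFractionalBM P H W) {t : ℝ} (ht : 0 ≤ t) (hH : 0 < H) :
    P.map (W t) = gaussianReal 0 (t ^ (2 * H)).toNNReal := by
  have := hW.2.2 1 (fun _ => t) (fun _ => ht) (fun _ => 1)
  simp only [Finset.univ_unique, Finset.sum_singleton, one_mul, fbmCov, sub_self, abs_zero] at this
  rw [zero_rpow (by positivity)] at this
  rw [this]; congr 2; ring

lemma fbm_memLp (hW : IsFractionalBM P H W) {t : ℝ} (ht : 0 ≤ t) : MemLp (W t) 2 P :=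
  (fbm_gaussian hW ht).memLp_two

lemma fbm_mean (hW : IsFractionalBM P H W) {t : ℝ} (ht : 0 ≤ t) : ∫ ω, W t ω ∂P = 0 := by
  have h := hW.2.2 1 (fun _ => t) (fun _ => ht) (fun _ => 1)
  simp only [Finset.univ_unique, Finset.sum_singleton, one_mul] at h
  have h2 : ∫ x, x ∂(P.map (W t)) = 0 := by
    rw [show P.map (W t) = _ from h, integral_id_gaussianReal]
  rwa [integral_map (hW.1 t).aemeasurable (by fun_prop)] at h2

lemma fbmCov_self (hH : 0 < H) (s : ℝ) : fbmCov H s s = s ^ (2 * H) := by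
  simp [fbmCov, zero_rpow (show 2 * H ≠ 0 by positivity)]

lemma fbmCov_comm (s t : ℝ) : fbmCov H s t = fbmCov H t s := by
  simp only [fbmCov, abs_sub_comm t s]; ring

lemma fbm_var (hW : IsFractionalBM P H W) {t : ℝ} (ht : 0 ≤ t) (hH : 0 < H) :
    Var[W t; P] = t ^ (2 * H) := by
  have h := variance_id_gaussianReal (μ := 0) (v := (t ^ (2 * H)).toNNReal)
  rw [← fbm_map hW ht hH, variance_map (by fun_prop) (hW.1 t).aemeasurable] at h
  simpa [Real.coe_toNNReal _ (rpow_nonneg ht _)] using h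

lemma fbm_cov (hW : IsFractionalBM P H W) (hH : 0 < H) {s t : ℝ} (hs : 0 ≤ s) (ht : 0 ≤ t) :
    cov[W s, W t; P] = fbmCov H s t := by
  have h := hW.2.2 2 ![s, t] (by intro i; fin_cases i <;> simpa) ![1, -1]
  simp only [Fin.sum_univ_two, Matrix.cons_val_zero, Matrix.cons_val_one, one_mul,
    fbmCov_self hH] at h
  have hv : (s ^ (2 * H) + -1 * fbmCov H s t + (-1 * fbmCov H t s + -1 * -1 * t ^ (2 * H)))
      = |t - s| ^ (2 * H) := by
    simp only [fbmCov, abs_sub_comm s t]; ring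
  simp only [mul_one, one_mul] at h
  rw [show (s ^ (2 * H) + -1 * fbmCov H s t + (-1 * fbmCov H t s + -1 * -1 * t ^ (2 * H)))
      = |t - s| ^ (2 * H) from hv] at h
  have h2 := variance_id_gaussianReal (μ := 0) (v := (|t - s| ^ (2 * H)).toNNReal)
  rw [← h, variance_map (by fun_prop)
    (show Measurable (fun ω => W s ω + -1 * W t ω) from
      (hW.1 s).add ((hW.1 t).const_mul (-1))).aemeasurable] at h2
  rw [Real.coe_toNNReal _ (by positivity)] at h2
  have h3 : Var[fun ω => W s ω - W t ω; P] = |t - s| ^ (2 * H) := by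
    rw [← h2]; congr 1; ext ω; simp; ring
  have h4 := variance_fun_sub (fbm_memLp hW hs) (fbm_memLp hW ht)
  rw [h3, fbm_var hW hs hH, fbm_var hW ht hH] at h4
  simp only [fbmCov]; linarith

lemma fbm_inc_memLp (hW : IsFractionalBM P H W) {s t : ℝ} (hs : 0 ≤ s) (ht : 0 ≤ t) :
    MemLp (fun ω => W t ω - W s ω) 2 P := (fbm_memLp hW ht).sub (fbm_memLp hW hs)

lemma fbm_inc_cov (hW : IsFractionalBM P H W) (hH : 0 < H) {a b c d : ℝ} (ha : 0 ≤ a) (hb : 0 ≤ b)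
    (hc : 0 ≤ c) (hd : 0 ≤ d) :
    cov[fun ω => W b ω - W a ω, fun ω => W d ω - W c ω; P] =
      (|d - a| ^ (2 * H) + |c - b| ^ (2 * H) - |c - a| ^ (2 * H) - |d - b| ^ (2 * H)) / 2 := by
  rw [covariance_fun_sub_fun_sub (fbm_memLp hW hb) (fbm_memLp hW ha) (fbm_memLp hW hd)
    (fbm_memLp hW hc), fbm_cov hW hH hb hd, fbm_cov hW hH hb hc, fbm_cov hW hH ha hd,
    fbm_cov hW hH ha hc]
  simp only [fbmCov]; ring

lemma rpow_conc (hH : 0 < H) (hH2 : H ≤ 1 / 2) {x y δ : ℝ} (hx : 0 ≤ x) (hxy : x ≤ y) (hδ : 0 ≤ δ) :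
    (y + δ) ^ (2 * H) + x ^ (2 * H) ≤ y ^ (2 * H) + (x + δ) ^ (2 * H) := by
  rcases eq_or_lt_of_le hδ with h0 | h0
  · subst h0; simp
  rcases eq_or_lt_of_le hxy with h1 | h1
  · subst h1; linarith
  have hc := Real.concaveOn_rpow (p := 2 * H) (by linarith) (by linarith)
  have hpos : 0 < y + δ - x := by linarith
  set θ := δ / (y + δ - x)
  have hθ : θ * (y + δ - x) = δ := div_mul_cancel₀ _ hpos.ne'
  have hθ0 : 0 ≤ θ := by positivity
  have hθ1 : 0 ≤ 1 - θ := by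
    rw [sub_nonneg, div_le_one hpos]; linarith
  have e1 := hc.2 (x := x) (y := y + δ) hx (by simp; linarith) hθ1 hθ0 (by ring)
  have e2 := hc.2 (x := x) (y := y + δ) hx (by simp; linarith) hθ0 hθ1 (by ring)
  simp only [smul_eq_mul] at e1 e2
  rw [show (1 - θ) * x + θ * (y + δ) = x + δ by linear_combination hθ] at e1
  rw [show θ * x + (1 - θ) * (y + δ) = y by linear_combination -hθ] at e2
  linarith

lemma fbm_inc_cov_nonpos (hW : IsFractionalBM P H W) (hH : 0 < H) (hH2 : H ≤ 1 / 2)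
    {a b c d : ℝ} (ha : 0 ≤ a) (hab : a ≤ b) (hbc : b ≤ c) (hcd : c ≤ d) :
    cov[fun ω => W b ω - W a ω, fun ω => W d ω - W c ω; P] ≤ 0 := by
  rw [fbm_inc_cov hW hH ha (by linarith) (by linarith) (by linarith),
    abs_of_nonneg (by linarith), abs_of_nonneg (by linarith), abs_of_nonneg (by linarith),
    abs_of_nonneg (by linarith)]
  have := rpow_conc hH hH2 (x := c - b) (y := c - a) (δ := d - c) (by linarith) (by linarith)
    (by linarith)
  rw [show c - a + (d - c) = d - a by ring, show c - b + (d - c) = d - b by ring] at this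
  linarith

/-- lower bound of the variance of a combination of increments -/
lemma fbm_var_lower (hW : IsFractionalBM P H W) (hH : 0 < H) (hH2 : H ≤ 1 / 2)
    (t : ℕ → ℝ) (ht : Monotone t) (ht0 : t 0 = 0) (n : ℕ) (f : Fin n → ℝ) :
    ∑ i : Fin n, f i ^ 2 * (((t (i + 1)) ^ (2 * H) - (t i) ^ (2 * H) + (t n - t i) ^ (2 * H)
        - (t n - t (i + 1)) ^ (2 * H)) / 2) ≤
      Var[fun ω => ∑ i : Fin n, f i * (W (t (i + 1)) ω - W (t i) ω); P] := by
  have hp : ∀ i, 0 ≤ t i := fun i => by rw [← ht0]; exact ht (Nat.zero_le i)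
  set G : Fin n → Fin n → ℝ := fun i j =>
    cov[fun ω => W (t (i + 1)) ω - W (t i) ω, fun ω => W (t (j + 1)) ω - W (t j) ω; P] with hG
  have hmem : ∀ i : Fin n, MemLp (fun ω => W (t (i + 1)) ω - W (t i) ω) 2 P :=
    fun i => fbm_inc_memLp hW (hp _) (hp _)
  have hvar : Var[fun ω => ∑ i : Fin n, f i * (W (t (i + 1)) ω - W (t i) ω); P]
      = ∑ i, ∑ j, f i * f j * G i j := by
    rw [← covariance_self (by
      refine Finset.aemeasurable_fun_sum _ fun i _ => ?_
      exact (((hW.1 _).sub (hW.1 _)).const_mul _).aemeasurable)]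
    rw [covariance_fun_sum_fun_sum (fun i => (hmem i).const_mul _) (fun i => (hmem i).const_mul _)]
    refine Finset.sum_congr rfl fun i _ => Finset.sum_congr rfl fun j _ => ?_
    rw [covariance_const_mul_left, covariance_const_mul_right]; ring
  have hGle : ∀ i j, i ≠ j → G i j ≤ 0 := by
    intro i j hij
    rcases lt_or_gt_of_ne hij with h | h
    · exact fbm_inc_cov_nonpos hW hH hH2 (hp _) (ht (Nat.le_succ _)) (ht (by
        have : (i : ℕ) < j := h
        omega)) (ht (Nat.le_succ _))
    · simp only [hG]; rw [covariance_comm]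
      exact fbm_inc_cov_nonpos hW hH hH2 (hp _) (ht (Nat.le_succ _)) (ht (by
        have : (j : ℕ) < i := h
        omega)) (ht (Nat.le_succ _))
  have hsymm : ∀ i j, G i j = G j i := fun i j => covariance_comm _ _
  have hrow : ∀ i : Fin n, ∑ j, G i j = ((t (i + 1)) ^ (2 * H) - (t i) ^ (2 * H)
      + (t n - t i) ^ (2 * H) - (t n - t (i + 1)) ^ (2 * H)) / 2 := by
    intro i
    have h1 : ∑ j, G i j = cov[fun ω => W (t (i + 1)) ω - W (t i) ω,
        fun ω => W (t n) ω - W (t 0) ω; P] := by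
      rw [← covariance_fun_sum_right hmem (hmem i)]
      congr 1
      ext ω
      rw [Fin.sum_univ_eq_sum_range (fun j => W (t (j + 1)) ω - W (t j) ω)]
      exact Finset.sum_range_sub (fun j => W (t j) ω) n
    rw [h1, fbm_inc_cov hW hH (hp _) (hp _) (hp _) (hp _), ht0]
    have hi : t (i + 1) ≤ t n := ht (by omega)
    have hi' : t i ≤ t n := ht (by omega)
    rw [abs_of_nonneg (sub_nonneg.2 hi), abs_of_nonneg (sub_nonneg.2 hi'), zero_sub, zero_sub,
      abs_neg, abs_neg, abs_of_nonneg (hp _), abs_of_nonneg (hp _)]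
    ring
  rw [hvar]
  calc _ = ∑ i, ∑ j, f i ^ 2 * G i j := by
        refine Finset.sum_congr rfl fun i _ => ?_
        rw [← Finset.mul_sum, hrow]
    _ = ∑ i, ∑ j, (f i ^ 2 + f j ^ 2) / 2 * G i j := by
        have h1 : ∑ i, ∑ j, f i ^ 2 * G i j = ∑ i, ∑ j, f j ^ 2 * G i j := by
          rw [Finset.sum_comm]
          refine Finset.sum_congr rfl fun i _ => Finset.sum_congr rfl fun j _ => ?_
          rw [hsymm]
        have h2 : ∑ i, ∑ j, (f i ^ 2 + f j ^ 2) / 2 * G i j =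
            (∑ i, ∑ j, f i ^ 2 * G i j + ∑ i, ∑ j, f j ^ 2 * G i j) / 2 := by
          simp_rw [← Finset.sum_add_distrib, Finset.sum_div]
          refine Finset.sum_congr rfl fun i _ => Finset.sum_congr rfl fun j _ => ?_
          ring
        rw [h2, ← h1]; ring
    _ ≤ _ := by
        refine Finset.sum_le_sum fun i _ => Finset.sum_le_sum fun j _ => ?_
        by_cases hij : i = j
        · subst hij; apply le_of_eq; ring
        · nlinarith [hGle i j hij, sq_nonneg (f i - f j)]

/-- uniform grid Poincare inequality -/
lemma fbm_poincare (hW : IsFractionalBM P H W) (hH : 0 < H) (hH2 : H ≤ 1 / 2)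
    {T : ℝ} (hT : 0 < T) (n : ℕ) (hn : 0 < n) (f : Fin n → ℝ) :
    2 * H * T ^ (2 * H - 1) * (T / n) * ∑ i : Fin n, f i ^ 2 ≤
      Var[fun ω => ∑ i : Fin n, f i * (W (T / n * ((i + 1 : ℕ) : ℝ)) ω - W (T / n * (i : ℕ)) ω); P] := by
  have hn' : (0 : ℝ) < n := by exact_mod_cast hn
  refine le_trans ?_ (fbm_var_lower hW hH hH2 (fun i => T / n * i) ?_ (by simp) n f)
  swap
  · intro i j hij
    have : (i : ℝ) ≤ j := by exact_mod_cast hij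
    simp only; gcongr
  rw [Finset.mul_sum]
  refine Finset.sum_le_sum fun i _ => ?_
  rw [mul_comm]
  refine mul_le_mul_of_nonneg_left ?_ (sq_nonneg _)
  have hTn : T / n * n = T := by field_simp
  simp only [hTn]
  set Δ := T / n with hΔ
  have hΔ0 : 0 < Δ := by positivity
  have hi0 : (0 : ℝ) ≤ (i : ℕ) := by positivity
  have hi1 : ((i : ℕ) : ℝ) + 1 ≤ n := by exact_mod_cast i.2
  have key : ∀ x, 0 ≤ x → x + Δ ≤ T → 2 * H * T ^ (2 * H - 1) * Δ ≤ (x + Δ) ^ (2 * H) - x ^ (2 * H) := by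
    intro x hx hxT
    have h1 := rpow_conc hH hH2 (x := x) (y := T - Δ) (δ := Δ) hx (by linarith) hΔ0.le
    rw [sub_add_cancel] at h1
    have hΔT : Δ / T ≤ 1 := by rw [div_le_one hT]; linarith
    have h2 := rpow_one_add_le_one_add_mul_self (s := -(Δ / T)) (by linarith)
      (p := 2 * H) (by linarith) (by linarith)
    have h3 : (T - Δ) ^ (2 * H) = T ^ (2 * H) * (1 + -(Δ / T)) ^ (2 * H) := by
      rw [← mul_rpow hT.le (by linarith)]; congr 1; field_simp; ring
    have h4 : T ^ (2 * H - 1) = T ^ (2 * H) / T := by rw [rpow_sub_one hT.ne']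
    have h5 : T ^ (2 * H) * (1 + -(Δ / T)) ^ (2 * H) ≤ T ^ (2 * H) * (1 + 2 * H * -(Δ / T)) := by
      gcongr
    have h6 : T ^ (2 * H) * (1 + 2 * H * -(Δ / T)) = T ^ (2 * H) - 2 * H * (T ^ (2 * H) / T) * Δ := by
      field_simp; ring
    rw [h4]; linarith
  have e1 := key (Δ * (i : ℕ)) (by positivity) (by rw [← hTn]; nlinarith)
  have e2 := key (T - Δ * ((i : ℕ) + 1)) (by rw [← hTn]; nlinarith) (by nlinarith)
  push_cast
  rw [show Δ * ((i : ℕ) : ℝ) + Δ = Δ * ((i : ℕ) + 1) by ring] at e1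
  rw [show T - Δ * (((i : ℕ) : ℝ) + 1) + Δ = T - Δ * (i : ℕ) by ring] at e2
  linarith

end Cov
end FBMProof

open MeasureTheory ProbabilityTheory Real

namespace FBMProof
open scoped ENNReal

/-- Cauchy-Schwarz for Bochner integrals -/
lemma cs_int {Ω : Type*} [MeasurableSpace Ω] {μ : Measure Ω} {f g : Ω → ℝ}
    (hf : MemLp f 2 μ) (hg : MemLp g 2 μ) :
    (∫ x, f x * g x ∂μ) ^ 2 ≤ (∫ x, f x ^ 2 ∂μ) * ∫ x, g x ^ 2 ∂μ := by
  have h1 : Integrable (fun x => f x ^ 2) μ := hf.integrable_sq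
  have h2 : Integrable (fun x => g x ^ 2) μ := hg.integrable_sq
  have h3 : Integrable (fun x => f x * g x) μ := hf.integrable_mul hg
  have key : ∀ t : ℝ, 0 ≤ (∫ x, g x ^ 2 ∂μ) * (t * t) + (2 * ∫ x, f x * g x ∂μ) * t
      + ∫ x, f x ^ 2 ∂μ := by
    intro t
    have : 0 ≤ ∫ x, (f x + t * g x) ^ 2 ∂μ := integral_nonneg fun x => sq_nonneg _
    have e : ∫ x, (f x + t * g x) ^ 2 ∂μ = ∫ x, (f x ^ 2 + (2 * t) * (f x * g x)) + t ^ 2 * g x ^ 2 ∂μ := by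
      congr 1; ext x; ring
    rw [e, integral_add (f := fun x => f x ^ 2 + 2 * t * (f x * g x)) (h1.add (h3.const_mul _)) (h2.const_mul _),
      integral_add h1 (h3.const_mul _), integral_const_mul, integral_const_mul] at this
    nlinarith
  have := discrim_le_zero key
  simp only [discrim] at this
  nlinarith

/-- predictable shears preserve Lebesgue measure -/
lemma shear_preserving : ∀ (n : ℕ) (α : (Fin n → ℝ) → (Fin n → ℝ)), Measurable α →
    (∀ i y y', (∀ j < i, y j = y' j) → α y i = α y' i) →
    MeasurePreserving (fun y => y + α y) (volume : Measure (Fin n → ℝ)) volume := by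
  intro n
  induction n with
  | zero =>
    intro α hα _
    have : (fun y : Fin 0 → ℝ => y + α y) = id := by ext y i; exact i.elim0
    rw [this]; exact MeasurePreserving.id _
  | succ n ih =>
    intro α hα hp
    set e := MeasurableEquiv.piFinSuccAbove (fun _ : Fin (n + 1) => ℝ) (Fin.last n) with he
    have hev : MeasurePreserving e volume volume :=
      volume_preserving_piFinSuccAbove (fun _ : Fin (n + 1) => ℝ) (Fin.last n)
    let j : (Fin n → ℝ) → (Fin (n + 1) → ℝ) := fun y => e.symm (0, y)
    have hjm : Measurable j := e.symm.measurable.comp (measurable_const.prodMk measurable_id)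
    have hj : ∀ (y : Fin n → ℝ) (i : Fin n), j y i.castSucc = y i := by
      intro y i
      simp [j, he, MeasurableEquiv.piFinSuccAbove, Fin.insertNthEquiv, Fin.snoc]
    let α' : (Fin n → ℝ) → (Fin n → ℝ) := fun y i => α (j y) i.castSucc
    have h1 : MeasurePreserving (fun y => y + α' y) (volume : Measure (Fin n → ℝ)) volume := by
      refine ih α' ?_ ?_
      · exact measurable_pi_lambda _ fun i => (measurable_pi_apply _).comp (hα.comp hjm)
      · intro i y y' h
        refine hp _ _ _ fun k hk => ?_
        have hkl : k ≠ Fin.last n := (lt_of_lt_of_le hk (Fin.le_last _)).ne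
        obtain ⟨k', rfl⟩ := Fin.exists_castSucc_eq.2 hkl
        rw [hj, hj]
        exact h k' (by simpa using hk)
    have h2 : MeasurePreserving (fun p : (Fin n → ℝ) × ℝ =>
        (p.1 + α' p.1, p.2 + α (j p.1) (Fin.last n)))
        (volume.prod volume) (volume.prod volume) := by
      refine MeasurePreserving.skew_product (f := fun y => y + α' y)
        (g := fun y x => x + α (j y) (Fin.last n)) h1 ?_ ?_
      · exact measurable_snd.add ((measurable_pi_apply _).comp ((hα.comp hjm).comp measurable_fst))
      · exact ae_of_all _ fun y => (measurePreserving_add_right volume _).map_eq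
    have h3 := (Measure.measurePreserving_swap (μ := (volume : Measure ℝ))
      (ν := (volume : Measure (Fin n → ℝ)))).comp hev
    have h4 := ((hev.symm).comp (Measure.measurePreserving_swap (μ := (volume : Measure (Fin n → ℝ)))
      (ν := (volume : Measure ℝ)))).comp (h2.comp h3)
    convert h4 using 1
    ext y i
    have hy : ∀ i : Fin n, (e y).2 i = y i.castSucc := by
      intro i; simp [he, MeasurableEquiv.piFinSuccAbove, Fin.insertNthEquiv]; rfl
    have hy0 : (e y).1 = y (Fin.last n) := by
      simp [he, MeasurableEquiv.piFinSuccAbove, Fin.insertNthEquiv]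
    have hsame : ∀ k : Fin (n + 1), k < Fin.last n → j (e y).2 k = y k := by
      intro k hk
      obtain ⟨k', rfl⟩ := Fin.exists_castSucc_eq.2 hk.ne
      rw [hj, hy]
    have he1 : ∀ (z : Fin n → ℝ) (x : ℝ) (i : Fin n), e.symm (x, z) i.castSucc = z i := by
      intro z x i
      simp [he, MeasurableEquiv.piFinSuccAbove, Fin.insertNthEquiv, Fin.snoc]
    have he2 : ∀ (z : Fin n → ℝ) (x : ℝ), e.symm (x, z) (Fin.last n) = x := by
      intro z x
      simp [he, MeasurableEquiv.piFinSuccAbove, Fin.insertNthEquiv, Fin.snoc]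
    simp only [Function.comp_apply, Prod.swap, Pi.add_apply]
    rcases Fin.eq_castSucc_or_eq_last i with ⟨i', rfl⟩ | rfl
    · rw [he1]
      simp only [Pi.add_apply, hy, α']
      congr 1
      exact hp _ _ _ fun k hk => (hsame k (lt_of_lt_of_le hk (Fin.le_last _))).symm
    · rw [he2, hy0]
      congr 1
      exact hp _ _ _ fun k hk => (hsame k hk).symm

lemma pi_gauss_lintegral : ∀ (n : ℕ) (F : (Fin n → ℝ) → ℝ≥0∞), Measurable F →
    ∫⁻ x, F x ∂(Measure.pi fun _ : Fin n => gaussianReal 0 1) =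
      ∫⁻ x, F x * ∏ i, gaussianPDF 0 1 (x i) := by
  intro n
  induction n with
  | zero =>
    intro F hF
    simp only [Finset.univ_eq_empty, Finset.prod_empty, mul_one]
    congr 1
    rw [volume_pi, Measure.pi_of_empty, Measure.pi_of_empty]
  | succ n ih =>
    intro F hF
    set e := MeasurableEquiv.piFinSuccAbove (fun _ : Fin (n + 1) => ℝ) 0 with he
    have hev : MeasurePreserving e.symm volume volume :=
      (volume_preserving_piFinSuccAbove (fun _ : Fin (n + 1) => ℝ) 0).symm
    have heg : MeasurePreserving e.symm _ _ := (measurePreserving_piFinSuccAbove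
      (fun _ : Fin (n + 1) => gaussianReal 0 1) 0).symm
    have hpm : Measurable fun x : Fin (n + 1) → ℝ => F x * ∏ i, gaussianPDF 0 1 (x i) := by
      refine hF.mul (Finset.measurable_prod _ fun i _ => ?_)
      exact (measurable_gaussianPDF 0 1).comp (measurable_pi_apply i)
    rw [← heg.lintegral_comp hF, ← hev.lintegral_comp hpm]
    have hFe : Measurable fun a => F (e.symm a) := hF.comp e.symm.measurable
    have hpe : Measurable fun a => F (e.symm a) * ∏ i, gaussianPDF 0 1 (e.symm a i) :=
      hpm.comp e.symm.measurable
    have hg1 : ∀ f : ℝ → ℝ≥0∞, Measurable f → ∫⁻ x, f x ∂(gaussianReal 0 1) =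
        ∫⁻ x, gaussianPDF 0 1 x * f x := by
      intro f hf
      rw [gaussianReal_of_var_ne_zero _ one_ne_zero, lintegral_withDensity_eq_lintegral_mul _
        (measurable_gaussianPDF 0 1) hf]
      rfl
    rw [lintegral_prod _ hFe.aemeasurable, Measure.volume_eq_prod,
      lintegral_prod _ hpe.aemeasurable]
    rw [hg1 _ hFe.lintegral_prod_right']
    refine lintegral_congr fun x => ?_
    have hFx : Measurable fun z => F (e.symm (x, z)) :=
      hF.comp (e.symm.measurable.comp (measurable_const.prodMk measurable_id))
    have := ih (fun z => F (e.symm (x, z))) hFx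
    rw [this, ← lintegral_const_mul]
    · refine lintegral_congr fun z => ?_
      rw [Fin.prod_univ_succ]
      have h0 : e.symm (x, z) 0 = x := by
        simp [he, MeasurableEquiv.piFinSuccAbove, Fin.insertNthEquiv]
      have h1 : ∀ i : Fin n, e.symm (x, z) i.succ = z i := by
        intro i; simp [he, MeasurableEquiv.piFinSuccAbove, Fin.insertNthEquiv]
      simp only [h0, h1]
      ring
    · refine hFx.mul (Finset.measurable_prod _ fun i _ => ?_)
      exact (measurable_gaussianPDF 0 1).comp (measurable_pi_apply i)

end FBMProof

open MeasureTheory ProbabilityTheory Real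

namespace FBMProof
open scoped ENNReal Matrix MatrixOrder

lemma gauss_repr {Ω : Type*} [MeasurableSpace Ω] {P : Measure Ω} [IsProbabilityMeasure P]
    {n : ℕ} {Y : Fin n → Ω → ℝ} (hY : HasGaussianLaw (fun ω i => Y i ω) P)
    (hmean : ∀ i, ∫ ω, Y i ω ∂P = 0) {l : ℝ} (hl : 0 < l)
    (hvar : ∀ c : Fin n → ℝ, l * ∑ i, c i ^ 2 ≤ Var[fun ω => ∑ i, c i * Y i ω; P]) :
    ∃ S : Matrix (Fin n) (Fin n) ℝ, S.det ≠ 0 ∧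
      (∀ v : Fin n → ℝ, l * ∑ i, v i ^ 2 ≤ ∑ i, (S *ᵥ v) i ^ 2) ∧
      P.map (fun ω i => Y i ω) =
        (Measure.pi fun _ : Fin n => gaussianReal 0 1).map (fun x => S *ᵥ x) := by
  have hmem : ∀ i, MemLp (Y i) 2 P := fun i => (hY.eval i).memLp_two
  set Γ : Matrix (Fin n) (Fin n) ℝ := Matrix.of fun i j => cov[Y i, Y j; P] with hΓ
  have hquad : ∀ c : Fin n → ℝ, c ⬝ᵥ Γ *ᵥ c = Var[fun ω => ∑ i, c i * Y i ω; P] := by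
    intro c
    rw [← covariance_self (by
      refine Finset.aemeasurable_fun_sum _ fun i _ => ?_
      exact ((hmem i).aemeasurable.const_mul _))]
    rw [covariance_fun_sum_fun_sum (fun i => (hmem i).const_mul _) (fun i => (hmem i).const_mul _)]
    simp only [dotProduct, Matrix.mulVec, Finset.mul_sum]
    refine Finset.sum_congr rfl fun i _ => Finset.sum_congr rfl fun j _ => ?_
    rw [covariance_const_mul_left, covariance_const_mul_right, hΓ, Matrix.of_apply]; ring
  have hherm : Γ.IsHermitian := by
    ext i j
    simp [hΓ, covariance_comm]
  have hpsd : Γ.PosSemidef := by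
    refine Matrix.PosSemidef.of_dotProduct_mulVec_nonneg hherm fun x => ?_
    simp only [star_trivial]
    rw [hquad]; exact variance_nonneg _ _
  set S := CFC.sqrt Γ with hS
  have hSS : S * S = Γ := CFC.sqrt_mul_sqrt_self _ hpsd.nonneg
  have hSh : Sᵀ = S := by
    have := (CFC.sqrt_nonneg Γ).isSelfAdjoint
    rw [IsSelfAdjoint, Matrix.star_eq_conjTranspose] at this
    simpa using this
  have hlow : ∀ v : Fin n → ℝ, l * ∑ i, v i ^ 2 ≤ ∑ i, (S *ᵥ v) i ^ 2 := by
    intro v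
    refine (hvar v).trans (le_of_eq ?_)
    rw [← hquad, ← hSS, ← Matrix.mulVec_mulVec, Matrix.dotProduct_mulVec, ← Matrix.mulVec_transpose, hSh]
    simp [dotProduct, sq]
  have hdet : S.det ≠ 0 := by
    intro h0
    obtain ⟨v, hv, hv0⟩ := Matrix.exists_mulVec_eq_zero_iff.2 h0
    have := hlow v
    rw [hv0] at this
    simp only [Pi.zero_apply, ne_eq, OfNat.ofNat_ne_zero, not_false_eq_true, zero_pow,
      Finset.sum_const_zero] at this
    apply hv
    have h2 : ∑ i, v i ^ 2 = 0 := le_antisymm (by nlinarith) (Finset.sum_nonneg fun i _ => sq_nonneg _)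
    rw [Finset.sum_eq_zero_iff_of_nonneg (fun i _ => sq_nonneg _)] at h2
    ext i; simpa using h2 i (Finset.mem_univ i)
  refine ⟨S, hdet, hlow, ?_⟩
  have hY2 : HasGaussianLaw (fun ω => WithLp.toLp 2 (fun i => Y i ω)) P := hY.toLp_pi 2
  have hY2m := hY2.isGaussian_map
  have hYm : AEMeasurable (fun ω i => Y i ω) P := hY.aemeasurable
  have hext : P.map (fun ω => WithLp.toLp 2 (fun i => Y i ω)) = multivariateGaussian 0 Γ := by
    apply IsGaussian.ext
    · simp only [integral_id_multivariateGaussian']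
      rw [integral_map hY2.aemeasurable aestronglyMeasurable_id]
      ext i
      have h1 := ContinuousLinearMap.integral_comp_comm
        (EuclideanSpace.proj i : EuclideanSpace ℝ (Fin n) →L[ℝ] ℝ) hY2.integrable
      simp only [id]
      have h2 : (∫ x, WithLp.toLp 2 (fun i => Y i x) ∂P) i =
        (EuclideanSpace.proj i : EuclideanSpace ℝ (Fin n) →L[ℝ] ℝ) (∫ x, WithLp.toLp 2 (fun i => Y i x) ∂P) := rfl
      rw [h2, ← h1]
      simpa using hmean i
    · ext x y
      rw [covarianceBilin_multivariateGaussian hpsd, covarianceBilin_apply_pi hmem]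
      simp only [dotProduct, Matrix.mulVec, Finset.mul_sum]
      refine Finset.sum_congr rfl fun i _ => Finset.sum_congr rfl fun j _ => ?_
      rw [hΓ, Matrix.of_apply]; ring
  have h3 : P.map (fun ω i => Y i ω) =
      (P.map (fun ω => WithLp.toLp 2 (fun i => Y i ω))).map (WithLp.ofLp) := by
    rw [AEMeasurable.map_map_of_aemeasurable (by fun_prop) hY2.aemeasurable]; rfl
  rw [h3, hext, multivariateGaussian, ← map_pi_eq_stdGaussian, Measure.map_map (by fun_prop) (by fun_prop),
    Measure.map_map (by fun_prop) (by fun_prop)]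
  congr 1
  ext x i
  simp [hS]

end FBMProof

open MeasureTheory ProbabilityTheory Real

namespace FBMProof
open scoped ENNReal Matrix

lemma girs_identity {n : ℕ} (S : Matrix (Fin n) (Fin n) ℝ) (hS : S.det ≠ 0)
    (α : (Fin n → ℝ) → (Fin n → ℝ)) (hα : Measurable α)
    (hp : ∀ i y y', (∀ j < i, y j = y' j) → α y i = α y' i)
    (F : (Fin n → ℝ) → ℝ≥0∞) (hF : Measurable F) :
    ∫⁻ x, F (S *ᵥ x + α (S *ᵥ x)) * ENNReal.ofReal (Real.exp (-(x ⬝ᵥ (S⁻¹ *ᵥ α (S *ᵥ x)))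
        - ((S⁻¹ *ᵥ α (S *ᵥ x)) ⬝ᵥ (S⁻¹ *ᵥ α (S *ᵥ x))) / 2))
        ∂(Measure.pi fun _ : Fin n => gaussianReal 0 1) =
      ∫⁻ x, F (S *ᵥ x) ∂(Measure.pi fun _ : Fin n => gaussianReal 0 1) := by
  have hu : IsUnit S.det := isUnit_iff_ne_zero.2 hS
  have hSm : ∀ M : Matrix (Fin n) (Fin n) ℝ, Measurable fun x : Fin n → ℝ => M *ᵥ x := fun M => by
    fun_prop
  set β : (Fin n → ℝ) → (Fin n → ℝ) := fun x => S⁻¹ *ᵥ α (S *ᵥ x) with hβ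
  have hβm : Measurable β := (hSm _).comp (hα.comp (hSm _))
  have hdm : Measurable fun x => -(x ⬝ᵥ β x) - (β x ⬝ᵥ β x) / 2 := by
    simp only [dotProduct]
    have : ∀ i, Measurable fun x => β x i := fun i => (measurable_pi_apply i).comp hβm
    fun_prop
  have hτ : MeasurePreserving (fun x => x + β x) (volume : Measure (Fin n → ℝ)) volume := by
    have h1 := Real.map_matrix_volume_pi_eq_smul_volume_pi hS
    have hto : ∀ M : Matrix (Fin n) (Fin n) ℝ, (⇑(Matrix.toLin' M)) = fun x => M *ᵥ x := by
      intro M; ext x; simp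
    rw [hto] at h1
    have e1 : MeasurePreserving (fun x => S *ᵥ x) volume
        (ENNReal.ofReal |S.det⁻¹| • (volume : Measure (Fin n → ℝ))) := ⟨hSm S, h1⟩
    have e2 := (shear_preserving n α hα hp).smul_measure (ENNReal.ofReal |S.det⁻¹|)
    have e3 : MeasurePreserving (fun x => S⁻¹ *ᵥ x)
        (ENNReal.ofReal |S.det⁻¹| • (volume : Measure (Fin n → ℝ))) volume := by
      refine ⟨hSm _, ?_⟩
      rw [← h1, Measure.map_map (hSm _) (hSm _)]
      have : (fun x => S⁻¹ *ᵥ x) ∘ (fun x : Fin n → ℝ => S *ᵥ x) = id := by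
        ext x i; simp [Matrix.mulVec_mulVec, Matrix.nonsing_inv_mul _ hu]
      rw [this, Measure.map_id]
    have e4 := e3.comp (e2.comp e1)
    convert e4 using 1
    ext x i
    simp [hβ, Matrix.mulVec_add, Matrix.mulVec_mulVec, Matrix.nonsing_inv_mul _ hu]
  have hpdf : ∀ x : Fin n → ℝ, ∏ i, gaussianPDF 0 1 (x i) =
      ENNReal.ofReal (((√(2 * π))⁻¹) ^ n * Real.exp (-(x ⬝ᵥ x) / 2)) := by
    intro x
    simp only [gaussianPDF, gaussianPDFReal]
    rw [← ENNReal.ofReal_prod_of_nonneg (fun i _ => by positivity)]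
    congr 1
    rw [Finset.prod_mul_distrib, ← Real.exp_sum]
    rw [Finset.prod_const, Finset.card_univ, Fintype.card_fin]
    congr 2
    · simp
    · simp only [dotProduct, ← Finset.sum_neg_distrib, Finset.sum_div]
      refine Finset.sum_congr rfl fun i _ => ?_
      simp; ring
  have hpm : Measurable fun x : Fin n → ℝ => ∏ i, gaussianPDF 0 1 (x i) :=
    Finset.measurable_prod _ fun i _ => (measurable_gaussianPDF 0 1).comp (measurable_pi_apply i)
  have hFS : Measurable fun x => F (S *ᵥ x) := hF.comp (hSm S)
  have hFα : Measurable fun x => F (S *ᵥ x + α (S *ᵥ x)) :=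
    hF.comp ((hSm S).add (hα.comp (hSm S)))
  rw [pi_gauss_lintegral, pi_gauss_lintegral _ _ hFS]
  swap
  · exact hFα.mul (hdm.exp.ennreal_ofReal)
  rw [← hτ.lintegral_comp (f := fun x => F (S *ᵥ x) * ∏ i, gaussianPDF 0 1 (x i)) (hFS.mul hpm)]
  refine lintegral_congr fun x => ?_
  have hSβ : S *ᵥ (x + β x) = S *ᵥ x + α (S *ᵥ x) := by
    simp [hβ, Matrix.mulVec_add, Matrix.mulVec_mulVec, Matrix.mul_nonsing_inv _ hu]
  rw [hSβ, mul_assoc, hpdf, hpdf, ← ENNReal.ofReal_mul (by positivity)]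
  congr 2
  rw [mul_left_comm, ← Real.exp_add]
  congr 2
  simp only [add_dotProduct, dotProduct_add, dotProduct_comm (β x) x]
  ring

lemma ofReal_int {X : Type*} [MeasurableSpace X] {μ : Measure X} {f : X → ℝ} (hf : Measurable f)
    (h0 : ∀ x, 0 ≤ f x) {c : ℝ} (hc : ∫⁻ x, ENNReal.ofReal (f x) ∂μ ≤ ENNReal.ofReal c)
    (hc0 : 0 ≤ c) :
    Integrable f μ ∧ ∫ x, f x ∂μ ≤ c := by
  have hi : Integrable f μ := by
    refine ⟨hf.aestronglyMeasurable, ?_⟩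
    rw [hasFiniteIntegral_iff_ofReal (ae_of_all _ h0)]
    exact hc.trans_lt ENNReal.ofReal_lt_top
  refine ⟨hi, ?_⟩
  rw [integral_eq_lintegral_of_nonneg_ae (ae_of_all _ h0) hf.aestronglyMeasurable]
  exact ENNReal.toReal_le_of_le_ofReal hc0 hc

lemma girs_abs {X : Type*} [MeasurableSpace X] (μ : Measure X) [IsProbabilityMeasure μ]
    (A q u v : X → ℝ) (hA : Measurable A) (hq : Measurable q) (hu : Measurable u)
    (hv : Measurable v) (Q : ℝ) (hq0 : ∀ x, 0 ≤ q x) (hqQ : ∀ x, q x ≤ Q)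
    (hu0 : ∀ x, 0 ≤ u x) (hu1 : ∀ x, u x ≤ 1) (hv0 : ∀ x, 0 ≤ v x) (hv1 : ∀ x, v x ≤ 1)
    (hθ : ∀ θ : ℝ, ∫⁻ x, ENNReal.ofReal (Real.exp (-(θ * A x) - θ ^ 2 * q x / 2)) ∂μ = 1)
    (hid : ∫⁻ x, ENNReal.ofReal (u x) * ENNReal.ofReal (Real.exp (-(A x) - q x / 2)) ∂μ =
      ∫⁻ x, ENNReal.ofReal (v x) ∂μ) :
    (∫ x, u x ∂μ) ^ 2 ≤ Real.exp Q * ∫ x, v x ∂μ ∧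
    (∫ x, v x ∂μ) ^ 2 ≤ Real.exp Q * ∫ x, u x ∂μ ∧
    (∫ x, u x ∂μ - ∫ x, v x ∂μ) ^ 2 ≤ Real.exp (3 * Q) * √(Q * ∫ x, q x ∂μ) := by
  have hθi : ∀ θ : ℝ, Integrable (fun x => Real.exp (-(θ * A x) - θ ^ 2 * q x / 2)) μ := by
    intro θ
    refine (ofReal_int (by fun_prop) (fun x => by positivity) (c := 1) ?_ zero_le_one).1
    rw [hθ]; simp
  have hθe : ∀ θ : ℝ, ∫ x, Real.exp (-(θ * A x) - θ ^ 2 * q x / 2) ∂μ = 1 := by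
    intro θ
    rw [integral_eq_lintegral_of_nonneg_ae (ae_of_all _ fun x => by positivity) (by fun_prop), hθ]
    simp
  have hQ0 : 0 ≤ Q := by
    have : Nonempty X := μ.nonempty_of_neZero
    exact (hq0 (Classical.arbitrary X)).trans (hqQ _)
  -- exponential moments
  have hmom : ∀ θ c : ℝ, 0 ≤ c →
      Integrable (fun x => Real.exp (-(θ * A x) - θ ^ 2 * q x / 2 + c * q x)) μ ∧
      ∫ x, Real.exp (-(θ * A x) - θ ^ 2 * q x / 2 + c * q x) ∂μ ≤ Real.exp (c * Q) := by
    intro θ c hc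
    have hle : ∀ x, Real.exp (-(θ * A x) - θ ^ 2 * q x / 2 + c * q x) ≤
        Real.exp (c * Q) * Real.exp (-(θ * A x) - θ ^ 2 * q x / 2) := by
      intro x
      rw [← Real.exp_add]
      apply Real.exp_le_exp.2
      nlinarith [mul_le_mul_of_nonneg_left (hqQ x) hc]
    have hintg : Integrable (fun x => Real.exp (-(θ * A x) - θ ^ 2 * q x / 2 + c * q x)) μ := by
      refine ((hθi θ).const_mul (Real.exp (c * Q))).mono' (by fun_prop) (ae_of_all _ fun x => ?_)
      rw [Real.norm_of_nonneg (by positivity)]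
      exact hle x
    refine ⟨hintg, ?_⟩
    calc _ ≤ ∫ x, Real.exp (c * Q) * Real.exp (-(θ * A x) - θ ^ 2 * q x / 2) ∂μ :=
          integral_mono hintg ((hθi θ).const_mul _) hle
      _ = _ := by rw [integral_const_mul, hθe, mul_one]
  set D : X → ℝ := fun x => Real.exp (-(A x) - q x / 2) with hD
  have hDm : Measurable D := by fun_prop
  have hD0 : ∀ x, 0 < D x := fun x => by positivity
  have hDsq : ∀ x, D x ^ 2 = Real.exp (-(2 * A x) - 2 ^ 2 * q x / 2 + 1 * q x) := by
    intro x; rw [hD, sq, ← Real.exp_add]; congr 1; ring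
  have hDinv : ∀ x, (D x)⁻¹ = Real.exp (-((-1) * A x) - (-1) ^ 2 * q x / 2 + 1 * q x) := by
    intro x; rw [hD, ← Real.exp_neg]; congr 1; ring
  have hD1 : Integrable D μ ∧ ∫ x, D x ∂μ = 1 := by
    have h1 := hθi 1
    have h2 := hθe 1
    simp only [one_mul, one_pow] at h1 h2
    exact ⟨h1, h2⟩
  have hD2 : Integrable (fun x => D x ^ 2) μ ∧ ∫ x, D x ^ 2 ∂μ ≤ Real.exp Q := by
    simp_rw [hDsq]; simpa using hmom 2 1 zero_le_one
  have hDi : Integrable (fun x => (D x)⁻¹) μ ∧ ∫ x, (D x)⁻¹ ∂μ ≤ Real.exp Q := by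
    simp_rw [hDinv]; simpa using hmom (-1) 1 zero_le_one
  have hDLp : MemLp D 2 μ := (memLp_two_iff_integrable_sq hDm.aestronglyMeasurable).2 hD2.1
  have huLp : MemLp u 2 μ := MemLp.of_bound hu.aestronglyMeasurable 1 (ae_of_all _ fun x => by
    rw [Real.norm_of_nonneg (hu0 x)]; exact hu1 x)
  have hui : Integrable u μ := huLp.integrable one_le_two
  have huD : Integrable (fun x => u x * D x) μ := huLp.integrable_mul hDLp
  have huDv : ∫ x, u x * D x ∂μ = ∫ x, v x ∂μ := by
    rw [integral_eq_lintegral_of_nonneg_ae (ae_of_all _ fun x => mul_nonneg (hu0 x) (hD0 x).le)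
      (by fun_prop), integral_eq_lintegral_of_nonneg_ae (ae_of_all _ hv0) (by fun_prop), ← hid]
    congr 1
    refine lintegral_congr fun x => ?_
    rw [ENNReal.ofReal_mul (hu0 x)]
  have hv0' : 0 ≤ ∫ x, v x ∂μ := integral_nonneg hv0
  have hu0' : 0 ≤ ∫ x, u x ∂μ := integral_nonneg hu0
  have hu2 : ∀ x, u x ^ 2 ≤ u x := fun x => by nlinarith [hu0 x, hu1 x]
  refine ⟨?_, ?_, ?_⟩
  · have hsq : ∀ x, √(D x) ^ 2 = D x := fun x => Real.sq_sqrt (hD0 x).le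
    have hsq' : ∀ x, ((√(D x))⁻¹) ^ 2 = (D x)⁻¹ := fun x => by rw [inv_pow, hsq]
    have hf : Integrable (fun x => (u x * √(D x)) ^ 2) μ := by
      refine huD.mono' (by fun_prop) (ae_of_all _ fun x => ?_)
      rw [Real.norm_of_nonneg (by positivity), mul_pow, hsq]
      exact mul_le_mul_of_nonneg_right (hu2 x) (hD0 x).le
    have hfLp : MemLp (fun x => u x * √(D x)) 2 μ :=
      (memLp_two_iff_integrable_sq (by fun_prop)).2 hf
    have hgLp : MemLp (fun x => (√(D x))⁻¹) 2 μ := by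
      refine (memLp_two_iff_integrable_sq (by fun_prop)).2 ?_
      simp_rw [hsq']; exact hDi.1
    have := cs_int hfLp hgLp
    have e1 : ∫ x, u x * √(D x) * (√(D x))⁻¹ ∂μ = ∫ x, u x ∂μ := by
      congr 1; ext x
      have : √(D x) ≠ 0 := (Real.sqrt_pos.2 (hD0 x)).ne'
      field_simp
    have e2 : ∫ x, (u x * √(D x)) ^ 2 ∂μ ≤ ∫ x, v x ∂μ := by
      rw [← huDv]
      refine integral_mono hf huD fun x => ?_
      simp only; rw [mul_pow, hsq]
      exact mul_le_mul_of_nonneg_right (hu2 x) (hD0 x).le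
    rw [e1] at this
    simp_rw [hsq'] at this
    calc _ ≤ _ := this
      _ ≤ (∫ x, v x ∂μ) * Real.exp Q :=
        mul_le_mul e2 hDi.2 (integral_nonneg fun x => (inv_pos.2 (hD0 x)).le) hv0'
      _ = _ := mul_comm _ _
  · have := cs_int huLp hDLp
    rw [huDv] at this
    calc _ ≤ _ := this
      _ ≤ (∫ x, u x ∂μ) * Real.exp Q :=
        mul_le_mul (integral_mono huLp.integrable_sq hui hu2) hD2.2
          (integral_nonneg fun x => sq_nonneg _) hu0'
      _ = _ := mul_comm _ _
  · have hDm1 : MemLp (fun x => 1 - D x) 2 μ := (memLp_const 1).sub hDLp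
    have h1 := cs_int huLp hDm1
    have e1 : ∫ x, u x * (1 - D x) ∂μ = ∫ x, u x ∂μ - ∫ x, v x ∂μ := by
      rw [← huDv, ← integral_sub hui huD]; congr 1; ext x; ring
    have e2 : ∫ x, (1 - D x) ^ 2 ∂μ = ∫ x, D x ^ 2 ∂μ - 1 := by
      have : ∀ x, (1 - D x) ^ 2 = D x ^ 2 - (2 * D x - 1) := fun x => by ring
      simp_rw [this]
      rw [integral_sub (g := fun x => 2 * D x - 1) hD2.1 ((hD1.1.const_mul 2).sub (integrable_const 1)),
        integral_sub (hD1.1.const_mul 2) (integrable_const 1), integral_const_mul, hD1.2]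
      simp; ring
    set D2 : X → ℝ := fun x => Real.exp (-(2 * A x) - 2 ^ 2 * q x / 2) with hD2def
    have hD2sq : ∀ x, D2 x ^ 2 = Real.exp (-(4 * A x) - 4 ^ 2 * q x / 2 + 4 * q x) := by
      intro x; rw [hD2def, sq, ← Real.exp_add]; congr 1; ring
    have hD2m : Integrable (fun x => D2 x ^ 2) μ ∧ ∫ x, D2 x ^ 2 ∂μ ≤ Real.exp (4 * Q) := by
      simp_rw [hD2sq]; exact hmom 4 4 (by norm_num)
    have hD2Lp : MemLp D2 2 μ := (memLp_two_iff_integrable_sq (by fun_prop)).2 hD2m.1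
    have hqi : Integrable q μ := Integrable.of_bound hq.aestronglyMeasurable Q
      (ae_of_all _ fun x => by rw [Real.norm_of_nonneg (hq0 x)]; exact hqQ x)
    have hEb : ∀ x, 0 ≤ Real.exp (q x) - 1 := fun x => by
      have := Real.add_one_le_exp (q x); linarith [hq0 x]
    have hEb2 : ∀ x, Real.exp (q x) - 1 ≤ q x * Real.exp Q := by
      intro x
      have h2 := Real.add_one_le_exp (-(q x))
      have h3 : Real.exp (q x) * Real.exp (-(q x)) = 1 := by rw [← Real.exp_add]; simp
      have h4 : Real.exp (q x) ≤ Real.exp Q := Real.exp_le_exp.2 (hqQ x)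
      have h5 := mul_le_mul_of_nonneg_left h2 (Real.exp_pos (q x)).le
      nlinarith [hq0 x, Real.exp_pos (q x)]
    have hEsq : ∀ x, (Real.exp (q x) - 1) ^ 2 ≤ Real.exp (2 * Q) * (Q * q x) := by
      intro x
      have h6 : Real.exp (2 * Q) = Real.exp Q ^ 2 := by rw [sq, ← Real.exp_add]; congr 1; ring
      calc (Real.exp (q x) - 1) ^ 2 ≤ (q x * Real.exp Q) ^ 2 := by
            apply pow_le_pow_left₀ (hEb x) (hEb2 x)
        _ = Real.exp (2 * Q) * (q x * q x) := by rw [h6]; ring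
        _ ≤ _ := by
            apply mul_le_mul_of_nonneg_left _ (Real.exp_pos _).le
            exact mul_le_mul_of_nonneg_right (hqQ x) (hq0 x)
    have hELp : MemLp (fun x => Real.exp (q x) - 1) 2 μ :=
      MemLp.of_bound (by fun_prop) (Q * Real.exp Q) (ae_of_all _ fun x => by
        rw [Real.norm_of_nonneg (hEb x)]
        exact (hEb2 x).trans (mul_le_mul_of_nonneg_right (hqQ x) (Real.exp_pos _).le))
    have h2 := cs_int hD2Lp hELp
    have e3 : ∫ x, D2 x * (Real.exp (q x) - 1) ∂μ = ∫ x, D x ^ 2 ∂μ - 1 := by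
      have : ∀ x, D2 x * (Real.exp (q x) - 1) = D x ^ 2 - D2 x := by
        intro x
        rw [hDsq, hD2def, mul_sub, ← Real.exp_add, mul_one, one_mul]
      simp_rw [this]
      rw [integral_sub hD2.1 (hD2Lp.integrable one_le_two)]
      congr 1
      exact hθe 2
    have e4 : ∫ x, (Real.exp (q x) - 1) ^ 2 ∂μ ≤ Real.exp (2 * Q) * (Q * ∫ x, q x ∂μ) := by
      rw [← integral_const_mul, ← integral_const_mul]
      exact integral_mono hELp.integrable_sq ((hqi.const_mul _).const_mul _) hEsq
    rw [e3] at h2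
    rw [e1, e2] at h1
    have hqq : 0 ≤ Q * ∫ x, q x ∂μ := mul_nonneg hQ0 (integral_nonneg hq0)
    have e5 : ∫ x, D x ^ 2 ∂μ - 1 ≤ Real.exp (3 * Q) * √(Q * ∫ x, q x ∂μ) := by
      apply le_of_sq_le_sq _ (by positivity)
      calc _ ≤ _ := h2
        _ ≤ Real.exp (4 * Q) * (Real.exp (2 * Q) * (Q * ∫ x, q x ∂μ)) :=
          mul_le_mul hD2m.2 e4 (integral_nonneg fun x => sq_nonneg _) (Real.exp_pos _).le
        _ = _ := by
          rw [mul_pow, Real.sq_sqrt hqq, ← mul_assoc, ← Real.exp_add, sq, ← Real.exp_add]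
          congr 2; ring
    have e6 : ∫ x, u x ^ 2 ∂μ ≤ 1 := by
      calc _ ≤ ∫ x, (1 : ℝ) ∂μ := integral_mono huLp.integrable_sq (integrable_const 1)
            fun x => (hu2 x).trans (hu1 x)
        _ = 1 := by simp
    have e7 : 0 ≤ ∫ x, D x ^ 2 ∂μ - 1 := by
      rw [← e2]; exact integral_nonneg fun x => sq_nonneg _
    calc _ ≤ _ := h1
      _ ≤ 1 * (∫ x, D x ^ 2 ∂μ - 1) := mul_le_mul_of_nonneg_right e6 e7
      _ ≤ _ := by rw [one_mul]; exact e5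

/-- finite dimensional Girsanov -/
theorem girs_fin {Ω : Type*} [MeasurableSpace Ω] {P : Measure Ω} [IsProbabilityMeasure P]
    {n : ℕ} {Y : Fin n → Ω → ℝ} (hY : HasGaussianLaw (fun ω i => Y i ω) P)
    (hmean : ∀ i, ∫ ω, Y i ω ∂P = 0) {l : ℝ} (hl : 0 < l)
    (hvar : ∀ c : Fin n → ℝ, l * ∑ i, c i ^ 2 ≤ Var[fun ω => ∑ i, c i * Y i ω; P])
    (α : (Fin n → ℝ) → (Fin n → ℝ)) (hα : Measurable α)
    (hp : ∀ i y y', (∀ j < i, y j = y' j) → α y i = α y' i)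
    (Q : ℝ) (hQ : ∀ y, ∑ i, α y i ^ 2 ≤ l * Q)
    (G : (Fin n → ℝ) → ℝ) (hG : Measurable G) (hG0 : ∀ y, 0 ≤ G y) (hG1 : ∀ y, G y ≤ 1) :
    (∫ ω, G (fun i => Y i ω + α (fun i => Y i ω) i) ∂P) ^ 2 ≤
      Real.exp Q * ∫ ω, G (fun i => Y i ω) ∂P ∧
    (∫ ω, G (fun i => Y i ω) ∂P) ^ 2 ≤
      Real.exp Q * ∫ ω, G (fun i => Y i ω + α (fun i => Y i ω) i) ∂P ∧
    (∫ ω, G (fun i => Y i ω + α (fun i => Y i ω) i) ∂P - ∫ ω, G (fun i => Y i ω) ∂P) ^ 2 ≤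
      Real.exp (3 * Q) * √(Q * ∫ ω, (∑ i, α (fun i => Y i ω) i ^ 2) / l ∂P) := by
  obtain ⟨S, hS, hSl, hmap⟩ := gauss_repr hY hmean hl hvar
  have hu : IsUnit S.det := isUnit_iff_ne_zero.2 hS
  have hSm : ∀ M : Matrix (Fin n) (Fin n) ℝ, Measurable fun x : Fin n → ℝ => M *ᵥ x := fun M => by
    fun_prop
  set γ := Measure.pi fun _ : Fin n => gaussianReal 0 1
  have htr : ∀ F : (Fin n → ℝ) → ℝ, Measurable F → ∫ ω, F (fun i => Y i ω) ∂P =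
      ∫ x, F (S *ᵥ x) ∂γ := by
    intro F hF
    rw [← integral_map (f := F) hY.aemeasurable hF.aestronglyMeasurable, hmap,
      integral_map (hSm S).aemeasurable hF.aestronglyMeasurable]
  have hGα : Measurable fun y => G (fun i => y i + α y i) :=
    hG.comp (measurable_id.add hα)
  have hαi : ∀ i, Measurable fun y => α y i := fun i => (measurable_pi_apply i).comp hα
  have hsm : Measurable fun y => (∑ i, α y i ^ 2) / l := by fun_prop
  rw [htr G hG, htr (fun y => G (fun i => y i + α y i)) hGα, htr (fun y => (∑ i, α y i ^ 2) / l) hsm]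
  set β : (Fin n → ℝ) → (Fin n → ℝ) := fun x => S⁻¹ *ᵥ α (S *ᵥ x) with hβ
  have hβm : Measurable β := (hSm _).comp (hα.comp (hSm _))
  have hβi : ∀ i, Measurable fun y => β y i := fun i => (measurable_pi_apply i).comp hβm
  have hqle : ∀ x, β x ⬝ᵥ β x ≤ (∑ i, α (S *ᵥ x) i ^ 2) / l := by
    intro x
    rw [le_div_iff₀ hl]
    have := hSl (β x)
    have e : S *ᵥ β x = α (S *ᵥ x) := by
      simp [hβ, Matrix.mulVec_mulVec, Matrix.mul_nonsing_inv _ hu]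
    rw [e] at this
    simp only [dotProduct]
    calc _ = l * ∑ i, β x i ^ 2 := by rw [mul_comm]; simp_rw [sq]
      _ ≤ _ := this
  have hq0 : ∀ x, 0 ≤ β x ⬝ᵥ β x := fun x => by
    simp only [dotProduct]; exact Finset.sum_nonneg fun i _ => mul_self_nonneg _
  have hsQ : ∀ y, (∑ i, α y i ^ 2) / l ≤ Q := by
    intro y
    rw [div_le_iff₀ hl]; linarith [hQ y]
  have := girs_abs γ (fun x => x ⬝ᵥ β x) (fun x => β x ⬝ᵥ β x)
    (fun x => G (fun i => (S *ᵥ x) i + α (S *ᵥ x) i)) (fun x => G (S *ᵥ x))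
    (by simp only [dotProduct]; fun_prop) (by simp only [dotProduct]; fun_prop)
    (hGα.comp (hSm S)) (hG.comp (hSm S)) Q hq0 (fun x => (hqle x).trans (hsQ _))
    (fun x => hG0 _) (fun x => hG1 _) (fun x => hG0 _) (fun x => hG1 _) ?_ ?_
  · refine ⟨this.1, this.2.1, this.2.2.trans ?_⟩
    refine mul_le_mul_of_nonneg_left (Real.sqrt_le_sqrt ?_) (Real.exp_pos _).le
    have hQ0 : 0 ≤ Q := (hq0 0).trans ((hqle 0).trans (hsQ _))
    refine mul_le_mul_of_nonneg_left ?_ hQ0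
    refine integral_mono_of_nonneg (ae_of_all _ hq0) ?_ (ae_of_all _ hqle)
    refine Integrable.of_bound (hsm.comp (hSm S)).aestronglyMeasurable Q (ae_of_all _ fun x => ?_)
    rw [Real.norm_of_nonneg (by positivity)]
    exact hsQ _
  · intro θ
    have h1 := girs_identity S hS (fun y => θ • α y) (hα.const_smul θ) (by
      intro i y y' h
      simp only [Pi.smul_apply]; rw [hp i y y' h]) (fun _ => 1) measurable_const
    simp only [one_mul, lintegral_const, measure_univ, mul_one] at h1
    rw [← h1]
    refine lintegral_congr fun x => ?_
    congr 2
    simp only [Matrix.mulVec_smul, dotProduct_smul, smul_dotProduct, smul_eq_mul, hβ]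
    ring
  · exact girs_identity S hS α hα hp (fun y => ENNReal.ofReal (G y)) hG.ennreal_ofReal

end FBMProof

open MeasureTheory ProbabilityTheory Real

namespace FBMProof
open scoped ENNReal

lemma fin_sum_trunc (f : ℕ → ℝ) {p n : ℕ} (hp : p ≤ n) :
    ∑ l : Fin n, (if (l : ℕ) < p then f l else 0) = ∑ l ∈ Finset.range p, f l := by
  rw [Fin.sum_univ_eq_sum_range (fun l => if l < p then f l else 0), ← Finset.sum_filter]
  congr 1
  ext l; simp; omega

lemma sum_range_blocks (f : ℕ → ℝ) (c M : ℕ) (hM : 0 < M) :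
    ∑ l ∈ Finset.range (c * M), f (l / M) = M * ∑ j ∈ Finset.range c, f j := by
  induction c with
  | zero => simp
  | succ c ih =>
    rw [Nat.succ_mul, Finset.sum_range_add, ih, Finset.sum_range_succ, mul_add]
    congr 1
    rw [Finset.sum_congr rfl (g := fun _ => f c)]
    · simp
    · intro x hx
      rw [Finset.mem_range] at hx
      rw [mul_comm c M, Nat.mul_add_div hM, Nat.div_eq_of_lt hx, add_zero]

section
variable {Ω : Type*} [MeasurableSpace Ω] {P : Measure Ω} [IsProbabilityMeasure P]
  {H : ℝ} {W : ℝ → Ω → ℝ}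

/-- increments on the uniform grid -/
noncomputable def inc (W : ℝ → Ω → ℝ) (T : ℝ) (n : ℕ) (l : ℕ) (ω : Ω) : ℝ :=
  W (T / n * ((l + 1 : ℕ) : ℝ)) ω - W (T / n * (l : ℕ)) ω

noncomputable def trunc (n p : ℕ) (y : Fin n → ℝ) : Fin n → ℝ := fun l => if (l : ℕ) < p then y l else 0

lemma trunc_meas (n p : ℕ) : Measurable (trunc n p) := by
  refine measurable_pi_lambda _ fun l => ?_
  simp only [trunc]
  split_ifs <;> fun_prop

noncomputable def incV (W : ℝ → Ω → ℝ) (T : ℝ) (n : ℕ) (ω : Ω) : Fin n → ℝ := fun l => inc W T n l ω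

lemma inc_sum (hW0 : ∀ ω, W 0 ω = 0) (T : ℝ) (n p : ℕ) (ω : Ω) :
    ∑ l ∈ Finset.range p, inc W T n l ω = W (T / n * p) ω := by
  have := Finset.sum_range_sub (fun l : ℕ => W (T / n * (l : ℝ)) ω) p
  simp only [inc]
  rw [this]; simp [hW0]

lemma incV_gaussian (hW : IsFractionalBM P H W) {T : ℝ} (hT : 0 < T) (n : ℕ) :
    HasGaussianLaw (incV W T n) P := by
  have h := fbm_gaussian_vec hW (n + 1) (fun i => T / n * (i : ℕ)) (fun i => by positivity)
  let L : (Fin (n + 1) → ℝ) →L[ℝ] (Fin n → ℝ) :=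
    ContinuousLinearMap.pi fun l =>
      (ContinuousLinearMap.proj l.succ : (Fin (n + 1) → ℝ) →L[ℝ] ℝ) - ContinuousLinearMap.proj l.castSucc
  have := h.map_fun L
  have e : incV W T n = fun ω => L (fun i : Fin (n + 1) => W (T / n * ((i : ℕ) : ℝ)) ω) := by
    ext ω l
    simp [incV, inc, L]
  rw [e]
  exact this

lemma incV_meas (hWm : ∀ t, Measurable (W t)) (T : ℝ) (n : ℕ) : Measurable (incV W T n) :=
  measurable_pi_lambda _ fun l => (hWm _).sub (hWm _)

lemma inc_mean (hW : IsFractionalBM P H W) {T : ℝ} (hT : 0 < T) (n l : ℕ) :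
    ∫ ω, inc W T n l ω ∂P = 0 := by
  have h1 := fbm_mean hW (t := T / n * ((l + 1 : ℕ) : ℝ)) (by positivity)
  have h2 := fbm_mean hW (t := T / n * ((l : ℕ) : ℝ)) (by positivity)
  simp only [inc]
  rw [integral_sub ((fbm_memLp hW (by positivity)).integrable one_le_two)
    ((fbm_memLp hW (by positivity)).integrable one_le_two), h1, h2, sub_zero]

lemma girs_fixed (hW : IsFractionalBM P H W) (hH : 0 < H) (hH2 : H ≤ 1 / 2)
    (hW0 : ∀ ω, W 0 ω = 0) {T K : ℝ} (hT : 0 < T) (hK : 0 ≤ K) {N M : ℕ} (hN : 0 < N) (hM : 0 < M)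
    (a : ℕ → Ω → ℝ)
    (ha : ∀ j, Measurable[MeasurableSpace.comap (fun ω => trunc (N * M) (j * M) (incV W T (N * M) ω))
      inferInstance] (a j))
    (hb : ∀ j, ∀ᵐ ω ∂P, |a j ω| ≤ K * (T / N))
    {m : ℕ} (c : Fin m → ℕ) (hc : ∀ r, c r ≤ N)
    (G : (Fin m → ℝ) → ℝ) (hG : Measurable G) (hG0 : ∀ y, 0 ≤ G y) (hG1 : ∀ y, G y ≤ 1) :
    (∫ ω, G (fun r => W (T / N * c r) ω + ∑ j ∈ Finset.range (c r), a j ω) ∂P) ^ 2 ≤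
      Real.exp (K ^ 2 * T ^ 2 / (2 * H * T ^ (2 * H))) * ∫ ω, G (fun r => W (T / N * c r) ω) ∂P ∧
    (∫ ω, G (fun r => W (T / N * c r) ω) ∂P) ^ 2 ≤ Real.exp (K ^ 2 * T ^ 2 / (2 * H * T ^ (2 * H))) *
      ∫ ω, G (fun r => W (T / N * c r) ω + ∑ j ∈ Finset.range (c r), a j ω) ∂P ∧
    (∫ ω, G (fun r => W (T / N * c r) ω + ∑ j ∈ Finset.range (c r), a j ω) ∂P
      - ∫ ω, G (fun r => W (T / N * c r) ω) ∂P) ^ 2 ≤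
      Real.exp (3 * (K ^ 2 * T ^ 2 / (2 * H * T ^ (2 * H)))) * √((K ^ 2 * T ^ 2 / (2 * H * T ^ (2 * H))) *
        (K * T / (2 * H * T ^ (2 * H)) * ∑ j ∈ Finset.range N, ∫ ω, |a j ω| ∂P)) := by
  set n := N * M with hn
  have hn0 : 0 < n := Nat.mul_pos hN hM
  have hNr : (0 : ℝ) < N := by exact_mod_cast hN
  have hMr : (0 : ℝ) < M := by exact_mod_cast hM
  have hnr : (n : ℝ) = N * M := by rw [hn]; push_cast; ring
  have hnr0 : (0 : ℝ) < n := by exact_mod_cast hn0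
  have hTH : 0 < T ^ (2 * H) := rpow_pos_of_pos hT _
  have hTH1 : T ^ (2 * H - 1) = T ^ (2 * H) / T := by rw [rpow_sub_one hT.ne']
  set Q := K ^ 2 * T ^ 2 / (2 * H * T ^ (2 * H)) with hQ
  set B := K * (T / N) with hB
  have hB0 : 0 ≤ B := by positivity
  choose φ hφm hφ using fun j => (ha j).exists_eq_measurable_comp
  let ψ : ℕ → (Fin n → ℝ) → ℝ := fun j y => max (-B) (min B (φ j y))
  have hψm : ∀ j, Measurable (ψ j) := fun j => measurable_const.max (measurable_const.min (hφm j))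
  have hψb : ∀ j y, |ψ j y| ≤ B := by
    intro j y
    rw [abs_le]
    exact ⟨le_max_left _ _, max_le (by linarith) (min_le_left _ _)⟩
  let α : (Fin n → ℝ) → (Fin n → ℝ) := fun y i => ψ (i / M) (trunc n (i / M * M) y) / M
  have hαm : Measurable α := by
    refine measurable_pi_lambda _ fun i => ?_
    exact ((hψm _).comp (trunc_meas n _)).div_const _
  have hαp : ∀ i y y', (∀ j < i, y j = y' j) → α y i = α y' i := by
    intro i y y' h
    simp only [α]
    congr 2
    ext l
    simp only [trunc]
    split_ifs with hl
    · exact h l (Fin.lt_def.2 (lt_of_lt_of_le hl (Nat.div_mul_le_self _ _)))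
    · rfl
  have hαb : ∀ y i, |α y i| ≤ K * (T / n) := by
    intro y i
    simp only [α]
    rw [abs_div, abs_of_pos hMr, div_le_iff₀ hMr]
    refine (hψb _ _).trans (le_of_eq ?_)
    rw [hB, hnr]; field_simp
  set l := 2 * H * T ^ (2 * H - 1) * (T / n) with hl
  have hl0 : 0 < l := by rw [hl, hTH1]; positivity
  have hlQ : l * Q = n * (K * (T / n)) ^ 2 := by
    rw [hl, hQ, hTH1]; field_simp
  have hsum : ∀ y, ∑ i, α y i ^ 2 ≤ l * Q := by
    intro y
    rw [hlQ]
    calc _ ≤ ∑ i : Fin n, (K * (T / n)) ^ 2 := by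
          refine Finset.sum_le_sum fun i _ => ?_
          rw [← sq_abs]
          exact pow_le_pow_left₀ (abs_nonneg _) (hαb y i) 2
      _ = _ := by simp
  let G' : (Fin n → ℝ) → ℝ := fun y => G (fun r => ∑ i, trunc n (c r * M) y i)
  have hG'm : Measurable G' := by
    refine hG.comp (measurable_pi_lambda _ fun r => Finset.measurable_sum _ fun i _ => ?_)
    exact (measurable_pi_apply i).comp (trunc_meas n _)
  have hcM : ∀ r, c r * M ≤ n := fun r => Nat.mul_le_mul_right _ (hc r)
  have hWgrid : ∀ r ω, ∑ i, trunc n (c r * M) (incV W T n ω) i = W (T / N * c r) ω := by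
    intro r ω
    simp only [trunc, incV]
    rw [fin_sum_trunc (fun l => inc W T n l ω) (hcM r), inc_sum hW0]
    congr 1
    rw [hnr]; push_cast; field_simp
  have hae : ∀ᵐ ω ∂P, ∀ j, ψ j (trunc n (j * M) (incV W T n ω)) = a j ω := by
    rw [ae_all_iff]
    intro j
    filter_upwards [hb j] with ω hω
    have e : φ j (trunc n (j * M) (incV W T n ω)) = a j ω := by
      have := congrFun (hφ j) ω
      exact this.symm
    simp only [ψ, e]
    rw [abs_le] at hω
    rw [min_eq_right hω.2, max_eq_right hω.1]
  have hαω : ∀ᵐ ω ∂P, ∀ i : Fin n, α (incV W T n ω) i = a (i / M) ω / M := by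
    filter_upwards [hae] with ω hω i
    simp only [α, hω]
  have h1 : ∀ᵐ ω ∂P, G' (fun i => incV W T n ω i + α (incV W T n ω) i) =
      G (fun r => W (T / N * c r) ω + ∑ j ∈ Finset.range (c r), a j ω) := by
    filter_upwards [hαω] with ω hω
    simp only [G']
    congr 1
    ext r
    rw [← hWgrid]
    have e : ∀ i, trunc n (c r * M) (fun i => incV W T n ω i + α (incV W T n ω) i) i =
        trunc n (c r * M) (incV W T n ω) i + (if (i : ℕ) < c r * M then a (i / M) ω / M else 0) := by
      intro i
      simp only [trunc, hω]
      split_ifs <;> simp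
    simp_rw [e]
    rw [Finset.sum_add_distrib, fin_sum_trunc (fun l => a (l / M) ω / M) (hcM r)]
    rw [sum_range_blocks (fun j => a j ω / M) _ _ hM, ← Finset.sum_div]
    congr 1
    field_simp
  have h2 : ∀ ω, G' (incV W T n ω) = G (fun r => W (T / N * c r) ω) := by
    intro ω
    simp only [G', hWgrid]
  have hmain := girs_fin (Y := fun i ω => incV W T n ω i) (incV_gaussian hW hT n)
    (fun i => inc_mean hW hT n i) hl0
    (fun f => fbm_poincare hW hH hH2 hT n hn0 f) α hαm hαp Q hsum G' hG'm
    (fun y => hG0 _) (fun y => hG1 _)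
  have e1 : ∫ ω, G' (fun i => incV W T n ω i + α (incV W T n ω) i) ∂P =
      ∫ ω, G (fun r => W (T / N * c r) ω + ∑ j ∈ Finset.range (c r), a j ω) ∂P :=
    integral_congr_ae h1
  have e2 : ∫ ω, G' (incV W T n ω) ∂P = ∫ ω, G (fun r => W (T / N * c r) ω) ∂P := by
    simp_rw [h2]
  change (∫ ω, G' (fun i => incV W T n ω i + α (incV W T n ω) i) ∂P) ^ 2 ≤
      Real.exp Q * ∫ ω, G' (incV W T n ω) ∂P ∧ (∫ ω, G' (incV W T n ω) ∂P) ^ 2 ≤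
      Real.exp Q * ∫ ω, G' (fun i => incV W T n ω i + α (incV W T n ω) i) ∂P ∧
      (∫ ω, G' (fun i => incV W T n ω i + α (incV W T n ω) i) ∂P - ∫ ω, G' (incV W T n ω) ∂P) ^ 2 ≤
      Real.exp (3 * Q) * √(Q * ∫ ω, (∑ i, α (incV W T n ω) i ^ 2) / l ∂P) at hmain
  rw [e1, e2] at hmain
  refine ⟨hmain.1, hmain.2.1, hmain.2.2.trans ?_⟩
  have hQ0 : 0 ≤ Q := by positivity
  refine mul_le_mul_of_nonneg_left (Real.sqrt_le_sqrt (mul_le_mul_of_nonneg_left ?_ hQ0))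
    (Real.exp_pos _).le
  have ham : ∀ j, AEStronglyMeasurable (a j) P := fun j => by
    have : Measurable (a j) := (ha j).mono
      (((trunc_meas n _).comp (incV_meas hW.1 T n)).comap_le) le_rfl
    exact this.aestronglyMeasurable
  have hai : ∀ j, Integrable (fun ω => |a j ω|) P := fun j =>
    (Integrable.of_bound (ham j) B (by simpa using hb j)).abs
  rw [← integral_finset_sum _ (fun j _ => hai j), ← integral_const_mul]
  refine integral_mono_of_nonneg (ae_of_all _ fun ω => by positivity)
    ((integrable_finset_sum _ fun j _ => hai j).const_mul _) ?_
  filter_upwards [hαω] with ω hω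
  have e3 : ∑ i, α (incV W T n ω) i ^ 2 ≤ ∑ i : Fin n, K * (T / n) * (|a (i / M) ω| / M) := by
    refine Finset.sum_le_sum fun i _ => ?_
    rw [← sq_abs, sq]
    refine mul_le_mul (hαb _ i) (le_of_eq ?_) (abs_nonneg _) (by positivity)
    rw [hω, abs_div, abs_of_pos hMr]
  have hblk : ∑ i ∈ Finset.range n, |a (i / M) ω| / M = M * ∑ j ∈ Finset.range N, |a j ω| / M :=
    sum_range_blocks (fun j => |a j ω| / M) N M hM
  rw [← Finset.mul_sum, Fin.sum_univ_eq_sum_range (fun l => |a (l / M) ω| / M),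
    hblk, ← Finset.sum_div] at e3
  calc _ ≤ _ := div_le_div_of_nonneg_right e3 hl0.le
    _ = _ := by
      rw [hl, hTH1]; field_simp

end
end FBMProof

open MeasureTheory ProbabilityTheory Real

namespace FBMProof
open scoped ENNReal Topology
open Filter

section
variable {Ω : Type*} [mΩ : MeasurableSpace Ω] {P : Measure Ω} [IsProbabilityMeasure P]
  {H : ℝ} {W : ℝ → Ω → ℝ}

/-- sigma-algebra generated by the path on `[0,t]` -/
noncomputable def past (W : ℝ → Ω → ℝ) (t : ℝ) : MeasurableSpace Ω :=
  ⨆ s ∈ Set.Icc (0 : ℝ) t, MeasurableSpace.comap (W s) inferInstance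

lemma past_le (hWm : ∀ t, Measurable (W t)) (t : ℝ) : past W t ≤ mΩ :=
  iSup₂_le fun s _ => (hWm s).comap_le

lemma past_mono {s t : ℝ} (h : s ≤ t) : past W s ≤ past W t :=
  iSup₂_le fun r hr => le_iSup₂_of_le r ⟨hr.1, hr.2.trans h⟩ le_rfl

lemma meas_past {s t : ℝ} (hs : s ∈ Set.Icc (0 : ℝ) t) : Measurable[past W t] (W s) :=
  measurable_iff_comap_le.2 (le_iSup₂_of_le s hs le_rfl)

/-- dyadic grid sigma-algebra -/
noncomputable def gridA (W : ℝ → Ω → ℝ) (T : ℝ) (N j k : ℕ) : MeasurableSpace Ω :=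
  ⨆ i ∈ Set.Iic (j * 2 ^ k), MeasurableSpace.comap (W (T / ((N * 2 ^ k : ℕ) : ℝ) * (i : ℕ))) inferInstance

lemma gridA_mono (T : ℝ) (N j : ℕ) : Monotone (gridA W T N j) := by
  refine monotone_nat_of_le_succ fun k => iSup₂_le fun i hi => ?_
  refine le_iSup₂_of_le (i * 2) ?_ ?_
  · simp only [Set.mem_Iic] at *
    rw [pow_succ]; nlinarith
  · apply le_of_eq
    congr 2
    push_cast
    rw [pow_succ, ← mul_assoc, ← div_div]
    ring

lemma gridA_le (hWm : ∀ t, Measurable (W t)) (T : ℝ) (N j k : ℕ) : gridA W T N j k ≤ mΩ :=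
  iSup₂_le fun s _ => (hWm _).comap_le

lemma gridA_le_comap (hW0 : ∀ ω, W 0 ω = 0) (T : ℝ) {N j : ℕ} (hj : j ≤ N) (k : ℕ) :
    gridA W T N j k ≤ MeasurableSpace.comap
      (fun ω => trunc (N * 2 ^ k) (j * 2 ^ k) (incV W T (N * 2 ^ k) ω)) inferInstance := by
  refine iSup₂_le fun i hi => ?_
  simp only [Set.mem_Iic] at hi
  have hi2 : i ≤ N * 2 ^ k := hi.trans (Nat.mul_le_mul_right _ hj)
  have e : W (T / ((N * 2 ^ k : ℕ) : ℝ) * (i : ℕ)) =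
      (fun y : Fin (N * 2 ^ k) → ℝ => ∑ l, trunc (N * 2 ^ k) i y l) ∘
        (fun ω => trunc (N * 2 ^ k) (j * 2 ^ k) (incV W T (N * 2 ^ k) ω)) := by
    ext ω
    simp only [Function.comp]
    rw [← inc_sum hW0, ← fin_sum_trunc _ hi2]
    refine Finset.sum_congr rfl fun l _ => ?_
    simp only [trunc, incV]
    by_cases h1 : (l : ℕ) < i
    · simp [h1, lt_of_lt_of_le h1 hi]
    · simp [h1]
  rw [e, ← MeasurableSpace.comap_comp]
  refine MeasurableSpace.comap_mono (Measurable.comap_le ?_)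
  exact Finset.measurable_sum _ fun l _ => (measurable_pi_apply l).comp (trunc_meas _ _)

lemma past_le_gridA (hWc : ∀ ω, Continuous fun t => W t ω) {T : ℝ} (hT : 0 < T) {N : ℕ} (hN : 0 < N)
    (j : ℕ) : past W (T / N * j) ≤ ⨆ k, gridA W T N j k := by
  refine iSup₂_le fun s hs => ?_
  rw [← measurable_iff_comap_le]
  have hNr : (0 : ℝ) < N := by exact_mod_cast hN
  let f : ℕ → ℝ := fun k => T / ((N * 2 ^ k : ℕ) : ℝ) * (⌊s * ((N * 2 ^ k : ℕ) : ℝ) / T⌋₊ : ℕ)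
  have hf : ∀ k, Measurable[⨆ k, gridA W T N j k] (W (f k)) := by
    intro k
    refine measurable_iff_comap_le.2 (le_trans ?_ (le_iSup _ k))
    refine le_iSup₂_of_le (⌊s * ((N * 2 ^ k : ℕ) : ℝ) / T⌋₊ : ℕ) ?_ le_rfl
    simp only [Set.mem_Iic]
    apply Nat.floor_le_of_le
    push_cast
    rw [div_le_iff₀ hT]
    have h2 := hs.2
    rw [div_mul_eq_mul_div, le_div_iff₀ hNr] at h2
    have : (0 : ℝ) < 2 ^ k := by positivity
    nlinarith
  have hpow : Tendsto (fun k : ℕ => ((N * 2 ^ k : ℕ) : ℝ) / T) atTop atTop := by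
    refine Tendsto.atTop_div_const hT ?_
    refine tendsto_natCast_atTop_atTop.comp ?_
    exact (tendsto_pow_atTop_atTop_of_one_lt (by norm_num : 1 < 2)).const_mul_atTop' hN
  have hlim : Tendsto f atTop (𝓝 s) := by
    have h := (tendsto_nat_floor_mul_div_atTop (R := ℝ) hs.1).comp hpow
    refine h.congr fun k => ?_
    simp only [Function.comp, f]
    rw [div_div_eq_mul_div, mul_div_assoc]
    ring
  have : Tendsto (fun k => W (f k)) atTop (𝓝 (W s)) := by
    rw [tendsto_pi_nhds]
    intro ω
    exact ((hWc ω).tendsto s).comp hlim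
  exact @measurable_of_tendsto_metrizable _ _ (⨆ k, gridA W T N j k) _ _ _ _ _ _ hf this

lemma girs_step (hW : IsFractionalBM P H W) (hH : 0 < H) (hH2 : H ≤ 1 / 2)
    (hW0 : ∀ ω, W 0 ω = 0) (hWc : ∀ ω, Continuous fun t => W t ω)
    {T K : ℝ} (hT : 0 < T) (hK : 0 ≤ K) {N : ℕ} (hN : 0 < N)
    (a : ℕ → Ω → ℝ)
    (ha : ∀ j < N, Measurable[past W (T / N * j)] (a j))
    (hb : ∀ j < N, ∀ᵐ ω ∂P, |a j ω| ≤ K * (T / N))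
    {m : ℕ} (c : Fin m → ℕ) (hc : ∀ r, c r ≤ N)
    (G : (Fin m → ℝ) → ℝ) (hG : Continuous G) (hG0 : ∀ y, 0 ≤ G y) (hG1 : ∀ y, G y ≤ 1) :
    (∫ ω, G (fun r => W (T / N * c r) ω + ∑ j ∈ Finset.range (c r), a j ω) ∂P) ^ 2 ≤
      Real.exp (K ^ 2 * T ^ 2 / (2 * H * T ^ (2 * H))) * ∫ ω, G (fun r => W (T / N * c r) ω) ∂P ∧
    (∫ ω, G (fun r => W (T / N * c r) ω) ∂P) ^ 2 ≤ Real.exp (K ^ 2 * T ^ 2 / (2 * H * T ^ (2 * H))) *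
      ∫ ω, G (fun r => W (T / N * c r) ω + ∑ j ∈ Finset.range (c r), a j ω) ∂P ∧
    (∫ ω, G (fun r => W (T / N * c r) ω + ∑ j ∈ Finset.range (c r), a j ω) ∂P
      - ∫ ω, G (fun r => W (T / N * c r) ω) ∂P) ^ 2 ≤
      Real.exp (3 * (K ^ 2 * T ^ 2 / (2 * H * T ^ (2 * H)))) * √((K ^ 2 * T ^ 2 / (2 * H * T ^ (2 * H))) *
        (K * T / (2 * H * T ^ (2 * H)) * ∑ j ∈ Finset.range N, ∫ ω, |a j ω| ∂P)) := by
  have hTH : 0 < T ^ (2 * H) := rpow_pos_of_pos hT _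
  have ham : ∀ j < N, Measurable (a j) := fun j hj => (ha j hj).mono (past_le hW.1 _) le_rfl
  have hai : ∀ j < N, Integrable (a j) P := fun j hj =>
    Integrable.of_bound (ham j hj).aestronglyMeasurable _ (by simpa using hb j hj)
  let A : ℕ → ℕ → Ω → ℝ := fun k j => if j < N then P[a j | gridA W T N j k] else fun _ => 0
  have hAm : ∀ k j, Measurable[MeasurableSpace.comap
      (fun ω => trunc (N * 2 ^ k) (j * 2 ^ k) (incV W T (N * 2 ^ k) ω)) inferInstance] (A k j) := by
    intro k j
    simp only [A]
    split_ifs with hj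
    · exact stronglyMeasurable_condExp.measurable.mono (gridA_le_comap hW0 T hj.le k) le_rfl
    · exact measurable_const
  have hKT : 0 ≤ K * (T / N) := by positivity
  have hAb : ∀ k j, ∀ᵐ ω ∂P, |A k j ω| ≤ K * (T / N) := by
    intro k j
    simp only [A]
    split_ifs with hj
    · exact ae_bdd_condExp_of_ae_bdd (R := ⟨K * (T / N), hKT⟩) (hb j hj)
    · simpa using hKT
  have hAi : ∀ k, ∀ j < N, ∫ ω, |A k j ω| ∂P ≤ ∫ ω, |a j ω| ∂P := by
    intro k j hj
    simp only [A, hj, if_true]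
    exact integral_abs_condExp_le _
  have hAt : ∀ᵐ ω ∂P, ∀ j < N, Tendsto (fun k => A k j ω) atTop (𝓝 (a j ω)) := by
    rw [ae_all_iff]; intro j
    by_cases hj : j < N
    · let F : Filtration ℕ mΩ := ⟨gridA W T N j, gridA_mono T N j, gridA_le hW.1 T N j⟩
      have := (hai j hj).tendsto_ae_condExp (ℱ := F)
        (((ha j hj).mono (past_le_gridA hWc hT hN j) le_rfl).stronglyMeasurable)
      filter_upwards [this] with ω hω _
      simp only [A, hj, if_true]
      exact hω
    · exact ae_of_all _ fun ω h => absurd h hj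
  have key := fun k => girs_fixed hW hH hH2 hW0 hT hK hN (M := 2 ^ k) (by positivity) (A k)
    (hAm k) (hAb k) c hc G hG.measurable hG0 hG1
  have hlim : Tendsto (fun k => ∫ ω, G (fun r => W (T / N * c r) ω + ∑ j ∈ Finset.range (c r), A k j ω) ∂P)
      atTop (𝓝 (∫ ω, G (fun r => W (T / N * c r) ω + ∑ j ∈ Finset.range (c r), a j ω) ∂P)) := by
    refine tendsto_integral_of_dominated_convergence (fun _ => 1) ?_ (integrable_const _) ?_ ?_
    · intro k
      refine (hG.measurable.comp (measurable_pi_lambda _ fun r => (hW.1 _).add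
        (Finset.measurable_sum _ fun j hj => ?_))).aestronglyMeasurable
      exact (hAm k j).mono (((trunc_meas _ _).comp (incV_meas hW.1 T _)).comap_le) le_rfl
    · intro k
      refine ae_of_all _ fun ω => ?_
      rw [Real.norm_of_nonneg (hG0 _)]; exact hG1 _
    · filter_upwards [hAt] with ω hω
      refine (hG.tendsto _).comp ?_
      rw [tendsto_pi_nhds]
      intro r
      refine tendsto_const_nhds.add (tendsto_finset_sum _ fun j hj => hω j ?_)
      exact lt_of_lt_of_le (Finset.mem_range.1 hj) (hc r)
  refine ⟨le_of_tendsto' (hlim.pow 2) fun k => (key k).1,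
    ge_of_tendsto' (hlim.const_mul _) fun k => (key k).2.1,
    le_of_tendsto' ((hlim.sub_const _).pow 2) fun k => (key k).2.2.trans ?_⟩
  have hS := Finset.sum_le_sum (s := Finset.range N) fun j hj => hAi k j (Finset.mem_range.1 hj)
  revert hS
  generalize ∑ j ∈ Finset.range N, ∫ ω, |A k j ω| ∂P = S1
  generalize ∑ j ∈ Finset.range N, ∫ ω, |a j ω| ∂P = S2
  intro hS
  gcongr

theorem thmG (hW : IsFractionalBM P H W) (hH : 0 < H) (hH2 : H ≤ 1 / 2)
    (hW0 : ∀ ω, W 0 ω = 0) (hWc : ∀ ω, Continuous fun t => W t ω)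
    {T K : ℝ} (hT : 0 < T) (hK : 0 ≤ K) (h : ℝ → Ω → ℝ)
    (h0 : ∀ᵐ ω ∂P, h 0 ω = 0)
    (hL : ∀ᵐ ω ∂P, ∀ s ∈ Set.Icc 0 T, ∀ t ∈ Set.Icc 0 T, |h t ω - h s ω| ≤ K * |t - s|)
    (had : ∀ t ∈ Set.Icc 0 T, ∃ g, Measurable[past W t] g ∧ h t =ᵐ[P] g)
    {m : ℕ} (τ : Fin m → ℝ) (hτ : ∀ r, τ r ∈ Set.Icc 0 T)
    (G : (Fin m → ℝ) → ℝ) (hG : Continuous G) (hG0 : ∀ y, 0 ≤ G y) (hG1 : ∀ y, G y ≤ 1) :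
    (∫ ω, G (fun r => W (τ r) ω + h (τ r) ω) ∂P) ^ 2 ≤
      Real.exp (K ^ 2 * T ^ 2 / (2 * H * T ^ (2 * H))) * ∫ ω, G (fun r => W (τ r) ω) ∂P ∧
    (∫ ω, G (fun r => W (τ r) ω) ∂P) ^ 2 ≤ Real.exp (K ^ 2 * T ^ 2 / (2 * H * T ^ (2 * H))) *
      ∫ ω, G (fun r => W (τ r) ω + h (τ r) ω) ∂P ∧
    ∀ e : Ω → ℝ, Integrable e P → (∀ N : ℕ, 0 < N → ∀ᵐ ω ∂P, ∑ j ∈ Finset.range N,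
        |h (T / N * ((j + 1 : ℕ) : ℝ)) ω - h (T / N * (j : ℕ)) ω| ≤ e ω) →
    (∫ ω, G (fun r => W (τ r) ω + h (τ r) ω) ∂P - ∫ ω, G (fun r => W (τ r) ω) ∂P) ^ 2 ≤
      Real.exp (3 * (K ^ 2 * T ^ 2 / (2 * H * T ^ (2 * H)))) * √((K ^ 2 * T ^ 2 / (2 * H * T ^ (2 * H))) *
        (K * T / (2 * H * T ^ (2 * H)) * ∫ ω, e ω ∂P)) := by
  have hTH : 0 < T ^ (2 * H) := rpow_pos_of_pos hT _
  have hg : ∀ t, ∃ g, t ∈ Set.Icc 0 T → Measurable[past W t] g ∧ h t =ᵐ[P] g := by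
    intro t
    by_cases ht : t ∈ Set.Icc 0 T
    · obtain ⟨g, h1⟩ := had t ht; exact ⟨g, fun _ => h1⟩
    · exact ⟨0, fun h => absurd h ht⟩
  choose g hg using hg
  -- grid points
  have hgrid : ∀ N : ℕ, 0 < N → ∀ j : ℕ, j ≤ N → T / N * j ∈ Set.Icc 0 T := by
    intro N hN j hj
    have hNr : (0 : ℝ) < N := by exact_mod_cast hN
    have hj' : (j : ℝ) ≤ N := by exact_mod_cast hj
    refine ⟨by positivity, ?_⟩
    rw [div_mul_eq_mul_div, div_le_iff₀ hNr]
    nlinarith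
  let a : ℕ → ℕ → Ω → ℝ := fun N j ω => g (T / N * j) ω - g (T / N * (j - 1 : ℕ)) ω
  let c : ℕ → Fin m → ℕ := fun N r => ⌊τ r * (N / T)⌋₊
  have hc : ∀ N, 0 < N → ∀ r, c N r ≤ N := by
    intro N hN r
    have hNr : (0 : ℝ) < N := by exact_mod_cast hN
    apply Nat.floor_le_of_le
    rw [mul_div_assoc', div_le_iff₀ hT]
    nlinarith [(hτ r).2]
  have hgh : ∀ᵐ ω ∂P, ∀ N : ℕ, 0 < N → ∀ j : ℕ, j ≤ N → g (T / N * j) ω = h (T / N * j) ω := by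
    rw [ae_all_iff]; intro N
    by_cases hN : 0 < N
    · have : ∀ᵐ ω ∂P, ∀ j : ℕ, j ≤ N → g (T / N * j) ω = h (T / N * j) ω := by
        rw [ae_all_iff]; intro j
        by_cases hj : j ≤ N
        · filter_upwards [(hg _ (hgrid N hN j hj)).2] with ω hω _
          exact hω.symm
        · exact ae_of_all _ fun ω h => absurd h hj
      filter_upwards [this] with ω hω _
      exact hω
    · exact ae_of_all _ fun ω h => absurd h hN
  have key := fun (N : ℕ) (hN : 0 < N) => girs_step hW hH hH2 hW0 hWc hT hK hN (a N)
    (by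
      intro j hj
      refine Measurable.sub (hg _ (hgrid N hN j hj.le)).1 ?_
      refine ((hg _ (hgrid N hN (j - 1) (by omega))).1).mono (past_mono ?_) le_rfl
      have : ((j - 1 : ℕ) : ℝ) ≤ j := by exact_mod_cast Nat.sub_le _ _
      gcongr)
    (by
      intro j hj
      filter_upwards [hgh, hL] with ω h1 h2
      simp only [a]
      rw [h1 N hN j hj.le, h1 N hN (j - 1) (by omega)]
      refine (h2 _ (hgrid N hN (j - 1) (by omega)) _ (hgrid N hN j hj.le)).trans ?_
      gcongr
      have hNr : (0 : ℝ) < N := by exact_mod_cast hN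
      rw [← mul_sub, abs_mul, abs_of_pos (by positivity : 0 < T / (N : ℝ))]
      refine mul_le_of_le_one_right (by positivity) ?_
      rcases Nat.eq_zero_or_pos j with hj0 | hj0
      · simp [hj0]
      · rw [Nat.cast_sub hj0]; simp)
    (c N) (hc N hN) G hG hG0 hG1
  have hsum : ∀ᵐ ω ∂P, ∀ N : ℕ, 0 < N → ∀ p ≤ N,
      ∑ j ∈ Finset.range p, a N j ω = h (T / N * (p - 1 : ℕ)) ω := by
    filter_upwards [hgh, h0] with ω h1 h2 N hN p
    induction p with
    | zero => intro _; simp [h2]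
    | succ p ih =>
      intro hp
      rw [Finset.sum_range_succ, ih (by omega)]
      simp only [a]
      rw [h1 N hN p (by omega), h1 N hN (p - 1) (by omega)]
      simp
  have hcl : ∀ r, Tendsto (fun n : ℕ => T / ((n + 1 : ℕ) : ℝ) * (c (n + 1) r : ℕ)) atTop (𝓝 (τ r)) := by
    intro r
    have hpow : Tendsto (fun n : ℕ => ((n + 1 : ℕ) : ℝ) / T) atTop atTop :=
      Tendsto.atTop_div_const hT (tendsto_natCast_atTop_atTop.comp (tendsto_add_atTop_nat 1))
    refine ((tendsto_nat_floor_mul_div_atTop (R := ℝ) (hτ r).1).comp hpow).congr fun k => ?_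
    simp only [Function.comp, c]
    rw [div_div_eq_mul_div, mul_div_assoc]
    ring
  have hinv : Tendsto (fun n : ℕ => T / ((n + 1 : ℕ) : ℝ)) atTop (𝓝 0) :=
    Tendsto.const_div_atTop (tendsto_natCast_atTop_atTop.comp (tendsto_add_atTop_nat 1)) _
  have hcl2 : ∀ r, Tendsto (fun n : ℕ => T / ((n + 1 : ℕ) : ℝ) * (c (n + 1) r - 1 : ℕ)) atTop (𝓝 (τ r)) := by
    intro r
    have hl := (hcl r).sub hinv
    rw [sub_zero] at hl
    refine tendsto_of_tendsto_of_tendsto_of_le_of_le hl (hcl r) (fun n => ?_) (fun n => ?_)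
    · have : (c (n + 1) r : ℝ) - 1 ≤ ((c (n + 1) r - 1 : ℕ) : ℝ) := by
        rw [sub_le_iff_le_add]; exact_mod_cast (by omega)
      have h3 : 0 ≤ T / ((n + 1 : ℕ) : ℝ) := by positivity
      have := mul_le_mul_of_nonneg_left this h3
      simp only
      linarith
    · have : ((c (n + 1) r - 1 : ℕ) : ℝ) ≤ c (n + 1) r := by exact_mod_cast Nat.sub_le _ _
      exact mul_le_mul_of_nonneg_left this (by positivity)
  have hlim0 : Tendsto (fun n : ℕ => ∫ ω, G (fun r => W (T / ((n + 1 : ℕ) : ℝ) * c (n + 1) r) ω) ∂P) atTop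
      (𝓝 (∫ ω, G (fun r => W (τ r) ω) ∂P)) := by
    refine tendsto_integral_of_dominated_convergence (fun _ => 1) ?_ (integrable_const _) ?_ ?_
    · intro k
      exact (hG.measurable.comp (measurable_pi_lambda _ fun r => hW.1 _)).aestronglyMeasurable
    · intro k
      refine ae_of_all _ fun ω => ?_
      rw [Real.norm_of_nonneg (hG0 _)]; exact hG1 _
    · refine ae_of_all _ fun ω => (hG.tendsto _).comp ?_
      rw [tendsto_pi_nhds]
      intro r
      exact ((hWc ω).tendsto _).comp (hcl r)
  have hlim1 : Tendsto (fun n : ℕ => ∫ ω, G (fun r => W (T / ((n + 1 : ℕ) : ℝ) * c (n + 1) r) ω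
      + ∑ j ∈ Finset.range (c (n + 1) r), a (n + 1) j ω) ∂P) atTop
      (𝓝 (∫ ω, G (fun r => W (τ r) ω + h (τ r) ω) ∂P)) := by
    refine tendsto_integral_of_dominated_convergence (fun _ => 1) ?_ (integrable_const _) ?_ ?_
    · intro k
      refine (hG.measurable.comp (measurable_pi_lambda _ fun r => (hW.1 _).add
        (Finset.measurable_sum _ fun j hj => ?_))).aestronglyMeasurable
      have hj' := hc (k + 1) (Nat.succ_pos k) r
      have hj2 := Finset.mem_range.1 hj
      have hm : ∀ i ≤ k + 1, Measurable (g (T / ((k + 1 : ℕ) : ℝ) * (i : ℕ))) := fun i hi =>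
        (hg _ (hgrid (k + 1) (Nat.succ_pos k) i hi)).1.mono (past_le hW.1 _) le_rfl
      exact (hm j (by omega)).sub (hm (j - 1) (by omega))
    · intro k
      refine ae_of_all _ fun ω => ?_
      rw [Real.norm_of_nonneg (hG0 _)]; exact hG1 _
    · filter_upwards [hsum, hL] with ω h1 h2
      refine (hG.tendsto _).comp ?_
      rw [tendsto_pi_nhds]
      intro r
      refine (((hWc ω).tendsto _).comp (hcl r)).add ?_
      have e : (fun n : ℕ => ∑ j ∈ Finset.range (c (n + 1) r), a (n + 1) j ω) =
          fun n : ℕ => h (T / ((n + 1 : ℕ) : ℝ) * (c (n + 1) r - 1 : ℕ)) ω := by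
        ext n
        exact h1 (n + 1) (Nat.succ_pos n) _ (hc _ (Nat.succ_pos n) r)
      rw [e, tendsto_iff_dist_tendsto_zero]
      have h3 := ((tendsto_iff_dist_tendsto_zero.1 (hcl2 r)).const_mul K)
      rw [mul_zero] at h3
      refine squeeze_zero (fun n => dist_nonneg) (fun n => ?_) h3
      rw [Real.dist_eq, Real.dist_eq]
      refine h2 _ (hτ r) _ (hgrid (n + 1) (Nat.succ_pos n) _ ?_)
      have := hc (n + 1) (Nat.succ_pos n) r
      omega
  refine ⟨le_of_tendsto_of_tendsto' (hlim1.pow 2) (hlim0.const_mul _) fun n => (key (n + 1) (Nat.succ_pos n)).1,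
    le_of_tendsto_of_tendsto' (hlim0.pow 2) (hlim1.const_mul _) fun n => (key (n + 1) (Nat.succ_pos n)).2.1,
    fun e he hle => le_of_tendsto' ((hlim1.sub hlim0).pow 2) fun n =>
      (key (n + 1) (Nat.succ_pos n)).2.2.trans ?_⟩
  have hN : 0 < n + 1 := Nat.succ_pos n
  have hintg : ∀ j ∈ Finset.range (n + 1), Integrable (fun ω => |a (n + 1) j ω|) P := by
    intro j hj
    have hj := Finset.mem_range.1 hj
    have hm : ∀ i ≤ n + 1, Measurable (g (T / ((n + 1 : ℕ) : ℝ) * (i : ℕ))) := fun i hi =>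
      (hg _ (hgrid (n + 1) (Nat.succ_pos n) i hi)).1.mono (past_le hW.1 _) le_rfl
    refine (Integrable.of_bound ((hm j (by omega)).sub (hm (j - 1) (by omega))).aestronglyMeasurable
      (K * T) ?_).abs
    filter_upwards [hgh, hL] with ω h1 h2
    simp only [Pi.sub_apply]
    rw [h1 _ hN j (by omega), h1 _ hN (j - 1) (by omega), Real.norm_eq_abs]
    refine (h2 _ (hgrid _ hN (j - 1) (by omega)) _ (hgrid _ hN j (by omega))).trans ?_
    gcongr
    have h3 := hgrid _ hN (j - 1) (by omega)
    have h4 := hgrid _ hN j (by omega)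
    rw [abs_le]; constructor <;> linarith [h3.1, h3.2, h4.1, h4.2]
  have hfin : ∑ j ∈ Finset.range (n + 1), ∫ ω, |a (n + 1) j ω| ∂P ≤ ∫ ω, e ω ∂P := by
    rw [← integral_finset_sum _ hintg]
    refine integral_mono_ae (integrable_finset_sum _ hintg) he ?_
    filter_upwards [hgh, hle (n + 1) hN] with ω h1 h2
    refine le_trans ?_ h2
    rw [Finset.sum_range_succ']
    have e0 : |a (n + 1) 0 ω| = 0 := by simp [a]
    rw [e0, add_zero]
    refine (Finset.sum_le_sum (g := fun j : ℕ => |h (T / ((n + 1 : ℕ) : ℝ) * ((j + 1 : ℕ) : ℝ)) ω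
      - h (T / ((n + 1 : ℕ) : ℝ) * (j : ℕ)) ω|) ?_).trans
      (Finset.sum_le_sum_of_subset_of_nonneg (Finset.range_subset_range.2 (Nat.le_succ n)) fun _ _ _ => abs_nonneg _)
    intro j hj
    have hj := Finset.mem_range.1 hj
    simp only [a]
    rw [h1 _ hN (j + 1) (by omega), h1 _ hN (j + 1 - 1) (by omega)]
    simp
  gcongr

end
end FBMProof

open MeasureTheory ProbabilityTheory Real

namespace FBMProof
open scoped ENNReal Topology
open Filter

section
variable {Ω : Type*} [mΩ : MeasurableSpace Ω] {P : Measure Ω} [IsProbabilityMeasure P]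
  {H : ℝ} {W : ℝ → Ω → ℝ}

lemma exp_three_le : Real.exp 3 ≤ 25 := by
  have h : Real.exp 3 = Real.exp 1 ^ 3 := by rw [← Real.exp_nat_mul]; norm_num
  rw [h]
  have h1 := Real.exp_one_lt_d9
  have h0 := Real.exp_pos 1
  calc Real.exp 1 ^ 3 ≤ (2.72 : ℝ) ^ 3 := by gcongr; linarith
    _ ≤ 25 := by norm_num

lemma gauss_shift {Z : Ω → ℝ} (hZm : Measurable Z) (hZ : HasGaussianLaw Z P) (h0 : ∫ ω, Z ω ∂P = 0)
    {l : ℝ} (hl : 0 < l)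
    (hv : l ≤ Var[Z; P]) (ψ : ℝ → ℝ) (hψ : Measurable ψ) (h0ψ : ∀ x, 0 ≤ ψ x) (h1ψ : ∀ x, ψ x ≤ 1)
    (x y : ℝ) :
    |∫ ω, ψ (Z ω + x) ∂P - ∫ ω, ψ (Z ω + y) ∂P| ≤ 5 * |x - y| / √l := by
  have hintg : ∀ x, 0 ≤ ∫ ω, ψ (Z ω + x) ∂P ∧ ∫ ω, ψ (Z ω + x) ∂P ≤ 1 := by
    intro x
    refine ⟨integral_nonneg fun ω => h0ψ _, ?_⟩
    have := integral_mono_of_nonneg (μ := P) (f := fun ω => ψ (Z ω + x)) (g := fun _ => (1 : ℝ))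
      (ae_of_all _ fun ω => h0ψ _) (integrable_const _) (ae_of_all _ fun ω => h1ψ _)
    simpa using this
  set Q := (x - y) ^ 2 / l with hQ
  have hQ0 : 0 ≤ Q := by positivity
  have hsl : 0 < √l := Real.sqrt_pos.2 hl
  have hrhs : (5 * |x - y| / √l) ^ 2 = 25 * Q := by
    rw [div_pow, mul_pow, sq_abs, Real.sq_sqrt hl.le, hQ]; ring
  refine abs_le_of_sq_le_sq ?_ (by positivity : (0 : ℝ) ≤ 5 * |x - y| / √l)
  rw [hrhs]
  rcases le_or_gt Q 1 with h | h
  swap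
  · obtain ⟨a1, a2⟩ := hintg x
    obtain ⟨b1, b2⟩ := hintg y
    nlinarith
  have hY : HasGaussianLaw (fun ω (_ : Fin 1) => Z ω) P := by
    let L : ℝ →L[ℝ] (Fin 1 → ℝ) := ContinuousLinearMap.pi fun _ => ContinuousLinearMap.id ℝ ℝ
    exact hZ.map_fun L
  have := (girs_fin (Y := fun (_ : Fin 1) => Z) hY (fun _ => h0) hl (by
    intro c
    simp only [Fin.sum_univ_one]
    rw [variance_const_mul]
    nlinarith [sq_nonneg (c 0)]) (fun _ _ => x - y) measurable_const (fun _ _ _ _ => rfl) Q (by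
    intro _
    simp only [Fin.sum_univ_one]
    rw [hQ, mul_div_cancel₀ _ hl.ne']) (fun v => ψ (v 0 + y)) (by fun_prop) (fun _ => h0ψ _)
    (fun _ => h1ψ _)).2.2
  simp only [Fin.sum_univ_one, integral_const, probReal_univ, smul_eq_mul, one_mul] at this
  rw [← hQ, Real.sqrt_mul_self hQ0] at this
  have e : ∀ ω, Z ω + (x - y) + y = Z ω + x := fun ω => by ring
  simp only [e] at this
  refine this.trans ?_
  refine mul_le_mul_of_nonneg_right ?_ hQ0
  exact (Real.exp_le_exp.2 (by linarith)).trans exp_three_le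

lemma indep_bound {E : Type*} [MeasurableSpace E] {Y : Ω → E} {Z : Ω → ℝ} (hY : Measurable Y)
    (hZ : Measurable Z) (hi : IndepFun Y Z P) (φ : E → ℝ) (hφ : Measurable φ)
    (hφi : Integrable (fun ω => φ (Y ω)) P) (L : E → ℝ) (hL : Measurable L)
    (ψ : ℝ → ℝ) (hψ : Measurable ψ) (hψ1 : ∀ x, |ψ x| ≤ 1)
    (B : ℝ) (hB : ∀ u, |∫ ω, ψ (Z ω + u) ∂P| ≤ B) :
    |∫ ω, φ (Y ω) * ψ (Z ω + L (Y ω)) ∂P| ≤ (∫ ω, |φ (Y ω)| ∂P) * B := by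
  have hprod := (indepFun_iff_map_prod_eq_prod_map_map hY.aemeasurable hZ.aemeasurable).1 hi
  have : IsProbabilityMeasure (P.map Y) := Measure.isProbabilityMeasure_map hY.aemeasurable
  have : IsProbabilityMeasure (P.map Z) := Measure.isProbabilityMeasure_map hZ.aemeasurable
  have hk : Measurable (fun p : E × ℝ => φ p.1 * ψ (p.2 + L p.1)) := by fun_prop
  have e1 : ∫ ω, φ (Y ω) * ψ (Z ω + L (Y ω)) ∂P =
      ∫ p, φ p.1 * ψ (p.2 + L p.1) ∂((P.map Y).prod (P.map Z)) := by
    rw [← hprod, integral_map (hY.prodMk hZ).aemeasurable hk.aestronglyMeasurable]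
  have hki : Integrable (fun p : E × ℝ => φ p.1 * ψ (p.2 + L p.1)) ((P.map Y).prod (P.map Z)) := by
    rw [← hprod, integrable_map_measure hk.aestronglyMeasurable (hY.prodMk hZ).aemeasurable]
    exact hφi.mul_bdd (c := 1) (by
      exact (hψ.comp (hZ.add (hL.comp hY))).aestronglyMeasurable) (ae_of_all _ fun ω => by simpa using hψ1 _)
  rw [e1, integral_prod _ hki]
  have e2 : ∀ y, ∫ z, φ y * ψ (z + L y) ∂(P.map Z) = φ y * ∫ ω, ψ (Z ω + L y) ∂P := by
    intro y
    rw [integral_const_mul, integral_map (f := fun z => ψ (z + L y)) hZ.aemeasurable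
      (hψ.comp (measurable_id.add_const _)).aestronglyMeasurable]
  simp only [e2]
  have hφi' : Integrable φ (P.map Y) := (integrable_map_measure hφ.aestronglyMeasurable hY.aemeasurable).2 hφi
  have e3 : ∫ ω, |φ (Y ω)| ∂P = ∫ y, |φ y| ∂(P.map Y) := by
    rw [integral_map hY.aemeasurable (by fun_prop)]
  rw [e3, ← integral_mul_const]
  refine (abs_integral_le_integral_abs).trans ?_
  refine integral_mono_of_nonneg (ae_of_all _ fun _ => abs_nonneg _) (hφi'.abs.mul_const _)
    (ae_of_all _ fun y => ?_)
  simp only [abs_mul]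
  exact mul_le_mul_of_nonneg_left (hB _) (abs_nonneg _)

/-- local nondeterminism -/
lemma fbm_lnd (hW : IsFractionalBM P H W) (hH : 0 < H) (hH2 : H ≤ 1 / 2) {s r : ℝ} (hs : 0 < s)
    (hsr : s < r) {n : ℕ} (hn : 0 < n) (c : Fin n → ℝ) :
    (r - s) ^ (2 * H) / 2 ≤ Var[fun ω => (W r ω - W s ω) - ∑ l, c l * inc W s n l ω; P] := by
  have hnr : (0 : ℝ) < n := by exact_mod_cast hn
  let tt : ℕ → ℝ := fun i => if i ≤ n then s / n * i else r
  have hle : ∀ i : ℕ, i ≤ n → s / n * i ≤ s := by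
    intro i hi
    have : (i : ℝ) ≤ n := by exact_mod_cast hi
    rw [div_mul_eq_mul_div, div_le_iff₀ hnr]; nlinarith
  have htt : Monotone tt := by
    intro i j hij
    simp only [tt]
    have hij' : (i : ℝ) ≤ j := by exact_mod_cast hij
    split_ifs with h1 h2 h2
    · gcongr
    · linarith [hle i h1]
    · omega
    · rfl
  have htn : tt n = s := by simp only [tt, le_refl, if_true]; field_simp
  have htn1 : tt (n + 1) = r := by simp [tt]
  have hp : ∀ i, 0 ≤ tt i := fun i => by
    have := htt (Nat.zero_le i)
    simpa [tt] using this
  have key := fbm_var_lower hW hH hH2 tt htt (by simp [tt]) (n + 1) (Fin.snoc (fun l => - c l) 1)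
  rw [Fin.sum_univ_castSucc] at key
  have e : (fun ω => ∑ i : Fin (n + 1), (Fin.snoc (fun l => - c l) 1 : Fin (n + 1) → ℝ) i *
      (W (tt (i + 1)) ω - W (tt i) ω)) = fun ω => (W r ω - W s ω) - ∑ l, c l * inc W s n l ω := by
    ext ω
    rw [Fin.sum_univ_castSucc]
    simp only [Fin.snoc_castSucc, Fin.snoc_last, Fin.val_last, htn, htn1, Fin.val_castSucc, one_mul]
    have : ∀ i : Fin n, -c i * (W (tt (i + 1)) ω - W (tt i) ω) = - (c i * inc W s n i ω) := by
      intro i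
      have h1 : tt ((i : ℕ) + 1) = s / n * (((i : ℕ) + 1 : ℕ) : ℝ) := by
        simp only [tt]; rw [if_pos (by omega)]
      have h2 : tt (i : ℕ) = s / n * ((i : ℕ) : ℝ) := by
        simp only [tt]; rw [if_pos (by omega)]
      rw [h1, h2]; simp only [inc]; ring
    simp only [this, Finset.sum_neg_distrib]
    ring
  rw [e] at key
  refine le_trans ?_ key
  have h1 : 0 ≤ ∑ i : Fin n, (Fin.snoc (fun l => - c l) 1 : Fin (n + 1) → ℝ) i.castSucc ^ 2 *
      (((tt (i.castSucc + 1)) ^ (2 * H) - (tt i.castSucc) ^ (2 * H) + (tt (n + 1) - tt i.castSucc) ^ (2 * H)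
        - (tt (n + 1) - tt (i.castSucc + 1)) ^ (2 * H)) / 2) := by
    refine Finset.sum_nonneg fun i _ => mul_nonneg (sq_nonneg _) ?_
    have a1 : (tt (i.castSucc)) ^ (2 * H) ≤ (tt (i.castSucc + 1)) ^ (2 * H) :=
      rpow_le_rpow (hp _) (htt (Nat.le_succ _)) (by positivity)
    have a2 : (tt (n + 1) - tt (i.castSucc + 1)) ^ (2 * H) ≤ (tt (n + 1) - tt (i.castSucc)) ^ (2 * H) := by
      refine rpow_le_rpow ?_ ?_ (by positivity)
      · have := htt (show ((i.castSucc : ℕ) + 1) ≤ n + 1 by simp)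
        linarith
      · linarith [htt (Nat.le_succ (i.castSucc : ℕ))]
    linarith
  have h2 : (r - s) ^ (2 * H) / 2 ≤ (Fin.snoc (fun l => - c l) 1 : Fin (n + 1) → ℝ) (Fin.last n) ^ 2 *
      (((tt (Fin.last n + 1)) ^ (2 * H) - (tt (Fin.last n)) ^ (2 * H) + (tt (n + 1) - tt (Fin.last n)) ^ (2 * H)
        - (tt (n + 1) - tt (Fin.last n + 1)) ^ (2 * H)) / 2) := by
    simp only [Fin.snoc_last, Fin.val_last, htn, htn1]
    rw [sub_self, zero_rpow (by positivity)]
    have : s ^ (2 * H) ≤ r ^ (2 * H) := rpow_le_rpow hs.le hsr.le (by positivity)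
    linarith
  linarith

lemma L1core (hW : IsFractionalBM P H W) (hH : 0 < H) (hH2 : H ≤ 1 / 2) (hW0 : ∀ ω, W 0 ω = 0)
    {s r : ℝ} (hs : 0 < s)
    (hsr : s < r) {n : ℕ} (hn : 0 < n) (φ : (Fin n → ℝ) → ℝ) (hφ : Measurable φ)
    (hφi : Integrable (fun ω => φ (incV W s n ω)) P)
    (ψ : ℝ → ℝ) (hψ : Measurable ψ) (h0ψ : ∀ x, 0 ≤ ψ x) (h1ψ : ∀ x, ψ x ≤ 1) (x y : ℝ) :
    |∫ ω, φ (incV W s n ω) * (ψ (W r ω + x) - ψ (W r ω + y)) ∂P| ≤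
      (∫ ω, |φ (incV W s n ω)| ∂P) * (10 * |x - y| / (r - s) ^ H) := by
  have hnr : (0 : ℝ) < n := by exact_mod_cast hn
  have hr : 0 ≤ r := by linarith
  -- projection
  have hmem : ∀ l : ℕ, MemLp (inc W s n l) 2 P := fun l =>
    fbm_inc_memLp hW (s := s / n * (l : ℕ)) (t := s / n * ((l + 1 : ℕ) : ℝ)) (by positivity) (by positivity)
  have hmr : MemLp (fun ω => W r ω - W s ω) 2 P := fbm_inc_memLp hW hs.le hr
  have hincm : ∀ l, Measurable (inc W s n l) := fun l => (hW.1 _).sub (hW.1 _)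
  have hproj : ∃ c : Fin n → ℝ, ∀ j : Fin n,
      cov[fun ω => (W r ω - W s ω) - ∑ l, c l * inc W s n l ω, inc W s n j; P] = 0 := by
    let Γ : Matrix (Fin n) (Fin n) ℝ := fun j i => cov[inc W s n i, inc W s n j; P]
    have hΓ : ∀ c j, Γ.mulVecLin c j = ∑ i : Fin n, cov[inc W s n i, inc W s n j; P] * c i := fun c j => rfl
    have hinj : Function.Injective Γ.mulVecLin := by
      rw [← LinearMap.ker_eq_bot, LinearMap.ker_eq_bot']
      intro c hc
      have hv : Var[fun ω => ∑ l : Fin n, c l * inc W s n l ω; P] = ∑ j, c j * Γ.mulVecLin c j := by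
        rw [← covariance_self (Finset.measurable_sum _ fun (l : Fin n) _ => ((hincm l).const_mul (c l))).aemeasurable]
        rw [covariance_fun_sum_fun_sum (fun i : Fin n => (hmem i).const_mul (c i))
          (fun i : Fin n => (hmem i).const_mul (c i))]
        rw [Finset.sum_comm]
        refine Finset.sum_congr rfl fun j _ => ?_
        rw [hΓ, Finset.mul_sum]
        refine Finset.sum_congr rfl fun i _ => ?_
        rw [covariance_const_mul_left, covariance_const_mul_right]; ring
      have hp := fbm_poincare hW hH hH2 hs n hn c
      change _ ≤ Var[fun ω => ∑ l : Fin n, c l * inc W s n l ω; P] at hp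
      rw [hv, hc] at hp
      simp only [Pi.zero_apply, mul_zero, Finset.sum_const_zero] at hp
      have hpos : 0 < 2 * H * s ^ (2 * H - 1) * (s / n) := by
        have := rpow_pos_of_pos hs (2 * H - 1)
        positivity
      have h0 : ∑ i, c i ^ 2 ≤ 0 := nonpos_of_mul_nonpos_right hp hpos
      ext i
      have := (Finset.sum_eq_zero_iff_of_nonneg (fun i _ => sq_nonneg (c i))).1
        (le_antisymm h0 (Finset.sum_nonneg fun i _ => sq_nonneg _)) i (Finset.mem_univ _)
      simpa using this
    obtain ⟨c, hc⟩ := (LinearMap.injective_iff_surjective.1 hinj)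
      (fun j => cov[fun ω => W r ω - W s ω, inc W s n j; P])
    refine ⟨c, fun j => ?_⟩
    rw [covariance_fun_sub_left hmr (memLp_finset_sum _ fun (l : Fin n) _ => (hmem l).const_mul (c l)) (hmem j)]
    rw [covariance_fun_sum_left (fun l : Fin n => (hmem l).const_mul (c l)) (hmem j)]
    have := congrFun hc j
    rw [hΓ] at this
    rw [← this, sub_eq_zero]
    refine Finset.sum_congr rfl fun i _ => ?_
    rw [covariance_const_mul_left]; ring
  obtain ⟨c, hc⟩ := hproj
  let Z : Ω → ℝ := fun ω => (W r ω - W s ω) - ∑ l, c l * inc W s n l ω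
  have hincm : ∀ l, Measurable (inc W s n l) := fun l => (hW.1 _).sub (hW.1 _)
  have hZm : Measurable Z := ((hW.1 _).sub (hW.1 _)).sub
    (Finset.measurable_sum _ fun l _ => (hincm l).const_mul _)
  -- joint Gaussian law
  have hjoint : HasGaussianLaw (fun ω => ((fun i : Fin n => inc W s n i ω), (fun _ : Fin 1 => Z ω))) P := by
    have h := fbm_gaussian_vec hW (n + 2) (fun i => if (i : ℕ) ≤ n then s / n * (i : ℕ) else r)
      (fun i => by split_ifs <;> positivity)
    let p : Fin (n + 2) → ((Fin (n + 2) → ℝ) →L[ℝ] ℝ) := fun i => ContinuousLinearMap.proj i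
    let I : Fin n → ((Fin (n + 2) → ℝ) →L[ℝ] ℝ) := fun l => p l.succ.castSucc - p l.castSucc.castSucc
    let L : (Fin (n + 2) → ℝ) →L[ℝ] ((Fin n → ℝ) × (Fin 1 → ℝ)) :=
      (ContinuousLinearMap.pi I).prod (ContinuousLinearMap.pi fun _ =>
        (p (Fin.last (n + 1)) - p (Fin.last n).castSucc) - ∑ l, c l • I l)
    have := h.map_fun L
    have e : (fun ω => ((fun i : Fin n => inc W s n i ω), (fun _ : Fin 1 => Z ω))) =
        fun ω => L (fun i : Fin (n + 2) => W (if (i : ℕ) ≤ n then s / n * ((i : ℕ) : ℝ) else r) ω) := by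
      have hI : ∀ (l : Fin n) ω, I l (fun i : Fin (n + 2) => W (if (i : ℕ) ≤ n then s / n * ((i : ℕ) : ℝ) else r) ω) =
          inc W s n l ω := by
        intro l ω
        have h1 : (l : ℕ) + 1 ≤ n := l.2
        have h2 : (l : ℕ) ≤ n := l.2.le
        simp [I, p, inc, h1, h2]
      have hs' : s / n * n = s := by field_simp
      ext ω i
      · exact (hI i ω).symm
      · simp only [Z, L, ContinuousLinearMap.prod_apply, ContinuousLinearMap.coe_pi',
          ContinuousLinearMap.sub_apply, ContinuousLinearMap.sum_apply, ContinuousLinearMap.smul_apply, hI]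
        simp [p, hs']
    rw [e]; exact this
  have hind : IndepFun (incV W s n) (fun ω (_ : Fin 1) => Z ω) P :=
    HasGaussianLaw.indepFun_of_covariance_eval (X := fun (i : Fin n) => inc W s n i) (Y := fun (_ : Fin 1) => Z)
      hjoint (fun i _ => by rw [covariance_comm]; exact hc i)
  have hind2 : IndepFun (incV W s n) Z P := by
    have hm0 : Measurable (fun v : Fin 1 → ℝ => v 0) := measurable_pi_apply (0 : Fin 1)
    exact hind.comp (φ := id) measurable_id hm0
  have hZg : HasGaussianLaw Z P := by
    have := hjoint.map_fun ((ContinuousLinearMap.proj (0 : Fin 1) : (Fin 1 → ℝ) →L[ℝ] ℝ).comp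
      (ContinuousLinearMap.snd ℝ (Fin n → ℝ) (Fin 1 → ℝ)))
    exact this
  have hZ0 : ∫ ω, Z ω ∂P = 0 := by
    have i1 : ∀ {t}, 0 ≤ t → Integrable (W t) P := fun ht => (fbm_memLp hW ht).integrable one_le_two
    have i2 : ∀ l : Fin n, Integrable (fun ω => c l * inc W s n l ω) P := fun l =>
      ((hmem l).integrable one_le_two).const_mul _
    simp only [Z]
    rw [integral_sub (f := fun ω => W r ω - W s ω) ((i1 hr).sub (i1 hs.le)) (integrable_finset_sum _ fun l _ => i2 l),
      integral_sub (i1 hr) (i1 hs.le), fbm_mean hW hr, fbm_mean hW hs.le,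
      integral_finset_sum _ fun l _ => i2 l]
    simp only [integral_const_mul, inc_mean hW hs n]
    simp
  have hrs : 0 < r - s := by linarith
  have hl : 0 < (r - s) ^ (2 * H) / 2 := by have := rpow_pos_of_pos hrs (2 * H); positivity
  have hsq : √((r - s) ^ (2 * H) / 2) = (r - s) ^ H / √2 := by
    rw [Real.sqrt_div (rpow_nonneg hrs.le _), mul_comm 2 H, rpow_mul hrs.le]
    congr 1
    rw [Real.rpow_two]
    exact Real.sqrt_sq (rpow_nonneg hrs.le _)
  have hB : ∀ u, |∫ ω, (ψ (Z ω + u + x) - ψ (Z ω + u + y)) ∂P| ≤ 10 * |x - y| / (r - s) ^ H := by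
    intro u
    have h := gauss_shift hZm hZg hZ0 hl (fbm_lnd hW hH hH2 hs hsr hn c) ψ hψ h0ψ h1ψ (u + x) (u + y)
    simp only [← add_assoc] at h
    have hi : ∀ x, Integrable (fun ω => ψ (Z ω + u + x)) P := fun x =>
      Integrable.of_bound (hψ.comp ((hZm.add_const _).add_const _)).aestronglyMeasurable 1 (ae_of_all _ fun ω => by
        rw [Real.norm_of_nonneg (h0ψ _)]; exact h1ψ _)
    rw [integral_sub (hi x) (hi y)]
    refine h.trans ?_
    rw [hsq, show u + x - (u + y) = x - y by ring, div_div_eq_mul_div]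
    have h2 : √2 ≤ 2 := by rw [Real.sqrt_le_left (by norm_num)]; norm_num
    have := rpow_pos_of_pos hrs H
    refine div_le_div_of_nonneg_right ?_ this.le
    nlinarith [abs_nonneg (x - y)]
  have := indep_bound (incV_meas hW.1 s n) hZm hind2 φ hφ hφi
    (fun v => ∑ l, v l + ∑ l, c l * v l) (by fun_prop) (fun z => ψ (z + x) - ψ (z + y)) (by fun_prop)
    (fun z => by rw [abs_le]; constructor <;> linarith [h0ψ (z + x), h1ψ (z + x), h0ψ (z + y), h1ψ (z + y)])
    _ hB
  refine le_trans (le_of_eq ?_) this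
  congr 2
  ext ω
  have e : Z ω + (∑ l, incV W s n ω l + ∑ l, c l * incV W s n ω l) = W r ω := by
    simp only [Z, incV]
    have : ∑ l : Fin n, inc W s n l ω = W s ω := by
      rw [Fin.sum_univ_eq_sum_range (fun l => inc W s n l ω), inc_sum hW0]
      congr 1; field_simp
    rw [this]; ring
  rw [e]

end
end FBMProof

open MeasureTheory ProbabilityTheory Real

namespace FBMProof
open scoped ENNReal Topology
open Filter

lemma meas_primitive {Ω : Type*} {m : MeasurableSpace Ω} (g : ℝ → Ω → ℝ) {a t : ℝ} (hat : a ≤ t)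
    (hgc : ∀ ω, Continuous fun u => g u ω) (hgm : ∀ u ∈ Set.Icc a t, Measurable (g u)) :
    Measurable fun ω => ∫ u in a..t, g u ω := by
  have h1 : ∀ ω, ∫ u in a..t, g u ω = ∫ u in a..t, g (max a (min u t)) ω := by
    intro ω
    refine intervalIntegral.integral_congr fun u hu => ?_
    rw [Set.uIcc_of_le hat] at hu
    simp only [min_eq_left hu.2, max_eq_right hu.1]
  simp_rw [h1, intervalIntegral.integral_of_le hat]
  have hm : Measurable (Function.uncurry fun u ω => g (max a (min u t)) ω) := by
    refine measurable_uncurry_of_continuous_of_measurable (fun ω => (hgc ω).comp (by fun_prop)) fun u => ?_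
    exact hgm _ ⟨le_max_left _ _, max_le hat (min_le_right _ _)⟩
  have := (hm.comp measurable_swap).stronglyMeasurable.integral_prod_right'
    (ν := volume.restrict (Set.Ioc a t))
  exact this.measurable

section
variable {Ω : Type*} [mΩ : MeasurableSpace Ω] {P : Measure Ω} [IsProbabilityMeasure P]
  {H : ℝ} {W : ℝ → Ω → ℝ}

lemma L1past (hW : IsFractionalBM P H W) (hH : 0 < H) (hH2 : H ≤ 1 / 2) (hW0 : ∀ ω, W 0 ω = 0)
    (hWc : ∀ ω, Continuous fun t => W t ω)
    {s r : ℝ} (hs : 0 < s) (hsr : s < r) (F : Ω → ℝ) (hF : Measurable[past W s] F)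
    {C : ℝ} (hFC : ∀ ω, |F ω| ≤ C)
    (ψ : ℝ → ℝ) (hψ : Measurable ψ) (h0ψ : ∀ x, 0 ≤ ψ x) (h1ψ : ∀ x, ψ x ≤ 1) (x y : ℝ) :
    |∫ ω, F ω * (ψ (W r ω + x) - ψ (W r ω + y)) ∂P| ≤
      (∫ ω, |F ω| ∂P) * (10 * |x - y| / (r - s) ^ H) := by
  have hFm : Measurable F := hF.mono (past_le hW.1 _) le_rfl
  have hFi : Integrable F P := Integrable.of_bound hFm.aestronglyMeasurable C (ae_of_all _ hFC)
  have hC : 0 ≤ C := by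
    obtain ⟨ω⟩ : Nonempty Ω := P.nonempty_of_neZero
    exact (abs_nonneg _).trans (hFC ω)
  let 𝓕 : Filtration ℕ mΩ := ⟨gridA W s 1 1, gridA_mono s 1 1, gridA_le hW.1 s 1 1⟩
  have hpast : past W s ≤ ⨆ k, gridA W s 1 1 k := by
    have := past_le_gridA hWc hs (N := 1) one_pos 1
    simpa using this
  have hlim : ∀ᵐ ω ∂P, Tendsto (fun k => (P[F | 𝓕 k]) ω) atTop (𝓝 (F ω)) :=
    hFi.tendsto_ae_condExp (ℱ := 𝓕) ((hF.mono hpast le_rfl).stronglyMeasurable)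
  have hgb : ∀ ω, |ψ (W r ω + x) - ψ (W r ω + y)| ≤ 1 := fun ω => by
    rw [abs_le]; constructor <;> linarith [h0ψ (W r ω + x), h1ψ (W r ω + x), h0ψ (W r ω + y), h1ψ (W r ω + y)]
  have hgm : Measurable fun ω => ψ (W r ω + x) - ψ (W r ω + y) :=
    (hψ.comp ((hW.1 r).add_const _)).sub (hψ.comp ((hW.1 r).add_const _))
  have hKm : ∀ k, Measurable (P[F | 𝓕 k]) := fun k =>
    stronglyMeasurable_condExp.measurable.mono (𝓕.le k) le_rfl
  have key : ∀ k, |∫ ω, (P[F | 𝓕 k]) ω * (ψ (W r ω + x) - ψ (W r ω + y)) ∂P| ≤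
      (∫ ω, |F ω| ∂P) * (10 * |x - y| / (r - s) ^ H) := by
    intro k
    have hm : Measurable[MeasurableSpace.comap
      (fun ω => trunc (1 * 2 ^ k) (1 * 2 ^ k) (incV W s (1 * 2 ^ k) ω)) inferInstance] (P[F | 𝓕 k]) :=
      stronglyMeasurable_condExp.measurable.mono (gridA_le_comap hW0 s le_rfl k) le_rfl
    obtain ⟨φ, hφ, hφe⟩ := hm.exists_eq_measurable_comp
    have e : ∀ ω, (P[F | 𝓕 k]) ω = φ (trunc (1 * 2 ^ k) (1 * 2 ^ k) (incV W s (1 * 2 ^ k) ω)) :=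
      fun ω => congrFun hφe ω
    have hi : Integrable (fun ω => φ (trunc (1 * 2 ^ k) (1 * 2 ^ k) (incV W s (1 * 2 ^ k) ω))) P := by
      simp_rw [← e]; exact integrable_condExp
    have := L1core hW hH hH2 hW0 hs hsr (n := 1 * 2 ^ k) (by positivity)
      (fun v => φ (trunc (1 * 2 ^ k) (1 * 2 ^ k) v)) (hφ.comp (trunc_meas _ _)) hi ψ hψ h0ψ h1ψ x y
    simp_rw [← e] at this
    refine this.trans ?_
    refine mul_le_mul_of_nonneg_right (integral_abs_condExp_le _) ?_
    have := rpow_nonneg (sub_nonneg.2 hsr.le) H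
    positivity
  suffices hTT : Tendsto (fun k : ℕ => ∫ ω, (P[F | 𝓕 k]) ω * (ψ (W r ω + x) - ψ (W r ω + y)) ∂P) atTop
      (𝓝 (∫ ω, F ω * (ψ (W r ω + x) - ψ (W r ω + y)) ∂P)) from
    le_of_tendsto' hTT.abs key
  refine tendsto_integral_filter_of_dominated_convergence (fun _ => C) ?_ ?_ (integrable_const _) ?_
  · exact Eventually.of_forall fun k => ((hKm k).mul hgm).aestronglyMeasurable
  · refine Eventually.of_forall fun k => ?_
    have := ae_bdd_condExp_of_ae_bdd (m := 𝓕 k) (R := ⟨C, hC⟩) (ae_of_all P hFC)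
    filter_upwards [this] with ω hω
    rw [Real.norm_eq_abs, abs_mul]
    calc _ ≤ C * 1 := mul_le_mul hω (hgb ω) (abs_nonneg _) hC
      _ = C := mul_one _
  · filter_upwards [hlim] with ω hω
    exact hω.mul_const _

lemma pow_primitive {g : ℝ → ℝ} (hg : Continuous g) (a t : ℝ) (p : ℕ) :
    (∫ u in a..t, g u) ^ (p + 2) = (p + 2) * (p + 1) *
      ∫ s in a..t, (∫ u in a..s, g u) ^ p * g s * (∫ u in s..t, g u) := by
  set A : ℝ → ℝ := fun s => ∫ u in a..s, g u with hA
  have hd : ∀ s, HasDerivAt A (g s) s := fun s => hg.integral_hasStrictDerivAt a s |>.hasDerivAt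
  have hAc : Continuous A := continuous_iff_continuousAt.2 fun s => (hd s).continuousAt
  have hst : ∀ s, ∫ u in s..t, g u = A t - A s := fun s => by
    rw [hA]
    simp only
    rw [← intervalIntegral.integral_interval_sub_left (hg.intervalIntegrable _ _) (hg.intervalIntegrable _ _)]
  simp_rw [hst]
  let B : ℝ → ℝ := fun s => A t * (p + 2) * A s ^ (p + 1) - (p + 1) * A s ^ (p + 2)
  have hB : ∀ s, HasDerivAt B ((p + 2) * (p + 1) * (A s ^ p * g s * (A t - A s))) s := by
    intro s
    have h1 := ((hd s).pow (p + 1)).const_mul (A t * (p + 2))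
    have h2 := ((hd s).pow (p + 2)).const_mul ((p : ℝ) + 1)
    have h3 := h1.sub h2
    convert! h3 using 1
    push_cast
    ring
  have := intervalIntegral.integral_eq_sub_of_hasDerivAt (a := a) (b := t) (fun s _ => hB s)
    (by apply Continuous.intervalIntegrable; fun_prop)
  rw [intervalIntegral.integral_const_mul] at this
  rw [this]
  have hAa : A a = 0 := by simp [hA]
  simp only [B, hAa]
  rw [sub_zero, zero_pow (by omega), zero_pow (by omega)]
  ring

lemma int_rpow_bound (hH : 0 < H) (hH2 : H ≤ 1 / 2) {s t : ℝ} (hst : s ≤ t) :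
    IntervalIntegrable (fun r => (1 : ℝ) / (r - s) ^ H) volume s t ∧
    ∫ r in s..t, (1 : ℝ) / (r - s) ^ H ≤ 2 * (t - s) ^ (1 - H) := by
  have e : ∀ r ∈ Set.Icc s t, (1 : ℝ) / (r - s) ^ H = (fun v => v ^ (-H)) (r - s) := by
    intro r hr
    simp only
    rw [rpow_neg (by linarith [hr.1]), one_div]
  have hi : IntervalIntegrable (fun r => (fun v : ℝ => v ^ (-H)) (r - s)) volume s t := by
    have := (intervalIntegral.intervalIntegrable_rpow' (a := 0) (b := t - s) (r := -H) (by linarith)).comp_sub_right s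
    simpa using this
  constructor
  · refine hi.congr ?_
    intro r hr
    rw [Set.uIoc_of_le hst] at hr
    exact (e r ⟨hr.1.le, hr.2⟩).symm
  · rw [intervalIntegral.integral_congr (g := fun r => (fun v : ℝ => v ^ (-H)) (r - s))
      (by rw [Set.uIcc_of_le hst]; exact e),
      intervalIntegral.integral_comp_sub_right (fun v : ℝ => v ^ (-H)) s, integral_rpow (by left; linarith)]
    rw [sub_self, zero_rpow (by linarith), sub_zero, neg_add_eq_sub, div_le_iff₀ (by linarith)]
    have := rpow_nonneg (sub_nonneg.2 hst) (1 - H)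
    nlinarith

lemma moment_step (hW : IsFractionalBM P H W) (hH : 0 < H) (hH2 : H ≤ 1 / 2) (hW0 : ∀ ω, W 0 ω = 0)
    (hWc : ∀ ω, Continuous fun t => W t ω)
    (ψ : ℝ → ℝ) (hψ : Continuous ψ) (h0ψ : ∀ x, 0 ≤ ψ x) (h1ψ : ∀ x, ψ x ≤ 1) (x y : ℝ)
    {a b : ℝ} (ha : 0 ≤ a) (hab : a ≤ b) {p : ℕ} (hp : Even p) (M : ℝ)
    (hM : ∀ s ∈ Set.Icc a b, ∫ ω, (∫ u in a..s, (ψ (W u ω + x) - ψ (W u ω + y))) ^ p ∂P ≤ M)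
    {t : ℝ} (ht : t ∈ Set.Icc a b) :
    ∫ ω, (∫ u in a..t, (ψ (W u ω + x) - ψ (W u ω + y))) ^ (p + 2) ∂P ≤
      (p + 2) * (p + 1) * ((b - a) * (M * (20 * |x - y| * (b - a) ^ (1 - H)))) := by
  set g : ℝ → Ω → ℝ := fun u ω => ψ (W u ω + x) - ψ (W u ω + y) with hg
  have hgc : ∀ ω, Continuous fun u => g u ω := fun ω => by
    have := hWc ω
    simp only [hg]; fun_prop
  have hgb : ∀ u ω, |g u ω| ≤ 1 := fun u ω => by
    simp only [hg]
    rw [abs_le]; constructor <;> linarith [h0ψ (W u ω + x), h1ψ (W u ω + x), h0ψ (W u ω + y), h1ψ (W u ω + y)]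
  have hgm : ∀ u, Measurable (g u) := fun u =>
    (hψ.measurable.comp ((hW.1 u).add_const _)).sub (hψ.measurable.comp ((hW.1 u).add_const _))
  set A : ℝ → Ω → ℝ := fun s ω => ∫ u in a..s, g u ω with hA
  have hAc : ∀ ω, Continuous fun s => A s ω := fun ω =>
    intervalIntegral.continuous_primitive (fun _ _ => (hgc ω).intervalIntegrable _ _) a
  have hIb : ∀ c d ω, |∫ u in c..d, g u ω| ≤ |d - c| := by
    intro c d ω
    have := intervalIntegral.norm_integral_le_of_norm_le_const (a := c) (b := d) (f := fun u => g u ω)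
      (C := 1) (fun u _ => hgb u ω)
    simpa using this
  have hAm : ∀ s, a ≤ s → Measurable (A s) := fun s hs => meas_primitive g hs hgc fun u _ => hgm u
  have hAp : ∀ s, a ≤ s → Measurable[past W s] (A s) := fun s hs => by
    refine @meas_primitive Ω (past W s) g a s hs hgc fun u hu => ?_
    have := meas_past (W := W) (s := u) (t := s) ⟨ha.trans hu.1, hu.2⟩
    exact (hψ.measurable.comp (this.add_const _)).sub (hψ.measurable.comp (this.add_const _))
  have hM0 : 0 ≤ M := (integral_nonneg fun ω => hp.pow_nonneg _).trans (hM a ⟨le_rfl, hab⟩)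
  have hba : 0 ≤ b - a := by linarith
  set κ := 20 * |x - y| * (b - a) ^ (1 - H) with hκ
  have hκ0 : 0 ≤ κ := by have := rpow_nonneg hba (1 - H); positivity
  -- bound for fixed s
  have hfix : ∀ s ∈ Set.Ioc a t, ∫ ω, A s ω ^ p * g s ω * (∫ u in s..t, g u ω) ∂P ≤ M * κ := by
    intro s hs
    have hs0 : 0 < s := ha.trans_lt hs.1
    set F : Ω → ℝ := fun ω => A s ω ^ p * g s ω with hF
    have hFm : Measurable[past W s] F := by
      refine ((hAp s hs.1.le).pow_const p).mul ?_
      have := meas_past (W := W) (s := s) (t := s) ⟨hs0.le, le_rfl⟩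
      exact (hψ.measurable.comp (this.add_const _)).sub (hψ.measurable.comp (this.add_const _))
    have hFm' : Measurable F := hFm.mono (past_le hW.1 _) le_rfl
    have hFb : ∀ ω, |F ω| ≤ A s ω ^ p := by
      intro ω
      simp only [hF]
      rw [abs_mul, abs_of_nonneg (hp.pow_nonneg _)]
      exact mul_le_of_le_one_right (hp.pow_nonneg _) (hgb _ _)
    have hAb : ∀ ω, A s ω ^ p ≤ (s - a) ^ p := by
      intro ω
      rw [← hp.pow_abs]
      refine pow_le_pow_left₀ (abs_nonneg _) ?_ p
      have := hIb a s ω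
      rw [abs_of_nonneg (by linarith [hs.1] : (0:ℝ) ≤ s - a)] at this
      exact this
    have hFC : ∀ ω, |F ω| ≤ (s - a) ^ p := fun ω => (hFb ω).trans (hAb ω)
    have hFi : ∫ ω, |F ω| ∂P ≤ M := by
      refine le_trans ?_ (hM s ⟨hs.1.le, hs.2.trans ht.2⟩)
      refine integral_mono_of_nonneg (ae_of_all _ fun _ => abs_nonneg _) ?_ (ae_of_all _ hFb)
      exact Integrable.of_bound ((hAm s hs.1.le).pow_const p).aestronglyMeasurable ((s - a) ^ p)
        (ae_of_all _ fun ω => by rw [Real.norm_of_nonneg (hp.pow_nonneg _)]; exact hAb ω)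
    have hsw : ∫ ω, F ω * (∫ u in s..t, g u ω) ∂P = ∫ u in s..t, ∫ ω, F ω * g u ω ∂P := by
      simp_rw [← intervalIntegral.integral_const_mul, intervalIntegral.integral_of_le hs.2]
      rw [integral_integral_swap]
      refine Integrable.of_bound (C := (s - a) ^ p) ?_ (ae_of_all _ ?_)
      · have h1 : Measurable (Function.uncurry g) := measurable_uncurry_of_continuous_of_measurable hgc hgm
        exact ((hFm'.comp measurable_fst).mul (h1.comp measurable_swap)).aestronglyMeasurable
      · rintro ⟨ω, u⟩
        simp only [Function.uncurry]
        rw [norm_mul]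
        exact (mul_le_of_le_one_right (norm_nonneg _) (hgb _ _)).trans (hFC ω)
    rw [hsw]
    obtain ⟨hi1, hi2⟩ := int_rpow_bound hH hH2 hs.2
    have hptw : ∀ u ∈ Set.Ioo s t, ∫ ω, F ω * g u ω ∂P ≤ M * (10 * |x - y|) * (1 / (u - s) ^ H) := by
      intro u hu
      have := L1past hW hH hH2 hW0 hWc hs0 hu.1 F hFm hFC ψ hψ.measurable h0ψ h1ψ x y
      refine (le_abs_self _).trans (this.trans ?_)
      rw [mul_assoc, mul_one_div]
      refine mul_le_mul_of_nonneg_right hFi ?_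
      have := rpow_nonneg (sub_nonneg.2 hu.1.le) H
      positivity
    have hcont : Continuous fun u => ∫ ω, F ω * g u ω ∂P := by
      refine continuous_of_dominated (bound := fun _ => (s - a) ^ p)
        (fun u => (hFm'.mul (hgm u)).aestronglyMeasurable) (fun u => ae_of_all _ fun ω => ?_)
        (integrable_const _) (ae_of_all _ fun ω => (hgc ω).const_mul _)
      rw [norm_mul]
      exact (mul_le_of_le_one_right (norm_nonneg _) (hgb _ _)).trans (hFC ω)
    calc ∫ u in s..t, ∫ ω, F ω * g u ω ∂P ≤ ∫ u in s..t, M * (10 * |x - y|) * (1 / (u - s) ^ H) := by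
          refine intervalIntegral.integral_mono_on_of_le_Ioo hs.2 (hcont.intervalIntegrable _ _)
            (hi1.const_mul _) hptw
      _ = M * (10 * |x - y|) * ∫ u in s..t, (1 / (u - s) ^ H) := by
          rw [intervalIntegral.integral_const_mul]
      _ ≤ M * (10 * |x - y|) * (2 * (b - a) ^ (1 - H)) := by
          refine mul_le_mul_of_nonneg_left (hi2.trans ?_) (by positivity)
          have : (t - s) ^ (1 - H) ≤ (b - a) ^ (1 - H) :=
            rpow_le_rpow (by linarith [hs.2]) (by linarith [hs.1, ht.2]) (by linarith)
          linarith
      _ = M * κ := by rw [hκ]; ring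
  have hpath : ∀ ω, A t ω ^ (p + 2) = (p + 2) * (p + 1) *
      ∫ s in a..t, A s ω ^ p * g s ω * (∫ u in s..t, g u ω) := fun ω => pow_primitive (hgc ω) a t p
  change ∫ ω, A t ω ^ (p + 2) ∂P ≤ _
  simp_rw [hpath]
  rw [integral_const_mul]
  refine mul_le_mul_of_nonneg_left ?_ (by positivity)
  have hst : ∀ s ω, ∫ u in s..t, g u ω = A t ω - A s ω := fun s ω => by
    simp only [hA]
    rw [← intervalIntegral.integral_interval_sub_left ((hgc ω).intervalIntegrable _ _)
      ((hgc ω).intervalIntegrable _ _)]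
  have hsw : ∫ ω, (∫ s in a..t, A s ω ^ p * g s ω * (∫ u in s..t, g u ω)) ∂P =
      ∫ s in a..t, ∫ ω, A s ω ^ p * g s ω * (∫ u in s..t, g u ω) ∂P := by
    simp_rw [intervalIntegral.integral_of_le ht.1]
    rw [integral_integral_swap]
    have h1 : Measurable (Function.uncurry fun s ω => A (max a s) ω ^ p * g s ω * (∫ u in (max a s)..t, g u ω)) := by
      refine measurable_uncurry_of_continuous_of_measurable (fun ω => ?_) fun s => ?_
      · simp_rw [hst]
        have := hAc ω
        have := hgc ω
        have h3 : Continuous fun s => A (max a s) ω := (hAc ω).comp (continuous_const.max continuous_id)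
        fun_prop
      · simp_rw [hst]
        exact (((hAm _ (le_max_left _ _)).pow_const p).mul (hgm s)).mul
          ((hAm t ht.1).sub (hAm _ (le_max_left _ _)))
    refine Integrable.congr (f := fun q : Ω × ℝ => (fun s ω => A (max a s) ω ^ p * g s ω *
      (∫ u in (max a s)..t, g u ω)) q.2 q.1) ?_ ?_
    · refine Integrable.of_bound (C := (b - a) ^ p * 1 * (b - a)) (h1.comp measurable_swap).aestronglyMeasurable ?_
      have hae : ∀ᵐ q : Ω × ℝ ∂(P.prod (volume.restrict (Set.Ioc a t))), q.2 ∈ Set.Ioc a t :=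
        Measure.quasiMeasurePreserving_snd.ae (ae_restrict_mem measurableSet_Ioc)
      filter_upwards [hae] with q hq
      simp only [max_eq_right hq.1.le]
      rw [norm_mul, norm_mul, norm_pow]
      gcongr
      · refine (hIb a q.2 q.1).trans ?_
        rw [abs_of_nonneg (by linarith [hq.1] : (0:ℝ) ≤ q.2 - a)]; linarith [hq.2, ht.2]
      · exact hgb _ _
      · refine (hIb q.2 t q.1).trans ?_
        rw [abs_of_nonneg (by linarith [hq.2] : (0:ℝ) ≤ t - q.2)]; linarith [hq.1, ht.2]
    · have hae : ∀ᵐ q : Ω × ℝ ∂(P.prod (volume.restrict (Set.Ioc a t))), q.2 ∈ Set.Ioc a t :=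
        Measure.quasiMeasurePreserving_snd.ae (ae_restrict_mem measurableSet_Ioc)
      filter_upwards [hae] with q hq
      simp only [max_eq_right hq.1.le, Function.uncurry]
  rw [hsw, intervalIntegral.integral_of_le ht.1]
  by_cases hintg : IntegrableOn (fun s => ∫ ω, A s ω ^ p * g s ω * (∫ u in s..t, g u ω) ∂P) (Set.Ioc a t)
  · calc _ ≤ ∫ s in Set.Ioc a t, M * κ := setIntegral_mono_on hintg (integrable_const _) measurableSet_Ioc hfix
      _ = (t - a) * (M * κ) := by
        simp [Real.volume_real_Ioc_of_le ht.1]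
      _ ≤ _ := by
        refine mul_le_mul_of_nonneg_right (by linarith [ht.2]) (by positivity)
  · rw [integral_undef hintg]
    positivity

lemma moment_six (hW : IsFractionalBM P H W) (hH : 0 < H) (hH2 : H ≤ 1 / 2) (hW0 : ∀ ω, W 0 ω = 0)
    (hWc : ∀ ω, Continuous fun t => W t ω)
    (ψ : ℝ → ℝ) (hψ : Continuous ψ) (h0ψ : ∀ x, 0 ≤ ψ x) (h1ψ : ∀ x, ψ x ≤ 1) (x y : ℝ)
    {a b : ℝ} (ha : 0 ≤ a) (hab : a ≤ b) :
    ∫ ω, (∫ u in a..b, (ψ (W u ω + x) - ψ (W u ω + y))) ^ 6 ∂P ≤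
      720 * ((b - a) * (20 * |x - y| * (b - a) ^ (1 - H))) ^ 3 := by
  have h2 := fun t ht => moment_step hW hH hH2 hW0 hWc ψ hψ h0ψ h1ψ x y ha hab (p := 0) (by simp) 1
    (by simp) (t := t) ht
  have h4 := fun t ht => moment_step hW hH hH2 hW0 hWc ψ hψ h0ψ h1ψ x y ha hab (p := 0 + 2) (by decide) _
    h2 (t := t) ht
  have h6 := moment_step hW hH hH2 hW0 hWc ψ hψ h0ψ h1ψ x y ha hab (p := 0 + 2 + 2) (by decide) _
    h4 (t := b) ⟨hab, le_rfl⟩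
  refine h6.trans (le_of_eq ?_)
  push_cast
  ring

end
end FBMProof

open MeasureTheory ProbabilityTheory Real

namespace FBMProof
open scoped ENNReal Topology
open Filter

/-- Paths starting at zero with Lipschitz constant `M`. -/
def LipM (M : ℝ) : Set (ℝ → ℝ) := {z | z 0 = 0 ∧ ∀ s t, |z s - z t| ≤ M * |s - t|}

/-- Discretised occupation functional. -/
noncomputable def chainS (w : ℝ → ℝ) (ψ : ℝ → ℝ) (M : ℝ) (n : ℕ) (ℓ : ℝ) (z : ℝ → ℝ) : ℝ :=
  ∑ j ∈ Finset.range n, ∫ u in ((j : ℝ) * ℓ)..(((j + 1 : ℕ) : ℝ) * ℓ),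
    ψ (w u + M * ℓ * ⌊z ((j : ℝ) * ℓ) / (M * ℓ)⌋)

lemma sum_range_two_mul (n : ℕ) (f : ℕ → ℝ) :
    ∑ j ∈ Finset.range (2 * n), f j = ∑ j ∈ Finset.range n, (f (2 * j) + f (2 * j + 1)) := by
  induction n with
  | zero => simp
  | succ n ih =>
    rw [show 2 * (n + 1) = 2 * n + 1 + 1 by ring, Finset.sum_range_succ, Finset.sum_range_succ, ih,
      Finset.sum_range_succ]
    ring

lemma abs_le_six {a y : ℝ} (ha : 0 < a) : |y| ≤ a + y ^ 6 / a ^ 5 := by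
  rcases le_or_gt |y| a with h | h
  · have : 0 ≤ y ^ 6 / a ^ 5 := by positivity
    linarith
  · have h5 : a ^ 5 ≤ |y| ^ 5 := pow_le_pow_left₀ ha.le h.le 5
    have : |y| ≤ y ^ 6 / a ^ 5 := by
      rw [le_div_iff₀ (by positivity), ← (show Even 6 by decide).pow_abs y]
      calc |y| * a ^ 5 ≤ |y| * |y| ^ 5 := by gcongr
        _ = _ := by ring
    linarith

/-- The increments appearing in the chaining. -/
noncomputable def chainY (w : ℝ → ℝ) (ψ : ℝ → ℝ) (M : ℝ) (ℓ : ℝ) (j : ℕ) (i d : ℤ) : ℝ :=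
  ∫ u in ((j : ℝ) * ℓ)..(((j + 1 : ℕ) : ℝ) * ℓ),
    (ψ (w u + M * ℓ * (2 * i + d : ℤ)) - ψ (w u + M * ℓ * (2 * i : ℤ)))

noncomputable def chainD (w : ℝ → ℝ) (ψ : ℝ → ℝ) (M : ℝ) (n : ℕ) (ℓ a : ℝ) : ℝ :=
  ∑ j ∈ Finset.range (2 * n), (a + ∑ i ∈ Finset.Icc (-(n : ℤ)) n, ∑ d ∈ Finset.Icc (-1 : ℤ) 2,
    chainY w ψ M ℓ j i d ^ 6 / a ^ 5)

lemma chain_path {w ψ : ℝ → ℝ} (hw : Continuous w) (hψ : Continuous ψ) {M ℓ a : ℝ} (hM : 0 < M)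
    (hℓ : 0 < ℓ) (ha : 0 < a) (n : ℕ) {z : ℝ → ℝ} (hz : z ∈ LipM M) :
    |chainS w ψ M (2 * n) ℓ z - chainS w ψ M n (2 * ℓ) z| ≤ chainD w ψ M n ℓ a := by
  have hc : ∀ c : ℝ, Continuous fun u => ψ (w u + c) := fun c => by fun_prop
  have hMℓ : 0 < M * ℓ := by positivity
  -- index facts
  have hidx : ∀ j < n, ∀ e : ℕ, e ≤ 1 → ∃ i ∈ Finset.Icc (-(n : ℤ)) n, ∃ d ∈ Finset.Icc (-1 : ℤ) 2,
      ⌊z ((j : ℝ) * (2 * ℓ)) / (M * (2 * ℓ))⌋ = i ∧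
      ⌊z (((2 * j + e : ℕ) : ℝ) * ℓ) / (M * ℓ)⌋ = 2 * i + d := by
    intro j hj e he
    set v := z ((j : ℝ) * (2 * ℓ)) / (M * (2 * ℓ)) with hv
    set v' := z (((2 * j + e : ℕ) : ℝ) * ℓ) / (M * ℓ) with hv'
    have h1 : |v' - 2 * v| ≤ 1 := by
      have : v' - 2 * v = (z (((2 * j + e : ℕ) : ℝ) * ℓ) - z ((j : ℝ) * (2 * ℓ))) / (M * ℓ) := by
        rw [hv, hv']; field_simp
      rw [this, abs_div, abs_of_pos hMℓ, div_le_one hMℓ]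
      refine (hz.2 _ _).trans ?_
      have e1 : (((2 * j + e : ℕ) : ℝ) * ℓ) - ((j : ℝ) * (2 * ℓ)) = e * ℓ := by push_cast; ring
      rw [e1, abs_of_nonneg (by positivity)]
      have : (e : ℝ) ≤ 1 := by exact_mod_cast he
      have : (e : ℝ) * ℓ ≤ 1 * ℓ := by gcongr
      nlinarith
    have h2 : |v| ≤ n := by
      rw [hv, abs_div, abs_of_pos (by positivity : 0 < M * (2 * ℓ)), div_le_iff₀ (by positivity)]
      have := hz.2 ((j : ℝ) * (2 * ℓ)) 0
      rw [hz.1, sub_zero, sub_zero, abs_of_nonneg (by positivity : 0 ≤ (j : ℝ) * (2 * ℓ))] at this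
      refine this.trans ?_
      have hjn : (j : ℝ) ≤ n := by exact_mod_cast hj.le
      calc M * (j * (2 * ℓ)) = j * (M * (2 * ℓ)) := by ring
        _ ≤ _ := by gcongr
    rw [abs_le] at h1 h2
    have f1 := Int.floor_le v
    have f2 := Int.lt_floor_add_one v
    have f3 := Int.floor_le v'
    have f4 := Int.lt_floor_add_one v'
    refine ⟨⌊v⌋, ?_, ⌊v'⌋ - 2 * ⌊v⌋, ?_, rfl, by ring⟩
    · rw [Finset.mem_Icc]
      constructor
      · rw [Int.le_floor]; push_cast; linarith
      · have : (⌊v⌋ : ℝ) ≤ ((n : ℤ) : ℝ) := by push_cast; linarith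
        exact_mod_cast this
    · rw [Finset.mem_Icc]
      constructor
      · have : (2 * ⌊v⌋ - 1 : ℤ) ≤ ⌊v'⌋ := by rw [Int.le_floor]; push_cast; linarith
        linarith
      · have : (⌊v'⌋ : ℝ) < ((2 * ⌊v⌋ + 3 : ℤ) : ℝ) := by push_cast; linarith
        have : ⌊v'⌋ < 2 * ⌊v⌋ + 3 := by exact_mod_cast this
        linarith
  have hterm : ∀ j, ∀ i ∈ Finset.Icc (-(n : ℤ)) n, ∀ d ∈ Finset.Icc (-1 : ℤ) 2,
      |chainY w ψ M ℓ j i d| ≤ a + ∑ i ∈ Finset.Icc (-(n : ℤ)) n, ∑ d ∈ Finset.Icc (-1 : ℤ) 2,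
        chainY w ψ M ℓ j i d ^ 6 / a ^ 5 := by
    intro j i hi d hd
    refine (abs_le_six ha).trans ?_
    have hnn : ∀ i d, 0 ≤ chainY w ψ M ℓ j i d ^ 6 / a ^ 5 := fun i d => by positivity
    have h1 := Finset.single_le_sum (f := fun d => chainY w ψ M ℓ j i d ^ 6 / a ^ 5)
      (fun d _ => hnn i d) hd
    have h2 := Finset.single_le_sum (f := fun i => ∑ d ∈ Finset.Icc (-1 : ℤ) 2, chainY w ψ M ℓ j i d ^ 6 / a ^ 5)
      (fun i _ => Finset.sum_nonneg fun d _ => hnn i d) hi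
    linarith
  unfold chainS chainD
  rw [sum_range_two_mul, sum_range_two_mul, ← Finset.sum_sub_distrib]
  refine (Finset.abs_sum_le_sum_abs _ _).trans (Finset.sum_le_sum fun j hj => ?_)
  rw [Finset.mem_range] at hj
  have hsplit : ∫ u in ((j : ℝ) * (2 * ℓ))..(((j + 1 : ℕ) : ℝ) * (2 * ℓ)),
      ψ (w u + M * (2 * ℓ) * ⌊z ((j : ℝ) * (2 * ℓ)) / (M * (2 * ℓ))⌋) =
      (∫ u in (((2 * j : ℕ) : ℝ) * ℓ)..(((2 * j + 1 : ℕ) : ℝ) * ℓ),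
        ψ (w u + M * (2 * ℓ) * ⌊z ((j : ℝ) * (2 * ℓ)) / (M * (2 * ℓ))⌋)) +
      ∫ u in (((2 * j + 1 : ℕ) : ℝ) * ℓ)..(((2 * j + 1 + 1 : ℕ) : ℝ) * ℓ),
        ψ (w u + M * (2 * ℓ) * ⌊z ((j : ℝ) * (2 * ℓ)) / (M * (2 * ℓ))⌋) := by
    rw [intervalIntegral.integral_add_adjacent_intervals ((hc _).intervalIntegrable _ _)
      ((hc _).intervalIntegrable _ _)]
    congr 1 <;> (push_cast; ring)
  rw [hsplit, add_sub_add_comm]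
  refine (abs_add_le _ _).trans (add_le_add ?_ ?_)
  · obtain ⟨i, hi, d, hd, e1, e2⟩ := hidx j hj 0 (by norm_num)
    rw [add_zero] at e2
    rw [e1, e2, ← intervalIntegral.integral_sub ((hc _).intervalIntegrable _ _) ((hc _).intervalIntegrable _ _)]
    refine le_trans (le_of_eq ?_) (hterm (2 * j) i hi d hd)
    unfold chainY
    congr 2; ext u; congr 3; push_cast; ring
  · obtain ⟨i, hi, d, hd, e1, e2⟩ := hidx j hj 1 (by norm_num)
    rw [e1, e2, ← intervalIntegral.integral_sub ((hc _).intervalIntegrable _ _) ((hc _).intervalIntegrable _ _)]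
    refine le_trans (le_of_eq ?_) (hterm (2 * j + 1) i hi d hd)
    unfold chainY
    congr 2; ext u; congr 3; push_cast; ring

section
variable {Ω : Type*} [mΩ : MeasurableSpace Ω] {P : Measure Ω} [IsProbabilityMeasure P]
  {H : ℝ} {W : ℝ → Ω → ℝ}

lemma chainY_meas (hW : IsFractionalBM P H W) (hWc : ∀ ω, Continuous fun t => W t ω)
    (ψ : ℝ → ℝ) (hψ : Continuous ψ) {M ℓ : ℝ} (hℓ : 0 < ℓ) (j : ℕ) (i d : ℤ) :
    Measurable fun ω => chainY (fun t => W t ω) ψ M ℓ j i d := by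
  unfold chainY
  refine meas_primitive (fun u ω => ψ (W u ω + M * ℓ * (2 * i + d : ℤ)) - ψ (W u ω + M * ℓ * (2 * i : ℤ)))
    (by push_cast; nlinarith) (fun ω => ?_) fun u _ => ?_
  · have := hWc ω
    fun_prop
  · exact (hψ.measurable.comp ((hW.1 u).add_const _)).sub (hψ.measurable.comp ((hW.1 u).add_const _))

lemma chainD_meas (hW : IsFractionalBM P H W) (hWc : ∀ ω, Continuous fun t => W t ω)
    (ψ : ℝ → ℝ) (hψ : Continuous ψ) {M ℓ a : ℝ} (hℓ : 0 < ℓ) (n : ℕ) :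
    Measurable fun ω => chainD (fun t => W t ω) ψ M n ℓ a := by
  unfold chainD
  refine Finset.measurable_fun_sum _ fun j _ => ?_
  refine measurable_const.add (Finset.measurable_fun_sum _ fun i _ => Finset.measurable_fun_sum _ fun d _ => ?_)
  exact ((chainY_meas hW hWc ψ hψ hℓ j i d).pow_const 6).div_const _

lemma chainD_nonneg {w ψ : ℝ → ℝ} {M ℓ a : ℝ} (ha : 0 < a) (n : ℕ) : 0 ≤ chainD w ψ M n ℓ a := by
  unfold chainD
  positivity

lemma chainD_int (hW : IsFractionalBM P H W) (hH : 0 < H) (hH2 : H ≤ 1 / 2) (hW0 : ∀ ω, W 0 ω = 0)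
    (hWc : ∀ ω, Continuous fun t => W t ω)
    (ψ : ℝ → ℝ) (hψ : Continuous ψ) (h0ψ : ∀ x, 0 ≤ ψ x) (h1ψ : ∀ x, ψ x ≤ 1)
    {M ℓ a : ℝ} (hM : 0 < M) (hℓ : 0 < ℓ) (ha : 0 < a) (n : ℕ) :
    ∫⁻ ω, ENNReal.ofReal (chainD (fun t => W t ω) ψ M n ℓ a) ∂P ≤ ENNReal.ofReal
      (2 * n * (a + (2 * n + 1) * (4 * (720 * (ℓ * (20 * (2 * M * ℓ) * ℓ ^ (1 - H))) ^ 3 / a ^ 5)))) := by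
  have hYb : ∀ j i d ω, |chainY (fun t => W t ω) ψ M ℓ j i d| ≤ ℓ := by
    intro j i d ω
    have := intervalIntegral.norm_integral_le_of_norm_le_const (a := (j : ℝ) * ℓ) (b := ((j + 1 : ℕ) : ℝ) * ℓ)
      (f := fun u => ψ (W u ω + M * ℓ * (2 * i + d : ℤ)) - ψ (W u ω + M * ℓ * (2 * i : ℤ)))
      (C := 1) (fun u _ => by
        rw [Real.norm_eq_abs, abs_le]
        constructor <;> linarith [h0ψ (W u ω + M * ℓ * (2 * i + d : ℤ)), h1ψ (W u ω + M * ℓ * (2 * i + d : ℤ)),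
          h0ψ (W u ω + M * ℓ * (2 * i : ℤ)), h1ψ (W u ω + M * ℓ * (2 * i : ℤ))])
    unfold chainY
    refine this.trans (le_of_eq ?_)
    rw [show ((j + 1 : ℕ) : ℝ) * ℓ - j * ℓ = ℓ by push_cast; ring, abs_of_pos hℓ, one_mul]
  have hYi : ∀ j i d, Integrable (fun ω => chainY (fun t => W t ω) ψ M ℓ j i d ^ 6 / a ^ 5) P := by
    intro j i d
    refine (Integrable.of_bound (C := ℓ ^ 6) ((chainY_meas hW hWc ψ hψ hℓ j i d).pow_const 6).aestronglyMeasurable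
      (ae_of_all _ fun ω => ?_)).div_const _
    rw [norm_pow]
    exact pow_le_pow_left₀ (norm_nonneg _) (hYb j i d ω) 6
  have hYe : ∀ j i, ∀ d ∈ Finset.Icc (-1 : ℤ) 2, ∫ ω, chainY (fun t => W t ω) ψ M ℓ j i d ^ 6 / a ^ 5 ∂P ≤
      720 * (ℓ * (20 * (2 * M * ℓ) * ℓ ^ (1 - H))) ^ 3 / a ^ 5 := by
    intro j i d hd
    rw [integral_div]
    refine div_le_div_of_nonneg_right ?_ (by positivity)
    have := moment_six hW hH hH2 hW0 hWc ψ hψ h0ψ h1ψ (M * ℓ * (2 * i + d : ℤ)) (M * ℓ * (2 * i : ℤ))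
      (a := (j : ℝ) * ℓ) (b := ((j + 1 : ℕ) : ℝ) * ℓ) (by positivity) (by push_cast; nlinarith)
    refine this.trans ?_
    rw [show ((j + 1 : ℕ) : ℝ) * ℓ - j * ℓ = ℓ by push_cast; ring]
    have hd' : |(d : ℝ)| ≤ 2 := by
      rw [Finset.mem_Icc] at hd
      have h1 : (-1 : ℝ) ≤ d := by exact_mod_cast hd.1
      have h2 : (d : ℝ) ≤ 2 := by exact_mod_cast hd.2
      rw [abs_le]; constructor <;> linarith
    have : |M * ℓ * (2 * i + d : ℤ) - M * ℓ * (2 * i : ℤ)| ≤ 2 * M * ℓ := by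
      rw [show M * ℓ * (2 * i + d : ℤ) - M * ℓ * (2 * i : ℤ) = M * ℓ * (d : ℝ) by push_cast; ring, abs_mul,
        abs_of_pos (by positivity : 0 < M * ℓ)]
      nlinarith [mul_pos hM hℓ]
    have := rpow_nonneg hℓ.le (1 - H)
    gcongr
  have hZi : ∀ j, Integrable (fun ω => (a + ∑ i ∈ Finset.Icc (-(n : ℤ)) n, ∑ d ∈ Finset.Icc (-1 : ℤ) 2,
    chainY (fun t => W t ω) ψ M ℓ j i d ^ 6 / a ^ 5)) P := fun j =>
    (integrable_const _).add (integrable_finsetSum _ fun i _ => integrable_finsetSum _ fun d _ => hYi j i d)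
  have hDi : Integrable (fun ω => chainD (fun t => W t ω) ψ M n ℓ a) P := by
    unfold chainD
    exact integrable_finsetSum _ fun j _ => hZi j
  rw [← ofReal_integral_eq_lintegral_ofReal hDi (ae_of_all _ fun ω => chainD_nonneg ha n)]
  refine ENNReal.ofReal_le_ofReal ?_
  unfold chainD
  rw [integral_finsetSum _ fun j _ => hZi j]
  set E := 720 * (ℓ * (20 * (2 * M * ℓ) * ℓ ^ (1 - H))) ^ 3 / a ^ 5 with hE
  have : ∀ j ∈ Finset.range (2 * n), ∫ ω, (a + ∑ i ∈ Finset.Icc (-(n : ℤ)) n, ∑ d ∈ Finset.Icc (-1 : ℤ) 2,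
    chainY (fun t => W t ω) ψ M ℓ j i d ^ 6 / a ^ 5) ∂P ≤ a + (2 * n + 1) * (4 * E) := by
    intro j _
    rw [integral_add (integrable_const _) (integrable_finsetSum _ fun i _ => integrable_finsetSum _ fun d _ => hYi j i d),
      integral_finsetSum _ fun i _ => integrable_finsetSum _ fun d _ => hYi j i d]
    refine add_le_add (by simp) ?_
    calc _ ≤ ∑ i ∈ Finset.Icc (-(n : ℤ)) n, 4 * E := by
          refine Finset.sum_le_sum fun i _ => ?_
          rw [integral_finsetSum _ fun d _ => hYi j i d]
          refine (Finset.sum_le_sum fun d hd => hYe j i d hd).trans (le_of_eq ?_)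
          simp
      _ = _ := by
          rw [Finset.sum_const, Int.card_Icc, nsmul_eq_mul]
          congr 1
          rw [show (n : ℤ) + 1 - -(n : ℤ) = ((2 * n + 1 : ℕ) : ℤ) by push_cast; ring, Int.toNat_natCast]
          push_cast; ring
  refine (Finset.sum_le_sum this).trans (le_of_eq ?_)
  rw [Finset.sum_const, Finset.card_range, nsmul_eq_mul]
  push_cast
  ring

end
end FBMProof

open MeasureTheory ProbabilityTheory Real

namespace FBMProof
open scoped ENNReal Topology
open Filter

lemma chain_tendsto {w ψ : ℝ → ℝ} (hw : Continuous w) (hψ : UniformContinuous ψ) {M T : ℝ} (hM : 0 < M)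
    (hT : 0 < T) {z : ℝ → ℝ} (hz : z ∈ LipM M) :
    Tendsto (fun k : ℕ => chainS w ψ M (2 ^ k) (T / 2 ^ k) z) atTop (𝓝 (∫ u in (0:ℝ)..T, ψ (w u + z u))) := by
  have hzc : Continuous z := by
    have : LipschitzWith ⟨M, hM.le⟩ z := LipschitzWith.of_dist_le_mul fun s t => hz.2 s t
    exact this.continuous
  have hψc := hψ.continuous
  have hc : Continuous fun u => ψ (w u + z u) := by fun_prop
  have hcc : ∀ c : ℝ, Continuous fun u => ψ (w u + c) := fun c => by fun_prop
  rw [Metric.tendsto_atTop]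
  intro ε hε
  obtain ⟨δ, hδ, hδε⟩ := Metric.uniformContinuous_iff.1 hψ (ε / (2 * T)) (by positivity)
  have hlim : Tendsto (fun k : ℕ => 2 * M * (T / 2 ^ k)) atTop (𝓝 0) := by
    have : Tendsto (fun k : ℕ => (2 * M * T) * (1 / 2 : ℝ) ^ k) atTop (𝓝 ((2 * M * T) * 0)) :=
      (tendsto_pow_atTop_nhds_zero_of_lt_one (by norm_num) (by norm_num)).const_mul _
    rw [mul_zero] at this
    refine this.congr fun k => ?_
    rw [one_div, inv_pow]; ring
  obtain ⟨N, hN⟩ := (hlim.eventually (gt_mem_nhds hδ)).exists_forall_of_atTop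
  refine ⟨N, fun k hk => ?_⟩
  set n := 2 ^ k with hn
  set ℓ : ℝ := T / 2 ^ k with hℓ
  have hℓ0 : 0 < ℓ := by positivity
  have hnl : ((n : ℕ) : ℝ) * ℓ = T := by rw [hn, hℓ]; push_cast; field_simp
  have hs : ∫ u in (0:ℝ)..T, ψ (w u + z u) = ∑ j ∈ Finset.range n,
      ∫ u in ((j : ℝ) * ℓ)..(((j + 1 : ℕ) : ℝ) * ℓ), ψ (w u + z u) := by
    rw [intervalIntegral.sum_integral_adjacent_intervals (a := fun j : ℕ => (j : ℝ) * ℓ)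
      (fun j _ => hc.intervalIntegrable _ _), hnl]
    simp
  rw [hs, Real.dist_eq, chainS, ← Finset.sum_sub_distrib]
  have hterm : ∀ j ∈ Finset.range n, |(∫ u in ((j : ℝ) * ℓ)..(((j + 1 : ℕ) : ℝ) * ℓ),
      ψ (w u + M * ℓ * ⌊z ((j : ℝ) * ℓ) / (M * ℓ)⌋)) - ∫ u in ((j : ℝ) * ℓ)..(((j + 1 : ℕ) : ℝ) * ℓ),
      ψ (w u + z u)| ≤ ε / (2 * T) * ℓ := by
    intro j _
    rw [← intervalIntegral.integral_sub ((hcc _).intervalIntegrable _ _) (hc.intervalIntegrable _ _)]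
    have hle : (j : ℝ) * ℓ ≤ ((j + 1 : ℕ) : ℝ) * ℓ := by push_cast; nlinarith
    have := intervalIntegral.norm_integral_le_of_norm_le_const (a := (j : ℝ) * ℓ) (b := ((j + 1 : ℕ) : ℝ) * ℓ)
      (f := fun u => ψ (w u + M * ℓ * ⌊z ((j : ℝ) * ℓ) / (M * ℓ)⌋) - ψ (w u + z u))
      (C := ε / (2 * T)) (fun u hu => by
        rw [Set.uIoc_of_le hle] at hu
        rw [← dist_eq_norm]
        refine (hδε ?_).le
        refine lt_of_le_of_lt ?_ (hN k hk)
        rw [Real.dist_eq]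
        have h1 := Int.floor_le (z ((j : ℝ) * ℓ) / (M * ℓ))
        have h2 := Int.lt_floor_add_one (z ((j : ℝ) * ℓ) / (M * ℓ))
        rw [le_div_iff₀ (by positivity)] at h1
        rw [div_lt_iff₀ (by positivity)] at h2
        have h3 := hz.2 ((j : ℝ) * ℓ) u
        rw [abs_sub_comm _ u, abs_of_nonneg (by linarith [hu.1] : 0 ≤ u - j * ℓ)] at h3
        have h4 : u - j * ℓ ≤ ℓ := by have := hu.2; push_cast at this; linarith
        have h5 : M * (u - j * ℓ) ≤ M * ℓ := by gcongr
        have h6 := abs_le.1 (h3.trans h5)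
        rw [abs_le]
        constructor <;> nlinarith)
    refine this.trans (le_of_eq ?_)
    rw [show ((j + 1 : ℕ) : ℝ) * ℓ - j * ℓ = ℓ by push_cast; ring, abs_of_pos hℓ0]
  refine lt_of_le_of_lt ((Finset.abs_sum_le_sum_abs _ _).trans (Finset.sum_le_sum hterm)) ?_
  rw [Finset.sum_const, Finset.card_range, nsmul_eq_mul]
  calc (n : ℝ) * (ε / (2 * T) * ℓ) = ε / (2 * T) * (n * ℓ) := by ring
    _ = ε / 2 := by rw [hnl]; field_simp
    _ < ε := by linarith

lemma geom_bound {H M T : ℝ} (hH2 : H ≤ 1 / 2) (hM : 0 < M) (hT : 0 < T) :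
    ∃ C : ℝ, 0 < C ∧ ∀ k : ℕ, (fun (n : ℕ) (ℓ a : ℝ) =>
      (2 * n * (a + (2 * n + 1) * (4 * (720 * (ℓ * (20 * (2 * M * ℓ) * ℓ ^ (1 - H))) ^ 3 / a ^ 5)))))
      (2 ^ k) (T / 2 ^ (k + 1)) ((0.95 / 2) ^ k) ≤ C * 0.95 ^ k := by
  set S := T ^ (1 - H) with hS
  have hS0 : 0 < S := rpow_pos_of_pos hT _
  refine ⟨2 + 6 * 4 * 720 * 64000 * M ^ 3 * S ^ 3 * T ^ 6, by positivity, fun k => ?_⟩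
  simp only
  set ℓ : ℝ := T / 2 ^ (k + 1) with hℓ
  have hℓ0 : 0 < ℓ := by positivity
  have hle : ℓ ^ (1 - H) ≤ S * 0.7072 ^ k := by
    have e : ℓ = T * (1 / 2) ^ (k + 1) := by rw [hℓ, one_div, inv_pow]; rfl
    rw [e, mul_rpow hT.le (by positivity)]
    refine mul_le_mul_of_nonneg_left ?_ hS0.le
    calc ((1 / 2 : ℝ) ^ (k + 1)) ^ (1 - H) ≤ ((1 / 2 : ℝ) ^ (k + 1)) ^ (1 / 2 : ℝ) :=
          rpow_le_rpow_of_exponent_ge (by positivity) (pow_le_one₀ (by norm_num) (by norm_num)) (by linarith)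
      _ = ((1 / 2 : ℝ) ^ (1 / 2 : ℝ)) ^ (k + 1) := by
          rw [← rpow_natCast, ← rpow_natCast, ← rpow_mul (by norm_num), ← rpow_mul (by norm_num), mul_comm]
      _ ≤ 0.7072 ^ (k + 1) := by
          refine pow_le_pow_left₀ (by positivity) ?_ _
          rw [← Real.sqrt_eq_rpow, Real.sqrt_le_left (by norm_num)]
          norm_num
      _ ≤ 0.7072 ^ k := pow_le_pow_of_le_one (by norm_num) (by norm_num) (by omega)
  have h6 : ℓ ^ 6 ≤ T ^ 6 * (1 / 64) ^ k := by
    have : ℓ ≤ T * (1 / 2) ^ k := by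
      rw [hℓ, one_div, inv_pow, div_eq_mul_inv]
      gcongr
      · norm_num
      · omega
    calc ℓ ^ 6 ≤ (T * (1 / 2) ^ k) ^ 6 := by gcongr
      _ = _ := by rw [mul_pow, ← pow_mul, mul_comm k 6, pow_mul]; norm_num
  have hpow : ((4 : ℝ) ^ k) * (1 / 64) ^ k * (0.7072 ^ k) ^ 3 / ((0.95 / 2) ^ k) ^ 5 ≤ 0.95 ^ k := by
    rw [← pow_mul, ← pow_mul, mul_comm k 3, mul_comm k 5, pow_mul, pow_mul, ← mul_pow, ← mul_pow, ← div_pow]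
    exact pow_le_pow_left₀ (by norm_num) (by norm_num) k
  have hn : ((2 ^ k : ℕ) : ℝ) = 2 ^ k := by push_cast; rfl
  rw [hn]
  have hn1 : (1 : ℝ) ≤ 2 ^ k := one_le_pow₀ (by norm_num)
  have h1 : 2 * (2 : ℝ) ^ k * (0.95 / 2) ^ k = 2 * 0.95 ^ k := by
    rw [mul_assoc, ← mul_pow]; norm_num
  have h2 : 2 * (2 : ℝ) ^ k * (2 * 2 ^ k + 1) ≤ 6 * 4 ^ k := by
    have : (4 : ℝ) ^ k = 2 ^ k * 2 ^ k := by rw [← mul_pow]; norm_num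
    rw [this]; nlinarith
  have h3 : (ℓ * (20 * (2 * M * ℓ) * ℓ ^ (1 - H))) ^ 3 ≤ 64000 * M ^ 3 * S ^ 3 * T ^ 6 * ((1 / 64) ^ k * (0.7072 ^ k) ^ 3) := by
    have hr : 0 ≤ ℓ ^ (1 - H) := rpow_nonneg hℓ0.le _
    calc _ = 64000 * M ^ 3 * (ℓ ^ 6 * (ℓ ^ (1 - H)) ^ 3) := by ring
      _ ≤ 64000 * M ^ 3 * ((T ^ 6 * (1 / 64) ^ k) * (S * 0.7072 ^ k) ^ 3) := by gcongr
      _ = _ := by ring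
  have ha : (0 : ℝ) < ((0.95 / 2) ^ k) ^ 5 := by positivity
  have hX : 0 ≤ (ℓ * (20 * (2 * M * ℓ) * ℓ ^ (1 - H))) ^ 3 := by
    have hr : 0 ≤ ℓ ^ (1 - H) := rpow_nonneg hℓ0.le _
    positivity
  calc _ = 2 * (2 : ℝ) ^ k * (0.95 / 2) ^ k + (2 * (2 : ℝ) ^ k * (2 * 2 ^ k + 1)) * (4 * 720) *
        ((ℓ * (20 * (2 * M * ℓ) * ℓ ^ (1 - H))) ^ 3 / ((0.95 / 2) ^ k) ^ 5) := by ring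
    _ ≤ 2 * 0.95 ^ k + (6 * 4 ^ k) * (4 * 720) * ((64000 * M ^ 3 * S ^ 3 * T ^ 6 * ((1 / 64) ^ k * (0.7072 ^ k) ^ 3)) / ((0.95 / 2) ^ k) ^ 5) := by
        rw [h1]
        refine add_le_add le_rfl ?_
        refine mul_le_mul (mul_le_mul_of_nonneg_right h2 (by norm_num)) (div_le_div_of_nonneg_right h3 ha.le) (by positivity) (by positivity)
    _ = 2 * 0.95 ^ k + (6 * 4 * 720 * 64000 * M ^ 3 * S ^ 3 * T ^ 6) * (((4 : ℝ) ^ k) * (1 / 64) ^ k * (0.7072 ^ k) ^ 3 / ((0.95 / 2) ^ k) ^ 5) := by ring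
    _ ≤ 2 * 0.95 ^ k + (6 * 4 * 720 * 64000 * M ^ 3 * S ^ 3 * T ^ 6) * 0.95 ^ k := by gcongr
    _ = _ := by ring

section
variable {Ω : Type*} [mΩ : MeasurableSpace Ω] {P : Measure Ω} [IsProbabilityMeasure P]
  {H : ℝ} {W : ℝ → Ω → ℝ}

lemma crude_pt (hW : IsFractionalBM P H W) (hH : 0 < H) {u : ℝ} (hu : 0 < u)
    (f : ℝ → ℝ≥0∞) (hf : Measurable f) (c : ℝ) :
    ∫⁻ ω, f (W u ω + c) ∂P ≤ ENNReal.ofReal (u ^ (-H)) * ∫⁻ x, f x := by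
  have hv : (0:ℝ) < u ^ (2 * H) := rpow_pos_of_pos hu _
  have h1 : ∫⁻ ω, f (W u ω + c) ∂P = ∫⁻ x, f (x + c) ∂(P.map (W u)) := by
    rw [lintegral_map (f := fun x => f (x + c)) (hf.comp (measurable_id.add_const c)) (hW.1 u)]
  have hv' : (u ^ (2 * H)).toNNReal ≠ 0 := by
    rw [Ne, Real.toNNReal_eq_zero, not_le]; exact hv
  rw [h1, fbm_map hW hu.le hH, gaussianReal_of_var_ne_zero _ hv',
    lintegral_withDensity_eq_lintegral_mul _ (measurable_gaussianPDF _ _) (g := fun x => f (x + c)) (hf.comp (measurable_id.add_const c))]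
  have hb : ∀ x, gaussianPDF 0 (u ^ (2 * H)).toNNReal x ≤ ENNReal.ofReal (u ^ (-H)) := by
    intro x
    unfold gaussianPDF
    refine ENNReal.ofReal_le_ofReal ?_
    unfold gaussianPDFReal
    rw [Real.coe_toNNReal _ hv.le]
    have e1 : (u ^ (-H)) = (√(u ^ (2 * H)))⁻¹ := by
      rw [rpow_neg hu.le, Real.sqrt_eq_rpow, ← rpow_mul hu.le]
      congr 2; ring
    rw [e1]
    have e2 : Real.exp (-(x - 0) ^ 2 / (2 * u ^ (2 * H))) ≤ 1 := by
      rw [Real.exp_le_one_iff]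
      exact div_nonpos_of_nonpos_of_nonneg (by nlinarith [sq_nonneg (x - 0)]) (by positivity)
    have e3 : (√(2 * π * u ^ (2 * H)))⁻¹ ≤ (√(u ^ (2 * H)))⁻¹ := by
      have : 0 < √(u ^ (2 * H)) := Real.sqrt_pos.2 hv
      gcongr
      nlinarith [Real.pi_gt_three]
    calc _ ≤ (√(2 * π * u ^ (2 * H)))⁻¹ * 1 := by gcongr
      _ ≤ _ := by rw [mul_one]; exact e3
  calc _ ≤ ∫⁻ x, ENNReal.ofReal (u ^ (-H)) * f (x + c) := by
        refine lintegral_mono fun x => ?_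
        simp only [Pi.mul_apply, Function.comp]
        gcongr
        exact hb x
    _ = ENNReal.ofReal (u ^ (-H)) * ∫⁻ x, f (x + c) := by
        exact lintegral_const_mul _ (hf.comp (measurable_id.add_const c))
    _ = _ := by rw [lintegral_add_right_eq_self f c]

/-- The crude bound. -/
noncomputable def crudeB (T : ℝ) (w : ℝ → ℝ) (ψ : ℝ → ℝ) (h : ℝ) (n : ℕ) : ℝ≥0∞ :=
  ∑ i ∈ Finset.Icc (-(n : ℤ)) n, ∫⁻ u in Set.Ioc 0 T, ENNReal.ofReal (ψ (w u + h * i))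

lemma uncurry_meas (hW : IsFractionalBM P H W) (hWc : ∀ ω, Continuous fun t => W t ω) :
    Measurable fun q : Ω × ℝ => W q.2 q.1 :=
  (measurable_uncurry_of_continuous_of_measurable hWc hW.1).comp measurable_swap

lemma crudeB_meas (hW : IsFractionalBM P H W) (hWc : ∀ ω, Continuous fun t => W t ω)
    (ψ : ℝ → ℝ) (hψ : Continuous ψ) (T h : ℝ) (n : ℕ) :
    Measurable fun ω => crudeB T (fun t => W t ω) ψ h n := by
  unfold crudeB
  refine Finset.measurable_fun_sum _ fun i _ => ?_
  refine Measurable.lintegral_prod_right' (f := fun q : Ω × ℝ => ENNReal.ofReal (ψ (W q.2 q.1 + h * i))) ?_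
  exact (hψ.measurable.comp ((uncurry_meas hW hWc).add_const _)).ennreal_ofReal

lemma crudeB_int (hW : IsFractionalBM P H W) (hH : 0 < H) (hWc : ∀ ω, Continuous fun t => W t ω)
    (ψ : ℝ → ℝ) (hψ : Continuous ψ) (T h : ℝ) (n : ℕ) :
    ∫⁻ ω, crudeB T (fun t => W t ω) ψ h n ∂P ≤
      (2 * n + 1) * ((∫⁻ u in Set.Ioc 0 T, ENNReal.ofReal (u ^ (-H))) * ∫⁻ x, ENNReal.ofReal (ψ x)) := by
  unfold crudeB
  have hm : ∀ i : ℤ, Measurable fun q : Ω × ℝ => ENNReal.ofReal (ψ (W q.2 q.1 + h * i)) := fun i =>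
    (hψ.measurable.comp ((uncurry_meas hW hWc).add_const _)).ennreal_ofReal
  rw [lintegral_finsetSum _ fun i _ => Measurable.lintegral_prod_right' (hm i)]
  have hterm : ∀ i ∈ Finset.Icc (-(n : ℤ)) n,
      ∫⁻ ω, (∫⁻ u in Set.Ioc 0 T, ENNReal.ofReal (ψ (W u ω + h * i))) ∂P ≤
      (∫⁻ u in Set.Ioc 0 T, ENNReal.ofReal (u ^ (-H))) * ∫⁻ x, ENNReal.ofReal (ψ x) := by
    intro i _
    rw [lintegral_lintegral_swap (hm i).aemeasurable, ← lintegral_mul_const _ (by fun_prop)]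
    refine setLIntegral_mono (by fun_prop) fun u hu => ?_
    exact crude_pt hW hH hu.1 (fun x => ENNReal.ofReal (ψ x)) hψ.measurable.ennreal_ofReal _
  refine (Finset.sum_le_sum hterm).trans (le_of_eq ?_)
  rw [Finset.sum_const, Int.card_Icc, nsmul_eq_mul]
  congr 1
  rw [show (n : ℤ) + 1 - -(n : ℤ) = ((2 * n + 1 : ℕ) : ℤ) by push_cast; ring, Int.toNat_natCast]
  push_cast; ring

lemma crude_path {w ψ : ℝ → ℝ} (hw : Continuous w) (hψ : Continuous ψ) (h0ψ : ∀ x, 0 ≤ ψ x) {M ℓ T : ℝ} (hM : 0 < M)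
    (hℓ : 0 < ℓ) (n : ℕ) (hn : n * ℓ = T) {z : ℝ → ℝ} (hz : z ∈ LipM M) :
    ENNReal.ofReal (chainS w ψ M n ℓ z) ≤ crudeB T w ψ (M * ℓ) n := by
  have hc : ∀ c : ℝ, Continuous fun u => ψ (w u + c) := fun c => by fun_prop
  have hT : 0 ≤ T := by rw [← hn]; positivity
  have hMℓ : 0 < M * ℓ := by positivity
  have hle : ∀ j : ℕ, (j : ℝ) * ℓ ≤ ((j + 1 : ℕ) : ℝ) * ℓ := fun j => by push_cast; nlinarith
  have hidx : ∀ j < n, ⌊z ((j : ℝ) * ℓ) / (M * ℓ)⌋ ∈ Finset.Icc (-(n : ℤ)) n := by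
    intro j hj
    set v := z ((j : ℝ) * ℓ) / (M * ℓ) with hv
    have h2 : |v| ≤ n := by
      rw [hv, abs_div, abs_of_pos hMℓ, div_le_iff₀ hMℓ]
      have := hz.2 ((j : ℝ) * ℓ) 0
      rw [hz.1, sub_zero, sub_zero, abs_of_nonneg (by positivity : 0 ≤ (j : ℝ) * ℓ)] at this
      refine this.trans ?_
      have hjn : (j : ℝ) ≤ n := by exact_mod_cast hj.le
      calc M * (j * ℓ) = j * (M * ℓ) := by ring
        _ ≤ _ := by gcongr
    rw [abs_le] at h2
    have f1 := Int.floor_le v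
    rw [Finset.mem_Icc]
    constructor
    · rw [Int.le_floor]; push_cast; linarith
    · have : (⌊v⌋ : ℝ) ≤ ((n : ℤ) : ℝ) := by push_cast; linarith
      exact_mod_cast this
  have hreal : chainS w ψ M n ℓ z ≤ ∑ i ∈ Finset.Icc (-(n : ℤ)) n, ∫ u in (0:ℝ)..T, ψ (w u + M * ℓ * i) := by
    have hs : ∀ i : ℤ, ∫ u in (0:ℝ)..T, ψ (w u + M * ℓ * i) = ∑ j ∈ Finset.range n,
      ∫ u in ((j : ℝ) * ℓ)..(((j + 1 : ℕ) : ℝ) * ℓ), ψ (w u + M * ℓ * i) := by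
      intro i
      rw [intervalIntegral.sum_integral_adjacent_intervals (a := fun j : ℕ => (j : ℝ) * ℓ)
        (fun j _ => (hc _).intervalIntegrable _ _), hn]
      simp
    simp_rw [hs]
    rw [Finset.sum_comm, chainS]
    refine Finset.sum_le_sum fun j hj => ?_
    exact Finset.single_le_sum (f := fun i : ℤ => ∫ u in ((j : ℝ) * ℓ)..(((j + 1 : ℕ) : ℝ) * ℓ), ψ (w u + M * ℓ * i))
      (fun i _ => intervalIntegral.integral_nonneg (hle j) fun u _ => h0ψ _) (hidx j (Finset.mem_range.1 hj))
  refine (ENNReal.ofReal_le_ofReal hreal).trans ?_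
  rw [ENNReal.ofReal_sum_of_nonneg fun i _ => intervalIntegral.integral_nonneg hT fun u _ => h0ψ _]
  unfold crudeB
  refine Finset.sum_le_sum fun i _ => ?_
  rw [intervalIntegral.integral_of_le hT, ofReal_integral_eq_lintegral_ofReal
    (((hc _).integrableOn_Icc).mono_set Set.Ioc_subset_Icc_self) (ae_of_all _ fun u => h0ψ _)]

lemma occ_psi (hW : IsFractionalBM P H W) (hH : 0 < H) (hH2 : H ≤ 1 / 2) (hW0 : ∀ ω, W 0 ω = 0)
    (hWc : ∀ ω, Continuous fun t => W t ω) {M T : ℝ} (hM : 0 < M) (hT : 0 < T) {ε : ℝ} (hε : 0 < ε) :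
    ∃ η : ℝ, 0 < η ∧ ∀ ψ : ℝ → ℝ, UniformContinuous ψ → (∀ x, 0 ≤ ψ x) → (∀ x, ψ x ≤ 1) →
      ∫⁻ x, ENNReal.ofReal (ψ x) ≤ ENNReal.ofReal η →
      ∃ ρ : Ω → ℝ≥0∞, Measurable ρ ∧ ∫⁻ ω, ρ ω ∂P ≤ ENNReal.ofReal ε ∧ ∀ ω, ∀ z ∈ LipM M,
        ∫⁻ u in Set.Ioc 0 T, ENNReal.ofReal (ψ (W u ω + z u)) ≤ ρ ω := by
  obtain ⟨C, hC, hCk⟩ := geom_bound (H := H) hH2 hM hT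
  obtain ⟨K, hK⟩ : ∃ K : ℕ, C * 0.95 ^ K * 20 ≤ ε / 2 := by
    have : Tendsto (fun K : ℕ => C * (0.95 : ℝ) ^ K * 20) atTop (𝓝 (C * 0 * 20)) :=
      ((tendsto_pow_atTop_nhds_zero_of_lt_one (by norm_num) (by norm_num)).const_mul _).mul_const _
    rw [mul_zero, zero_mul] at this
    obtain ⟨K, hK⟩ := (this.eventually (gt_mem_nhds (half_pos hε))).exists
    exact ⟨K, hK.le⟩
  set I := ∫⁻ u in Set.Ioc 0 T, ENNReal.ofReal (u ^ (-H)) with hI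
  have hIfin : I ≠ ⊤ := by
    have := (intervalIntegral.intervalIntegrable_rpow' (a := 0) (b := T) (r := -H) (by linarith))
    rw [intervalIntegrable_iff_integrableOn_Ioc_of_le hT.le] at this
    have h2 := this.lintegral_lt_top
    exact h2.ne
  set A : ℝ := (2 * ((2 ^ K : ℕ) : ℝ) + 1) * I.toReal with hA
  have hA0 : 0 ≤ A := by positivity
  refine ⟨ε / 2 / (A + 1), by positivity, fun ψ hψu h0 h1 hη => ?_⟩
  have hψ := hψu.continuous
  refine ⟨fun ω => crudeB T (fun t => W t ω) ψ (M * (T / 2 ^ K)) (2 ^ K) +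
    ∑' k : ℕ, ENNReal.ofReal (chainD (fun t => W t ω) ψ M (2 ^ (K + k)) (T / 2 ^ (K + k + 1)) ((0.95 / 2) ^ (K + k))),
    ?_, ?_, ?_⟩
  · refine (crudeB_meas hW hWc ψ hψ T _ _).add (Measurable.ennreal_tsum fun k => ?_)
    exact (chainD_meas hW hWc ψ hψ (by positivity) _).ennreal_ofReal
  · rw [lintegral_add_left (crudeB_meas hW hWc ψ hψ T _ _), lintegral_tsum fun k =>
      ((chainD_meas hW hWc ψ hψ (by positivity) _).ennreal_ofReal).aemeasurable,
      show ε = ε / 2 + ε / 2 by ring, ENNReal.ofReal_add (by positivity) (by positivity)]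
    refine add_le_add ?_ ?_
    · refine (crudeB_int hW hH hWc ψ hψ T _ _).trans ?_
      rw [← hI, ← mul_assoc]
      calc _ ≤ ENNReal.ofReal A * ENNReal.ofReal (ε / 2 / (A + 1)) := by
            refine mul_le_mul' (le_of_eq ?_) hη
            rw [hA, ENNReal.ofReal_mul (by positivity), ENNReal.ofReal_toReal hIfin,
              ENNReal.ofReal_add (by positivity) (by positivity), ENNReal.ofReal_mul (by positivity), ENNReal.ofReal_natCast]
            simp
        _ = ENNReal.ofReal (A * (ε / 2 / (A + 1))) := by rw [ENNReal.ofReal_mul hA0]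
        _ ≤ _ := by
            refine ENNReal.ofReal_le_ofReal ?_
            rw [mul_div_assoc', div_le_iff₀ (by positivity)]
            nlinarith
    · have hk : ∀ k : ℕ, ∫⁻ ω, ENNReal.ofReal (chainD (fun t => W t ω) ψ M (2 ^ (K + k)) (T / 2 ^ (K + k + 1))
          ((0.95 / 2) ^ (K + k))) ∂P ≤ ENNReal.ofReal (C * 0.95 ^ K * 0.95 ^ k) := by
        intro k
        refine (chainD_int hW hH hH2 hW0 hWc ψ hψ h0 h1 hM (by positivity) (by positivity) _).trans ?_
        refine ENNReal.ofReal_le_ofReal ?_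
        have := hCk (K + k)
        simp only at this
        rw [pow_add (0.95 : ℝ), ← mul_assoc C] at this
        exact this
      refine (ENNReal.tsum_le_tsum hk).trans ?_
      have hsum : HasSum (fun k : ℕ => C * (0.95:ℝ) ^ K * 0.95 ^ k) (C * 0.95 ^ K * (1 - 0.95)⁻¹) :=
        (hasSum_geometric_of_lt_one (by norm_num) (by norm_num)).mul_left _
      rw [← ENNReal.ofReal_tsum_of_nonneg (fun k => by positivity) hsum.summable, hsum.tsum_eq]
      refine ENNReal.ofReal_le_ofReal (le_trans (le_of_eq ?_) hK)
      norm_num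
  · intro ω z hz
    set w : ℝ → ℝ := fun t => W t ω with hw
    have hwc : Continuous w := hWc ω
    set D : ℕ → ℝ := fun k => chainD w ψ M (2 ^ k) (T / 2 ^ (k + 1)) ((0.95 / 2) ^ k) with hD
    have hD0 : ∀ k, 0 ≤ D k := fun k => chainD_nonneg (by positivity) _
    have hstep : ∀ k : ℕ, chainS w ψ M (2 ^ (k + 1)) (T / 2 ^ (k + 1)) z ≤ chainS w ψ M (2 ^ k) (T / 2 ^ k) z + D k := by
      intro k
      have := chain_path hwc hψ hM (ℓ := T / 2 ^ (k + 1)) (by positivity) (a := (0.95 / 2) ^ k) (by positivity) (2 ^ k) hz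
      rw [show 2 * 2 ^ k = 2 ^ (k + 1) by ring, show 2 * (T / 2 ^ (k + 1)) = T / 2 ^ k by field_simp; ring] at this
      have := (le_abs_self _).trans this
      simp only [hD]; linarith
    have htel : ∀ m : ℕ, ENNReal.ofReal (chainS w ψ M (2 ^ (K + m)) (T / 2 ^ (K + m)) z) ≤
        ENNReal.ofReal (chainS w ψ M (2 ^ K) (T / 2 ^ K) z) + ∑ k ∈ Finset.range m, ENNReal.ofReal (D (K + k)) := by
      intro m
      induction m with
      | zero => simp
      | succ m ih =>
        rw [Finset.sum_range_succ, ← add_assoc (ENNReal.ofReal _)]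
        refine (ENNReal.ofReal_le_ofReal (hstep (K + m))).trans (ENNReal.ofReal_add_le.trans ?_)
        exact add_le_add ih le_rfl
    have hcr := crude_path hwc hψ h0 hM (ℓ := T / 2 ^ K) (T := T) (by positivity) (2 ^ K) (by push_cast; field_simp) hz
    have hzc : Continuous z := by
      have : LipschitzWith ⟨M, hM.le⟩ z := LipschitzWith.of_dist_le_mul fun s t => hz.2 s t
      exact this.continuous
    have hc : Continuous fun u => ψ (w u + z u) := by fun_prop
    have hintg : ∫⁻ u in Set.Ioc 0 T, ENNReal.ofReal (ψ (w u + z u)) = ENNReal.ofReal (∫ u in (0:ℝ)..T, ψ (w u + z u)) := by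
      rw [intervalIntegral.integral_of_le hT.le, ofReal_integral_eq_lintegral_ofReal
        ((hc.integrableOn_Icc).mono_set Set.Ioc_subset_Icc_self) (ae_of_all _ fun u => h0 _)]
    rw [hintg]
    have hlim := (ENNReal.continuous_ofReal.tendsto _).comp ((chain_tendsto hwc hψu hM hT hz).comp (tendsto_add_atTop_nat K))
    refine le_of_tendsto' hlim fun m => ?_
    simp only [Function.comp]
    rw [add_comm m K]
    refine (htel m).trans (add_le_add hcr ?_)
    exact ENNReal.sum_le_tsum _

end
end FBMProof

open MeasureTheory ProbabilityTheory Real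

namespace FBMProof
open scoped ENNReal Topology
open Filter

section
variable {Ω : Type*} [mΩ : MeasurableSpace Ω] {P : Measure Ω} [IsProbabilityMeasure P]
  {H : ℝ} {W : ℝ → Ω → ℝ}

lemma occ_open (hW : IsFractionalBM P H W) (hH : 0 < H) (hH2 : H ≤ 1 / 2) (hW0 : ∀ ω, W 0 ω = 0)
    (hWc : ∀ ω, Continuous fun t => W t ω) {M T : ℝ} (hM : 0 < M) (hT : 0 < T) (x₀ : ℝ) {ε : ℝ} (hε : 0 < ε) :
    ∃ η : ℝ, 0 < η ∧ ∀ U : Set ℝ, IsOpen U → volume U ≤ ENNReal.ofReal η →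
      ∃ ρ : Ω → ℝ≥0∞, Measurable ρ ∧ ∫⁻ ω, ρ ω ∂P ≤ ENNReal.ofReal ε ∧ ∀ ω, ∀ z ∈ LipM M,
        ∫⁻ u in Set.Ioc 0 T, U.indicator 1 (x₀ + W u ω + z u) ≤ ρ ω := by
  obtain ⟨η, hη, h⟩ := occ_psi hW hH hH2 hW0 hWc hM hT hε
  refine ⟨η, hη, fun U hU hUη => ?_⟩
  have hne : (Uᶜ).Nonempty := by
    rw [Set.nonempty_compl]
    rintro rfl
    simp at hUη
  set ψ : ℕ → ℝ → ℝ := fun i x => min 1 (i * Metric.infDist (x₀ + x) Uᶜ) with hψ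
  have h0 : ∀ i x, 0 ≤ ψ i x := fun i x => le_min zero_le_one (by have := Metric.infDist_nonneg (x := x₀ + x) (s := Uᶜ); positivity)
  have h1 : ∀ i x, ψ i x ≤ 1 := fun i x => min_le_left _ _
  have hu : ∀ i, UniformContinuous (ψ i) := by
    intro i
    have l2 : LipschitzWith (i : NNReal) (ψ i) := by
      refine LipschitzWith.of_dist_le_mul fun x y => ?_
      simp only [hψ]
      have hinf : |Metric.infDist (x₀ + x) Uᶜ - Metric.infDist (x₀ + y) Uᶜ| ≤ |x - y| := by
        have := (Metric.lipschitz_infDist_pt Uᶜ).dist_le_mul (x₀ + x) (x₀ + y)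
        simpa [Real.dist_eq] using this
      calc dist (min 1 ((i:ℝ) * Metric.infDist (x₀ + x) Uᶜ)) (min 1 ((i:ℝ) * Metric.infDist (x₀ + y) Uᶜ))
          ≤ |(i:ℝ) * Metric.infDist (x₀ + x) Uᶜ - (i:ℝ) * Metric.infDist (x₀ + y) Uᶜ| := by
            rw [Real.dist_eq]
            have := abs_min_sub_min_le_max (1:ℝ) ((i:ℝ) * Metric.infDist (x₀ + x) Uᶜ) 1 ((i:ℝ) * Metric.infDist (x₀ + y) Uᶜ)
            simpa using this
        _ = i * |Metric.infDist (x₀ + x) Uᶜ - Metric.infDist (x₀ + y) Uᶜ| := by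
            rw [← mul_sub, abs_mul, Nat.abs_cast]
        _ ≤ i * |x - y| := by gcongr
        _ = _ := by simp [Real.dist_eq]
    exact l2.uniformContinuous
  have hzero : ∀ i x, x₀ + x ∉ U → ψ i x = 0 := by
    intro i x hx
    simp only [hψ]
    rw [Metric.infDist_zero_of_mem (show x₀ + x ∈ Uᶜ from hx)]
    simp
  have hlim : ∀ x, Tendsto (fun i : ℕ => ENNReal.ofReal (ψ i x)) atTop (𝓝 (U.indicator 1 (x₀ + x))) := by
    intro x
    by_cases hx : x₀ + x ∈ U
    · have hpos : 0 < Metric.infDist (x₀ + x) Uᶜ :=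
        (hU.isClosed_compl.notMem_iff_infDist_pos hne).1 (by simpa using hx)
      rw [Set.indicator_of_mem hx]
      obtain ⟨N, hN⟩ := exists_nat_gt (1 / Metric.infDist (x₀ + x) Uᶜ)
      refine tendsto_const_nhds.congr' ?_
      filter_upwards [eventually_ge_atTop N] with i hi
      have hi' : (N : ℝ) ≤ i := by exact_mod_cast hi
      have : 1 ≤ (i : ℝ) * Metric.infDist (x₀ + x) Uᶜ := by
        rw [div_lt_iff₀ hpos] at hN
        nlinarith
      simp [hψ, min_eq_left this]
    · rw [Set.indicator_of_notMem hx]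
      refine tendsto_const_nhds.congr fun i => ?_
      rw [hzero i x hx, ENNReal.ofReal_zero]
  have hintg : ∀ i, ∫⁻ x, ENNReal.ofReal (ψ i x) ≤ ENNReal.ofReal η := by
    intro i
    calc ∫⁻ x, ENNReal.ofReal (ψ i x) ≤ ∫⁻ x, U.indicator 1 (x₀ + x) := by
          refine lintegral_mono fun x => ?_
          by_cases hx : x₀ + x ∈ U
          · rw [Set.indicator_of_mem hx]
            simpa using h1 i x
          · rw [hzero i x hx]; simp
      _ = ∫⁻ x, U.indicator 1 x := lintegral_add_left_eq_self (fun x => U.indicator 1 x) x₀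
      _ = volume U := lintegral_indicator_one hU.measurableSet
      _ ≤ _ := hUη
  choose ρ hρm hρi hρ using fun i => h (ψ i) (hu i) (h0 i) (h1 i) (hintg i)
  refine ⟨fun ω => liminf (fun i => ρ i ω) atTop, Measurable.liminf hρm, ?_, fun ω z hz => ?_⟩
  · refine (lintegral_liminf_le hρm).trans ?_
    exact liminf_le_of_le (by isBoundedDefault) fun b hb => by
      obtain ⟨i, hi⟩ := hb.exists
      exact hi.trans (hρi i)
  · have hzc : Continuous z := by
      have : LipschitzWith ⟨M, hM.le⟩ z := LipschitzWith.of_dist_le_mul fun s t => hz.2 s t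
      exact this.continuous
    have hwc := hWc ω
    calc ∫⁻ u in Set.Ioc 0 T, U.indicator 1 (x₀ + W u ω + z u)
        = ∫⁻ u in Set.Ioc 0 T, liminf (fun i => ENNReal.ofReal (ψ i (W u ω + z u))) atTop := by
          refine lintegral_congr fun u => ?_
          rw [(hlim (W u ω + z u)).liminf_eq, add_assoc]
      _ ≤ liminf (fun i => ∫⁻ u in Set.Ioc 0 T, ENNReal.ofReal (ψ i (W u ω + z u))) atTop := by
          refine lintegral_liminf_le fun i => ?_
          have := (hu i).continuous
          exact (this.comp (hwc.add hzc)).measurable.ennreal_ofReal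
      _ ≤ _ := liminf_le_liminf (Eventually.of_forall fun i => hρ i ω z hz)

lemma approx_cont {b : ℝ → ℝ} (hbi : Integrable b) {M : ℝ} (hM : 0 < M) (hb : ∀ x, |b x| ≤ M)
    {ε η : ℝ} (hε : 0 < ε) (hη : 0 < η) :
    ∃ (g : ℝ → ℝ) (U : Set ℝ), Continuous g ∧ (∀ x, |g x| ≤ M) ∧ IsOpen U ∧ volume U ≤ ENNReal.ofReal η ∧
      ∀ x, |b x - g x| ≤ ε + 2 * M * U.indicator 1 x := by
  obtain ⟨f, -, hf, hfc, hfi⟩ := hbi.exists_hasCompactSupport_lintegral_sub_le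
    (ε := ENNReal.ofReal (ε * (η / 2))) (by simp; positivity)
  set g : ℝ → ℝ := fun x => max (-M) (min (f x) M) with hg
  have hgc : Continuous g := by fun_prop
  set S : Set ℝ := {x | ENNReal.ofReal ε ≤ ‖b x - f x‖ₑ} with hS
  have hSm : volume S ≤ ENNReal.ofReal (η / 2) := by
    have := mul_meas_ge_le_lintegral₀ (μ := volume) (f := fun x => ‖b x - f x‖ₑ)
      ((hbi.aestronglyMeasurable.sub hfc.aestronglyMeasurable).enorm) (ENNReal.ofReal ε)
    have h2 := this.trans hf
    rw [ENNReal.ofReal_mul hε.le] at h2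
    exact (ENNReal.mul_le_mul_iff_right (by simpa using hε) (by simp)).1 h2
  obtain ⟨U, hSU, hU, hUη⟩ := S.exists_isOpen_lt_of_lt (μ := volume) (ENNReal.ofReal η)
    (hSm.trans_lt ((ENNReal.ofReal_lt_ofReal_iff hη).2 (by linarith)))
  have hgM : ∀ x, |g x| ≤ M := fun x => abs_le.2 ⟨le_max_left _ _, max_le (by linarith) (min_le_right _ _)⟩
  refine ⟨g, U, hgc, hgM, hU, hUη.le, fun x => ?_⟩
  by_cases hx : x ∈ U
  · rw [Set.indicator_of_mem hx]
    have h1 := abs_le.1 (hb x)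
    have h2 := abs_le.1 (hgM x)
    simp only [Pi.one_apply]
    rw [abs_le]; constructor <;> linarith
  · rw [Set.indicator_of_notMem hx, mul_zero, add_zero]
    have hx' : ¬ ENNReal.ofReal ε ≤ ‖b x - f x‖ₑ := fun hh => hx (hSU hh)
    rw [not_le, Real.enorm_eq_ofReal_abs, ENNReal.ofReal_lt_ofReal_iff hε, abs_lt] at hx'
    have h1 := abs_le.1 (hb x)
    simp only [hg]
    rw [abs_le]
    constructor
    · rcases max_choice (-M) (min (f x) M) with h | h <;> rw [h]
      · linarith
      · linarith [min_le_left (f x) M]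
    · rcases min_choice (f x) M with h | h <;> rw [h]
      · linarith [le_max_right (-M) (f x)]
      · linarith [le_max_right (-M) M]

lemma drift_approx (hW : IsFractionalBM P H W) (hH : 0 < H) (hH2 : H ≤ 1 / 2) (hW0 : ∀ ω, W 0 ω = 0)
    (hWc : ∀ ω, Continuous fun t => W t ω) {M T : ℝ} (hM : 0 < M) (hT : 0 < T) (x₀ : ℝ)
    {b : ℝ → ℝ} (hbm : Measurable b) (hbi : Integrable b) (hb : ∀ x, |b x| ≤ M) :
    ∃ (g : ℕ → ℝ → ℝ) (R : ℕ → Ω → ℝ≥0∞), (∀ n, Continuous (g n)) ∧ (∀ n x, |g n x| ≤ M) ∧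
      (∀ n, Measurable (R n)) ∧ (∀ n, ∫⁻ ω, R n ω ∂P ≤ ENNReal.ofReal ((1 / 2) ^ n)) ∧
      (∀ᵐ ω ∂P, Tendsto (fun n => R n ω) atTop (𝓝 0)) ∧
      ∀ n ω, ∀ z ∈ LipM M, ∫⁻ u in Set.Ioc 0 T,
        ENNReal.ofReal |b (x₀ + W u ω + z u) - g n (x₀ + W u ω + z u)| ≤ R n ω := by
  have key : ∀ n : ℕ, ∃ (g : ℝ → ℝ) (R : Ω → ℝ≥0∞), Continuous g ∧ (∀ x, |g x| ≤ M) ∧ Measurable R ∧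
      ∫⁻ ω, R ω ∂P ≤ ENNReal.ofReal ((1 / 2) ^ n) ∧ ∀ ω, ∀ z ∈ LipM M, ∫⁻ u in Set.Ioc 0 T,
        ENNReal.ofReal |b (x₀ + W u ω + z u) - g (x₀ + W u ω + z u)| ≤ R ω := by
    intro n
    set δ : ℝ := (1 / 2) ^ n / 2 with hδ
    have hδ0 : 0 < δ := by positivity
    obtain ⟨η, hη, h⟩ := occ_open hW hH hH2 hW0 hWc hM hT x₀ (ε := δ / (2 * M)) (by positivity)
    obtain ⟨g, U, hgc, hgM, hU, hUη, hbg⟩ := approx_cont hbi hM hb (ε := δ / T) (by positivity) hη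
    obtain ⟨ρ, hρm, hρi, hρ⟩ := h U hU hUη
    refine ⟨g, fun ω => ENNReal.ofReal δ + ENNReal.ofReal (2 * M) * ρ ω, hgc, hgM, by fun_prop, ?_, fun ω z hz => ?_⟩
    · rw [lintegral_add_left (by fun_prop), lintegral_const_mul _ hρm, lintegral_const, measure_univ, mul_one]
      calc _ ≤ ENNReal.ofReal δ + ENNReal.ofReal (2 * M) * ENNReal.ofReal (δ / (2 * M)) := by gcongr
        _ = ENNReal.ofReal ((1 / 2) ^ n) := by
          rw [← ENNReal.ofReal_mul (by positivity), ← ENNReal.ofReal_add (by positivity) (by positivity)]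
          congr 1
          rw [hδ]; field_simp; ring
    · have hzc : Continuous z := by
        have : LipschitzWith ⟨M, hM.le⟩ z := LipschitzWith.of_dist_le_mul fun s t => hz.2 s t
        exact this.continuous
      have hwc := hWc ω
      have hmU : Measurable fun u => U.indicator (1 : ℝ → ℝ≥0∞) (x₀ + W u ω + z u) :=
        (measurable_one.indicator hU.measurableSet).comp ((hwc.const_add x₀ |>.add hzc).measurable)
      calc _ ≤ ∫⁻ u in Set.Ioc 0 T, (ENNReal.ofReal (δ / T) + ENNReal.ofReal (2 * M) * U.indicator 1 (x₀ + W u ω + z u)) := by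
            refine lintegral_mono fun u => ?_
            refine (ENNReal.ofReal_le_ofReal (hbg _)).trans (ENNReal.ofReal_add_le.trans ?_)
            refine add_le_add le_rfl ?_
            by_cases hx : x₀ + W u ω + z u ∈ U
            · simp [Set.indicator_of_mem hx]
            · simp [Set.indicator_of_notMem hx]
        _ = ENNReal.ofReal δ + ENNReal.ofReal (2 * M) * ∫⁻ u in Set.Ioc 0 T, U.indicator 1 (x₀ + W u ω + z u) := by
            rw [lintegral_add_left (by fun_prop), lintegral_const_mul _ hmU, lintegral_const,
              Measure.restrict_apply_univ, Real.volume_Ioc, sub_zero, ← ENNReal.ofReal_mul (by positivity)]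
            congr 2; field_simp
        _ ≤ _ := add_le_add le_rfl (mul_le_mul' le_rfl (hρ ω z hz))
  choose g R h1 h2 h3 h4 h5 using key
  refine ⟨g, R, h1, h2, h3, h4, ?_, h5⟩
  have hs : ∫⁻ ω, ∑' n, R n ω ∂P ≠ ⊤ := by
    rw [lintegral_tsum fun n => (h3 n).aemeasurable]
    refine ne_top_of_le_ne_top ?_ (ENNReal.tsum_le_tsum h4)
    rw [← ENNReal.ofReal_tsum_of_nonneg (fun k => by positivity) (summable_geometric_of_lt_one (by norm_num) (by norm_num))]
    exact ENNReal.ofReal_ne_top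
  filter_upwards [ae_lt_top (Measurable.ennreal_tsum h3) hs] with ω hω
  exact ENNReal.tendsto_atTop_zero_of_tsum_ne_top hω.ne

end
end FBMProof

open MeasureTheory ProbabilityTheory Real
namespace FBMProof
open scoped ENNReal Topology
open Filter

theorem lip_closed_lim {M : ℝ} {z : ℕ → ℝ → ℝ} {y : ℝ → ℝ} (hz : ∀ n, z n ∈ LipM M)
    (h : ∀ t, Tendsto (fun n => z n t) atTop (𝓝 (y t))) : y ∈ LipM M := by
  refine ⟨?_, fun s t => ?_⟩
  · have : Tendsto (fun n => z n 0) atTop (𝓝 0) := by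
      simp only [(hz _).1]; exact tendsto_const_nhds
    exact tendsto_nhds_unique (h 0) this
  · exact le_of_tendsto ((h s).sub (h t)).abs (Eventually.of_forall fun n => (hz n).2 s t)

theorem lip_cauchy_of_rat {M : ℝ} (hM : 0 < M) {z : ℕ → ℝ → ℝ} (hz : ∀ n, z n ∈ LipM M)
    (h : ∀ q : ℚ, ∃ l, Tendsto (fun n => z n (q : ℝ)) atTop (𝓝 l)) (t : ℝ) :
    ∃ l, Tendsto (fun n => z n t) atTop (𝓝 l) := by
  refine cauchySeq_tendsto_of_complete ?_
  rw [Metric.cauchySeq_iff]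
  intro ε hε
  obtain ⟨q, hq1, hq2⟩ := exists_rat_btwn (show t < t + ε / (4 * M) by
    have : 0 < ε / (4 * M) := by positivity
    linarith)
  obtain ⟨l, hl⟩ := h q
  have hc := hl.cauchySeq
  rw [Metric.cauchySeq_iff] at hc
  obtain ⟨N, hN⟩ := hc (ε / 2) (by positivity)
  refine ⟨N, fun m hm n hn => ?_⟩
  have h1 := hN m hm n hn
  rw [Real.dist_eq] at h1 ⊢
  have h2 := (hz m).2 t q
  have h3 := (hz n).2 t q
  have h4 : |t - q| < ε / (4 * M) := by rw [abs_lt]; constructor <;> linarith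
  have h5 : M * |t - q| < ε / 4 := by
    calc M * |t - q| < M * (ε / (4 * M)) := by gcongr
      _ = ε / 4 := by field_simp
  rw [abs_le] at h2 h3
  rw [abs_lt] at h1 ⊢
  constructor <;> linarith

theorem lip_tendsto_of_rat {M : ℝ} (hM : 0 < M) {z : ℕ → ℝ → ℝ} {y : ℝ → ℝ} (hz : ∀ n, z n ∈ LipM M)
    (hy : y ∈ LipM M)
    (h : ∀ q : ℚ, Tendsto (fun n => z n (q : ℝ)) atTop (𝓝 (y q))) (t : ℝ) :
    Tendsto (fun n => z n t) atTop (𝓝 (y t)) := by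
  choose y' hy' using lip_cauchy_of_rat hM hz (fun q => ⟨_, h q⟩)
  have h2 := lip_closed_lim hz hy'
  have hyc : ∀ f ∈ LipM M, Continuous f := fun f hf => by
    refine LipschitzWith.continuous (K := M.toNNReal) (LipschitzWith.of_dist_le_mul fun s t => ?_)
    rw [Real.dist_eq, Real.dist_eq, Real.coe_toNNReal _ hM.le]; exact hf.2 s t
  have : y' = y := by
    refine Continuous.ext_on Rat.denseRange_cast (hyc _ h2) (hyc _ hy) ?_
    rintro _ ⟨q, rfl⟩
    exact tendsto_nhds_unique (hy' q) (h q)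
  rw [← this]; exact hy' t

theorem lip_cont {M : ℝ} (hM : 0 < M) {f : ℝ → ℝ} (hf : f ∈ LipM M) : Continuous f := by
  refine LipschitzWith.continuous (K := M.toNNReal) (LipschitzWith.of_dist_le_mul fun s t => ?_)
  rw [Real.dist_eq, Real.dist_eq, Real.coe_toNNReal _ hM.le]; exact hf.2 s t

theorem lip_bound {M : ℝ} {f : ℝ → ℝ} (hf : f ∈ LipM M) (t : ℝ) : |f t| ≤ M * |t| := by
  have := hf.2 t 0
  rwa [hf.1, sub_zero, sub_zero] at this

theorem lip_compact {M : ℝ} (hM : 0 < M) {z : ℕ → ℝ → ℝ} (hz : ∀ n, z n ∈ LipM M) :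
    ∃ y ∈ LipM M, ∃ φ : ℕ → ℕ, StrictMono φ ∧
      ∀ t, Tendsto (fun n => z (φ n) t) atTop (𝓝 (y t)) := by
  have hK : IsCompact (Set.univ.pi fun q : ℚ => Set.Icc (-(M * |(q:ℝ)|)) (M * |(q:ℝ)|)) :=
    isCompact_univ_pi fun q => isCompact_Icc
  obtain ⟨y0, -, φ, hφ, hl⟩ := hK.tendsto_subseq (x := fun n => fun q : ℚ => z n q) (fun n q _ => by
    exact abs_le.mp (lip_bound (hz n) q))
  rw [tendsto_pi_nhds] at hl
  choose y hy using lip_cauchy_of_rat hM (fun n => hz (φ n)) (fun q => ⟨_, hl q⟩)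
  exact ⟨y, lip_closed_lim (fun n => hz (φ n)) hy, φ, hφ, hy⟩

theorem lip_dense {M : ℝ} (hM : 0 < M) (S : Set (ℝ → ℝ)) (hS : S ⊆ LipM M) (hne : S.Nonempty) :
    ∃ D : ℕ → ℝ → ℝ, (∀ n, D n ∈ S) ∧ ∀ z ∈ S, ∃ φ : ℕ → ℕ,
      ∀ t, Tendsto (fun n => D (φ n) t) atTop (𝓝 (z t)) := by
  let r : (ℝ → ℝ) → (ℚ → ℝ) := fun f q => f q
  let S' := r '' S
  have : Nonempty S' := (hne.image r).to_subtype
  let d := TopologicalSpace.denseSeq S'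
  have hd : DenseRange d := TopologicalSpace.denseRange_denseSeq S'
  have h1 : ∀ n, ∃ f ∈ S, r f = (d n : ℚ → ℝ) := fun n => (d n).2
  choose D hDS hD using h1
  refine ⟨D, hDS, fun z hz => ?_⟩
  have h2 : (⟨r z, z, hz, rfl⟩ : S') ∈ closure (Set.range d) := hd _
  rw [mem_closure_iff_seq_limit] at h2
  obtain ⟨x, hx, hxl⟩ := h2
  choose φ hφ using hx
  refine ⟨φ, fun t => lip_tendsto_of_rat hM (fun n => hS (hDS _)) (hS hz) (fun q => ?_) t⟩
  have h3 := (continuous_apply q).tendsto _ |>.comp ((continuous_subtype_val.tendsto _).comp hxl)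
  refine h3.congr fun n => ?_
  simp only [Function.comp]
  rw [← hφ n, ← hD]

/-- Continuity of the drift functional along pointwise convergent Lipschitz perturbations. -/
def Good (b w : ℝ → ℝ) (M T : ℝ) : Prop :=
  ∀ (z : ℕ → ℝ → ℝ) (y : ℝ → ℝ), (∀ n, z n ∈ LipM M) → y ∈ LipM M →
   (∀ t, Tendsto (fun n => z n t) atTop (𝓝 (y t))) →
   ∀ t ∈ Set.Icc 0 T, Tendsto (fun n => ∫ u in (0:ℝ)..t, b (w u + z n u)) atTop
    (𝓝 (∫ u in (0:ℝ)..t, b (w u + y u)))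

/-- Solutions on the interval from 0 to t. -/
def Sol (b w : ℝ → ℝ) (M t : ℝ) : Set (ℝ → ℝ) :=
  {z | z ∈ LipM M ∧ ∀ s ∈ Set.Icc 0 t, z s = ∫ u in (0:ℝ)..s, b (w u + z u)}

theorem sol_limit {b w : ℝ → ℝ} {M T t : ℝ} (hG : Good b w M T) (htT : t ≤ T)
    {z : ℕ → ℝ → ℝ} {y : ℝ → ℝ} (hz : ∀ n, z n ∈ LipM M)
    (h : ∀ t, Tendsto (fun n => z n t) atTop (𝓝 (y t)))
    (he : ∀ s ∈ Set.Icc 0 t, Tendsto (fun n => z n s - ∫ u in (0:ℝ)..s, b (w u + z n u)) atTop (𝓝 0)) :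
    y ∈ Sol b w M t := by
  have hy := lip_closed_lim hz h
  refine ⟨hy, fun s hs => ?_⟩
  have h1 := hG z y hz hy h s ⟨hs.1, hs.2.trans htT⟩
  have h2 := (h s).sub h1
  have := tendsto_nhds_unique h2 (he s hs)
  linarith

theorem bint {b w z : ℝ → ℝ} {M : ℝ} (hb : Measurable b) (hbM : ∀ x, |b x| ≤ M)
    (hw : Continuous w) (hz : Continuous z) (r s : ℝ) :
    IntervalIntegrable (fun u => b (w u + z u)) volume r s := by
  refine (intervalIntegrable_const (c := M)).mono_fun ?_ ?_
  · exact (hb.comp (hw.add hz).measurable).aestronglyMeasurable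
  · refine Eventually.of_forall fun u => ?_
    exact (hbM _).trans (le_abs_self _)

theorem bint_le {b w z : ℝ → ℝ} {M : ℝ} (hbM : ∀ x, |b x| ≤ M) (r s : ℝ) :
    |∫ u in r..s, b (w u + z u)| ≤ M * |s - r| := by
  have := intervalIntegral.norm_integral_le_of_norm_le_const (a := r) (b := s) (C := M)
    (f := fun u => b (w u + z u)) (fun u _ => hbM _)
  simpa using this

end FBMProof

open MeasureTheory ProbabilityTheory Real
namespace FBMProof
open scoped ENNReal Topology
open Filter

section
variable {b w : ℝ → ℝ} {M T : ℝ}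

theorem ext_delay (hM : 0 < M) (hb : Measurable b) (hbM : ∀ x, |b x| ≤ M)
    (hw : Continuous w) {t : ℝ} (ht : 0 ≤ t) {z0 : ℝ → ℝ} (hz0 : z0 ∈ Sol b w M t)
    {δ : ℝ} (hδ : 0 < δ) : ∃ z ∈ LipM M, (∀ s ≤ t, z s = z0 s) ∧
      ∀ s ∈ Set.Icc 0 T, |z s - ∫ u in (0:ℝ)..s, b (w u + z u)| ≤ M * δ := by
  let F : (ℝ → ℝ) → (ℝ → ℝ) := fun z s =>
    z0 (min s t) + ∫ u in t..max t (s - δ), b (w u + z u)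
  have hF : ∀ z ∈ LipM M, F z ∈ LipM M := by
    intro z hz
    refine ⟨?_, ?_⟩
    · have : max t (0 - δ) = t := max_eq_left (by linarith)
      simp only [F]
      rw [this, min_eq_left ht, hz0.1.1]; simp
    · have key : ∀ s s' : ℝ, s ≤ s' → |F z s - F z s'| ≤ M * |s - s'| := by
        intro s s' hss
        have h1 := hz0.1.2 (min s t) (min s' t)
        have h2 : (∫ u in t..max t (s' - δ), b (w u + z u)) - ∫ u in t..max t (s - δ), b (w u + z u)
            = ∫ u in max t (s - δ)..max t (s' - δ), b (w u + z u) :=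
          intervalIntegral.integral_interval_sub_left
            (bint hb hbM hw (lip_cont hM hz) _ _) (bint hb hbM hw (lip_cont hM hz) _ _)
        have h3 := bint_le (w := w) (z := z) hbM (max t (s - δ)) (max t (s' - δ))
        rw [← h2] at h3
        have h4 : min s t ≤ min s' t := min_le_min_right _ hss
        have h5 : max t (s - δ) ≤ max t (s' - δ) := max_le_max_left _ (by linarith)
        rw [abs_of_nonpos (by linarith : min s t - min s' t ≤ 0)] at h1
        rw [abs_of_nonneg (by linarith : (0:ℝ) ≤ max t (s' - δ) - max t (s - δ))] at h3
        rw [abs_of_nonpos (by linarith : s - s' ≤ 0)]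
        have h6 : (min s' t - min s t) + (max t (s' - δ) - max t (s - δ)) ≤ s' - s := by
          rcases min_cases s t with h | h <;> rcases min_cases s' t with h' | h' <;>
          rcases max_cases t (s - δ) with k | k <;> rcases max_cases t (s' - δ) with k' | k' <;>
          linarith
        have h7 := mul_le_mul_of_nonneg_left h6 hM.le
        have h8 : F z s - F z s' = (z0 (min s t) - z0 (min s' t)) -
          ((∫ u in t..max t (s' - δ), b (w u + z u)) - ∫ u in t..max t (s - δ), b (w u + z u)) := by
          simp only [F]; ring
        rw [h8]
        refine (abs_sub _ _).trans ?_
        linarith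
      intro s s'
      rcases le_total s s' with h | h
      · exact key s s' h
      · rw [abs_sub_comm, abs_sub_comm s]; exact key s' s h
  let Z : ℕ → ℝ → ℝ := fun k => Nat.rec (fun s => z0 (min s t)) (fun _ z => F z) k
  have hZs : ∀ k, Z (k + 1) = F (Z k) := fun k => rfl
  have hZL : ∀ k, Z k ∈ LipM M := by
    intro k
    induction k with
    | zero =>
      refine ⟨?_, fun s s' => ?_⟩
      · show z0 (min 0 t) = 0
        rw [min_eq_left ht, hz0.1.1]
      · refine (hz0.1.2 _ _).trans ?_
        refine mul_le_mul_of_nonneg_left ?_ hM.le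
        have := abs_min_sub_min_le_max s t s' t
        simpa using this
    | succ k ih => exact hF _ ih
  have hZt : ∀ k, ∀ s ≤ t, Z k s = z0 s := by
    intro k s hs
    cases k with
    | zero => show z0 (min s t) = z0 s; rw [min_eq_left hs]
    | succ k =>
      rw [hZs]; simp only [F]
      rw [min_eq_left hs, max_eq_left (by linarith : s - δ ≤ t)]; simp
  have hst : ∀ k : ℕ, ∀ s ≤ t + k * δ, Z (k + 1) s = Z k s := by
    intro k
    induction k with
    | zero =>
      intro s hs
      have hs' : s ≤ t := by simpa using hs
      exact (hZt (0 + 1) s hs').trans (hZt 0 s hs').symm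
    | succ k ih =>
      intro s hs
      rw [hZs (k + 1)]; nth_rw 2 [hZs k]
      simp only [F]
      congr 1
      refine intervalIntegral.integral_congr fun u hu => ?_
      rw [Set.uIcc_of_le (le_max_left _ _)] at hu
      have : u ≤ t + k * δ := by
        refine hu.2.trans (max_le ?_ ?_)
        · have : 0 ≤ (k:ℝ) * δ := by positivity
          linarith
        · push_cast at hs; linarith
      simp only [ih u this]
  obtain ⟨k, hk⟩ := exists_nat_gt ((T - t) / δ)
  have hk' : T ≤ t + k * δ := by
    rw [div_lt_iff₀ hδ] at hk; linarith
  refine ⟨Z k, hZL k, hZt k, fun s hs => ?_⟩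
  have hfix : Z k s = F (Z k) s := by rw [← hZs, hst k s (hs.2.trans hk')]
  rcases le_total s t with h | h
  · rw [hZt k s h, hz0.2 s ⟨hs.1, h⟩]
    have : ∫ u in (0:ℝ)..s, b (w u + Z k u) = ∫ u in (0:ℝ)..s, b (w u + z0 u) := by
      refine intervalIntegral.integral_congr fun u hu => ?_
      rw [Set.uIcc_of_le hs.1] at hu
      simp only [hZt k u (hu.2.trans h)]
    rw [this, sub_self, abs_zero]; positivity
  · have h0 : ∫ u in (0:ℝ)..t, b (w u + Z k u) = z0 t := by
      rw [hz0.2 t ⟨ht, le_rfl⟩]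
      refine intervalIntegral.integral_congr fun u hu => ?_
      rw [Set.uIcc_of_le ht] at hu
      simp only [hZt k u hu.2]
    have hI := fun a c => bint hb hbM hw (lip_cont hM (hZL k)) a c
    have h1 : ∫ u in (0:ℝ)..s, b (w u + Z k u) = z0 t + ((∫ u in t..max t (s - δ), b (w u + Z k u)) +
       ∫ u in max t (s - δ)..s, b (w u + Z k u)) := by
      rw [intervalIntegral.integral_add_adjacent_intervals (hI _ _) (hI _ _), ← h0,
        intervalIntegral.integral_add_adjacent_intervals (hI _ _) (hI _ _)]
    have h2 := bint_le (w := w) (z := Z k) hbM (max t (s - δ)) s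
    have h3 : |s - max t (s - δ)| ≤ δ := by
      rw [abs_le]; rcases max_cases t (s - δ) with k' | k' <;> constructor <;> linarith
    rw [hfix, h1]; simp only [F]
    rw [min_eq_right h]
    have h4 := mul_le_mul_of_nonneg_left h3 hM.le
    have : ∀ a c d : ℝ, a + c - (a + (c + d)) = - d := by intros; ring
    rw [this, abs_neg]; linarith

theorem ext_sol (hM : 0 < M) (hb : Measurable b) (hbM : ∀ x, |b x| ≤ M)
    (hw : Continuous w) (hG : Good b w M T) {t : ℝ} (ht : 0 ≤ t) {z0 : ℝ → ℝ}
    (hz0 : z0 ∈ Sol b w M t) : ∃ z ∈ Sol b w M T, ∀ s ≤ t, z s = z0 s := by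
  have h := fun n : ℕ => ext_delay (T := T) hM hb hbM hw ht hz0 (δ := 1 / ((n:ℝ) + 1)) (by positivity)
  choose z hz hz1 hz2 using h
  obtain ⟨y, hy, φ, hφ, hl⟩ := lip_compact hM hz
  refine ⟨y, sol_limit hG le_rfl (fun n => hz (φ n)) hl fun s hs => ?_, fun s hs => ?_⟩
  · have h0 : Tendsto (fun n : ℕ => M * (1 / ((n:ℝ) + 1))) atTop (𝓝 0) := by
      simpa using tendsto_one_div_add_atTop_nhds_zero_nat.const_mul M
    refine squeeze_zero_norm (fun n => ?_) (h0.comp hφ.tendsto_atTop)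
    exact hz2 (φ n) s hs
  · refine tendsto_nhds_unique (hl s) ?_
    simp only [hz1 _ s hs]; exact tendsto_const_nhds

theorem sol_deriv (hM : 0 < M) (hb : Measurable b) (hbM : ∀ x, |b x| ≤ M)
    (hw : Continuous w) {z : ℝ → ℝ} (hz : z ∈ Sol b w M T) (hT : 0 ≤ T) :
    ∀ᵐ u, u ∈ Set.Ioo 0 T → HasDerivAt z (b (w u + z u)) u := by
  have h := (bint hb hbM hw (lip_cont hM hz.1) 0 T).ae_hasDerivAt_integral
  filter_upwards [h] with u hu huI
  have h1 := hu (by rw [Set.uIcc_of_le hT]; exact ⟨huI.1.le, huI.2.le⟩) 0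
    (by rw [Set.uIcc_of_le hT]; exact ⟨le_rfl, hT⟩)
  refine h1.congr_of_eventuallyEq ?_
  filter_upwards [Ioo_mem_nhds huI.1 huI.2] with s hs
  exact hz.2 s ⟨hs.1.le, hs.2.le⟩

theorem sol_max (hM : 0 < M) (hb : Measurable b) (hbM : ∀ x, |b x| ≤ M)
    (hw : Continuous w) (hT : 0 ≤ T) {z1 z2 : ℝ → ℝ} (hz1 : z1 ∈ Sol b w M T) (hz2 : z2 ∈ Sol b w M T) :
    (fun s => max (z1 s) (z2 s)) ∈ Sol b w M T := by
  set y : ℝ → ℝ := fun s => max (z1 s) (z2 s) with hy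
  have hyL : y ∈ LipM M := by
    refine ⟨by simp [hy, hz1.1.1, hz2.1.1], fun s t => ?_⟩
    refine (abs_max_sub_max_le_max _ _ _ _).trans (max_le (hz1.1.2 s t) (hz2.1.2 s t))
  have hLW : LipschitzWith M.toNNReal y := LipschitzWith.of_dist_le_mul fun s t => by
    rw [Real.dist_eq, Real.dist_eq, Real.coe_toNNReal _ hM.le]; exact hyL.2 s t
  refine ⟨hyL, fun s hs => ?_⟩
  have h1 := (hLW.lipschitzOnWith (s := Set.uIcc 0 s)).absolutelyContinuousOnInterval.integral_deriv_eq_sub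
  rw [hyL.1, sub_zero] at h1
  rw [← h1]
  refine intervalIntegral.integral_congr_ae ?_
  filter_upwards [hLW.ae_differentiableAt_real, sol_deriv hM hb hbM hw hz1 hT,
    sol_deriv hM hb hbM hw hz2 hT, (measure_eq_zero_iff_ae_notMem.1 (measure_singleton (μ := volume) T))] with u hd hd1 hd2 hne hu
  rw [Set.uIoc_of_le hs.1] at hu
  have huI : u ∈ Set.Ioo 0 T := ⟨hu.1, lt_of_le_of_ne (hu.2.trans hs.2) hne⟩
  have e1 := hd1 huI
  have e2 := hd2 huI
  rcases le_total (z2 u) (z1 u) with h | h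
  · have hyu : y u = z1 u := max_eq_left h
    have hm : IsLocalMin (fun s => y s - z1 s) u := Eventually.of_forall fun v => by
      simp only [hyu, sub_self]; exact sub_nonneg.2 (le_max_left _ _)
    have := hm.hasDerivAt_eq_zero (hd.hasDerivAt.sub e1)
    rw [hyu]; linarith
  · have hyu : y u = z2 u := max_eq_right h
    have hm : IsLocalMin (fun s => y s - z2 s) u := Eventually.of_forall fun v => by
      simp only [hyu, sub_self]; exact sub_nonneg.2 (le_max_right _ _)
    have := hm.hasDerivAt_eq_zero (hd.hasDerivAt.sub e2)
    rw [hyu]; linarith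

theorem zero_sol (hM : 0 < M) : (fun _ => (0:ℝ)) ∈ Sol b w M 0 := by
  refine ⟨⟨rfl, fun s t => by simp; positivity⟩, fun s hs => ?_⟩
  have : s = 0 := le_antisymm hs.2 hs.1
  subst this; simp

theorem exists_max (hM : 0 < M) (hb : Measurable b) (hbM : ∀ x, |b x| ≤ M)
    (hw : Continuous w) (hT : 0 ≤ T) (hG : Good b w M T) :
    ∃ y ∈ Sol b w M T, ∀ t ∈ Set.Icc 0 T, ∀ z ∈ Sol b w M t, z t ≤ y t := by
  obtain ⟨z0, hz0, -⟩ := ext_sol hM hb hbM hw hG le_rfl (zero_sol (b := b) (w := w) hM)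
  obtain ⟨D, hD, hDd⟩ := lip_dense hM (Sol b w M T) (fun z hz => hz.1) ⟨z0, hz0⟩
  let E : ℕ → ℝ → ℝ := fun k => Nat.rec (D 0) (fun k z s => max (z s) (D (k + 1) s)) k
  have hE : ∀ k, E k ∈ Sol b w M T := by
    intro k
    induction k with
    | zero => exact hD 0
    | succ k ih => exact sol_max hM hb hbM hw hT ih (hD (k + 1))
  have hEmono : ∀ s, Monotone fun k => E k s := fun s => monotone_nat_of_le_succ fun k => le_max_left _ _
  have hDE : ∀ k s, D k s ≤ E k s := by
    intro k s
    cases k with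
    | zero => exact le_rfl
    | succ k => exact le_max_right _ _
  obtain ⟨y, hy, φ, hφ, hl⟩ := lip_compact hM (fun n => (hE n).1)
  have hyS : y ∈ Sol b w M T := by
    refine sol_limit hG le_rfl (fun n => (hE (φ n)).1) hl fun s hs => ?_
    have : ∀ n, E (φ n) s - ∫ u in (0:ℝ)..s, b (w u + E (φ n) u) = 0 := fun n => by
      rw [← (hE (φ n)).2 s hs, sub_self]
    simp only [this]; exact tendsto_const_nhds
  have hDy : ∀ k s, D k s ≤ y s := by
    intro k s
    refine ge_of_tendsto (hl s) ?_
    filter_upwards [eventually_ge_atTop k] with n hn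
    exact (hDE k s).trans (hEmono s (hn.trans (hφ.id_le n)))
  refine ⟨y, hyS, fun t ht z hz => ?_⟩
  obtain ⟨z', hz', hzz⟩ := ext_sol hM hb hbM hw hG ht.1 hz
  rw [← hzz t le_rfl]
  obtain ⟨ψ, hψ⟩ := hDd z' hz'
  exact le_of_tendsto (hψ t) (Eventually.of_forall fun n => hDy _ t)

end
end FBMProof

open MeasureTheory ProbabilityTheory Real
namespace FBMProof
open scoped ENNReal Topology
open Filter

/-- Approximate solution on a grid. -/
def Cnd (b w : ℝ → ℝ) (t : ℝ) (k : ℕ) (z : ℝ → ℝ) : Prop :=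
  ∀ j ∈ Finset.range (k + 2), |z (t * ((j:ℝ) / ((k:ℝ) + 1))) -
    ∫ u in (0:ℝ)..t * ((j:ℝ) / ((k:ℝ) + 1)), b (w u + z u)| ≤ 1 / ((k:ℝ) + 1)

open Classical in
/-- Formula for the maximal solution. -/
noncomputable def maxF (b w : ℝ → ℝ) (M t : ℝ) (D : ℕ → ℝ → ℝ) : ℝ :=
  ⨅ k : ℕ, ⨆ n : ℕ, if Cnd b w t k (D n) then D n t else -(M * t)

theorem cnd_lim {b w : ℝ → ℝ} {M T : ℝ} (hM : 0 < M) (hb : Measurable b) (hbM : ∀ x, |b x| ≤ M)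
    (hw : Continuous w) {t s : ℝ} (ht : 0 ≤ t) (hs : s ∈ Set.Icc 0 t) (k : ℕ) {z : ℝ → ℝ} (hz : z ∈ LipM M)
    (h : Cnd b w t k z) : |z s - ∫ u in (0:ℝ)..s, b (w u + z u)| ≤ (1 + 2 * M * t) * (1 / ((k:ℝ) + 1)) := by
  have hk : (0:ℝ) < (k:ℝ) + 1 := by positivity
  obtain ⟨j, hj, hj2⟩ : ∃ j ∈ Finset.range (k + 2), |s - t * ((j:ℝ) / ((k:ℝ) + 1))| ≤ t * (1 / ((k:ℝ) + 1)) := by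
    rcases ht.eq_or_lt with h0 | h0
    · refine ⟨0, by simp, ?_⟩
      have : s = 0 := le_antisymm (h0 ▸ hs.2) hs.1
      simp [this, ← h0]
    · have hle : s / t ≤ 1 := (div_le_one h0).2 hs.2
      have hst0 : 0 ≤ s / t := div_nonneg hs.1 h0.le
      refine ⟨⌊s / t * ((k:ℝ) + 1)⌋₊, ?_, ?_⟩
      · rw [Finset.mem_range]
        have : ⌊s / t * ((k:ℝ) + 1)⌋₊ ≤ k + 1 := by
          refine Nat.floor_le_of_le ?_
          push_cast
          exact mul_le_of_le_one_left hk.le hle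
        omega
      · have h1 := Nat.floor_le (a := s / t * ((k:ℝ) + 1)) (by positivity)
        have h2 := Nat.lt_floor_add_one (s / t * ((k:ℝ) + 1))
        set f : ℝ := (⌊s / t * ((k:ℝ) + 1)⌋₊ : ℝ)
        have e : s - t * (f / ((k:ℝ) + 1)) = t * ((s / t * ((k:ℝ) + 1) - f) / ((k:ℝ) + 1)) := by
          field_simp
        rw [e, abs_of_nonneg]
        · gcongr; linarith
        · exact mul_nonneg ht (div_nonneg (by linarith) hk.le)
  have h1 := h j hj
  set r := t * ((j:ℝ) / ((k:ℝ) + 1)) with hr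
  have h2 := hz.2 s r
  have h3 := bint_le (w := w) (z := z) hbM r s
  have hI := fun a c => bint hb hbM hw (lip_cont hM hz) a c
  have h4 : ∫ u in (0:ℝ)..s, b (w u + z u) = (∫ u in (0:ℝ)..r, b (w u + z u)) + ∫ u in r..s, b (w u + z u) :=
    (intervalIntegral.integral_add_adjacent_intervals (hI _ _) (hI _ _)).symm
  rw [h4]
  have h5 := mul_le_mul_of_nonneg_left hj2 hM.le
  have h6 : (1 + 2 * M * t) * (1 / ((k:ℝ) + 1)) = 1 / ((k:ℝ) + 1) + 2 * (M * (t * (1 / ((k:ℝ) + 1)))) := by ring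
  rw [h6]
  rw [abs_le] at h1 h2 h3 ⊢
  constructor <;> linarith

theorem max_formula {b w : ℝ → ℝ} {M T : ℝ} (hM : 0 < M) (hb : Measurable b) (hbM : ∀ x, |b x| ≤ M)
    (hw : Continuous w) (hG : Good b w M T) {D : ℕ → ℝ → ℝ} (hD : ∀ n, D n ∈ LipM M)
    (hDd : ∀ z ∈ LipM M, ∃ φ : ℕ → ℕ, ∀ t, Tendsto (fun n => D (φ n) t) atTop (𝓝 (z t)))
    {y : ℝ → ℝ} (hy : y ∈ Sol b w M T) (hmax : ∀ t ∈ Set.Icc 0 T, ∀ z ∈ Sol b w M t, z t ≤ y t)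
    {t : ℝ} (ht : t ∈ Set.Icc 0 T) : y t = maxF b w M t D := by
  classical
  have hab : ∀ z ∈ LipM M, |z t| ≤ M * t := fun z hz => by
    have := lip_bound hz t; rwa [abs_of_nonneg ht.1] at this
  have hMt : 0 ≤ M * t := mul_nonneg hM.le ht.1
  have hbd : ∀ k n, (if Cnd b w t k (D n) then D n t else -(M * t)) ∈ Set.Icc (-(M * t)) (M * t) := by
    intro k n
    split_ifs
    · exact abs_le.1 (hab _ (hD n))
    · exact ⟨le_rfl, by linarith⟩
  have hBA : ∀ k, BddAbove (Set.range fun n => if Cnd b w t k (D n) then D n t else -(M * t)) := by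
    intro k; refine ⟨M * t, ?_⟩; rintro _ ⟨n, rfl⟩; exact (hbd k n).2
  have hBB : BddBelow (Set.range fun k : ℕ => ⨆ n, if Cnd b w t k (D n) then D n t else -(M * t)) := by
    refine ⟨-(M * t), ?_⟩; rintro _ ⟨k, rfl⟩
    exact (hbd k 0).1.trans (le_ciSup (hBA k) 0)
  unfold maxF
  apply le_antisymm
  · refine le_ciInf fun k => ?_
    obtain ⟨φ, hφ⟩ := hDd y hy.1
    refine le_of_tendsto (hφ t) ?_
    have hev : ∀ᶠ n in atTop, Cnd b w t k (D (φ n)) := by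
      unfold Cnd
      rw [eventually_all_finset]
      intro j hj
      have hk : (0:ℝ) < (k:ℝ) + 1 := by positivity
      have hr : t * ((j:ℝ) / ((k:ℝ) + 1)) ∈ Set.Icc 0 T := by
        refine ⟨mul_nonneg ht.1 (by positivity), ?_⟩
        refine (mul_le_of_le_one_right ht.1 ?_).trans ht.2
        rw [div_le_one hk]
        have : j ≤ k + 1 := by have := Finset.mem_range.1 hj; omega
        exact_mod_cast this
      have h1 := (hφ (t * ((j:ℝ) / ((k:ℝ) + 1)))).sub (hG _ y (fun n => hD (φ n)) hy.1 hφ _ hr)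
      rw [← hy.2 _ hr, sub_self] at h1
      have h2 := h1.abs
      rw [abs_zero] at h2
      filter_upwards [h2.eventually_lt_const (show (0:ℝ) < 1 / ((k:ℝ) + 1) by positivity)] with n hn
      exact hn.le
    filter_upwards [hev] with n hn
    have := le_ciSup (hBA k) (φ n)
    simpa [hn] using this
  · by_contra hlt
    push Not at hlt
    obtain ⟨c, hc1, hc2⟩ := exists_between hlt
    have hex : ∀ k : ℕ, ∃ n, Cnd b w t k (D n) ∧ c < D n t := by
      intro k
      have h1 := hc2.trans_le (ciInf_le hBB k)
      obtain ⟨n, hn⟩ := exists_lt_of_lt_ciSup h1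
      refine ⟨n, ?_⟩
      by_cases hC : Cnd b w t k (D n)
      · rw [if_pos hC] at hn; exact ⟨hC, hn⟩
      · rw [if_neg hC] at hn
        have := (abs_le.1 (hab y hy.1)).1
        linarith
    choose ν hν1 hν2 using hex
    obtain ⟨z, hz, φ, hφ, hl⟩ := lip_compact hM (fun k => hD (ν k))
    have hzS : z ∈ Sol b w M t := by
      refine sol_limit hG ht.2 (fun k => hD (ν (φ k))) hl fun s hs => ?_
      have h0 : Tendsto (fun n : ℕ => (1 + 2 * M * t) * (1 / ((n:ℝ) + 1))) atTop (𝓝 0) := by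
        simpa using tendsto_one_div_add_atTop_nhds_zero_nat.const_mul (1 + 2 * M * t)
      refine squeeze_zero_norm (fun n => ?_) (h0.comp hφ.tendsto_atTop)
      exact cnd_lim (T := T) hM hb hbM hw ht.1 hs (φ n) (hD _) (hν1 (φ n))
    have h1 := hmax t ht z hzS
    have h2 : c ≤ z t := ge_of_tendsto (hl t) (Eventually.of_forall fun n => (hν2 (φ n)).le)
    linarith

theorem meas_bint {Ω : Type*} {m : MeasurableSpace Ω} {b : ℝ → ℝ} (hb : Measurable b)
    {w : ℝ → Ω → ℝ} (hwc : ∀ ω, Continuous fun u => w u ω) {t : ℝ}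
    (hwm : ∀ s ∈ Set.Icc 0 t, Measurable (w s)) {z : ℝ → ℝ} (hz : Continuous z) {r : ℝ}
    (hr : r ∈ Set.Icc 0 t) : Measurable fun ω => ∫ u in (0:ℝ)..r, b (w u ω + z u) := by
  have h1 : ∀ ω, ∫ u in (0:ℝ)..r, b (w u ω + z u) = ∫ u in Set.Ioc 0 r, b (w (max 0 (min u r)) ω + z u) := by
    intro ω
    rw [intervalIntegral.integral_of_le hr.1]
    refine setIntegral_congr_fun measurableSet_Ioc fun u hu => ?_
    simp only [min_eq_left hu.2, max_eq_right hu.1.le]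
  simp only [h1]
  have hj : Measurable fun q : Ω × ℝ => w (max 0 (min q.2 r)) q.1 := by
    have := measurable_uncurry_of_continuous_of_measurable (ι := ℝ) (u := fun u ω => w (max 0 (min u r)) ω)
      (fun ω => (hwc ω).comp (by fun_prop)) (fun u => hwm _ ⟨le_max_left _ _, max_le (hr.1.trans hr.2) ((min_le_right _ _).trans hr.2)⟩)
    exact this.comp measurable_swap
  have h2 : Measurable fun q : Ω × ℝ => b (w (max 0 (min q.2 r)) q.1 + z q.2) :=
    hb.comp (hj.add (hz.measurable.comp measurable_snd))
  exact (h2.stronglyMeasurable.integral_prod_right (ν := volume.restrict (Set.Ioc 0 r))).measurable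

theorem max_meas {Ω : Type*} {m : MeasurableSpace Ω} {b : ℝ → ℝ} (hb : Measurable b)
    {w : ℝ → Ω → ℝ} (hwc : ∀ ω, Continuous fun u => w u ω) {t : ℝ} (ht : 0 ≤ t)
    (hwm : ∀ s ∈ Set.Icc 0 t, Measurable (w s)) {M : ℝ} (hM : 0 < M) {D : ℕ → ℝ → ℝ} (hD : ∀ n, D n ∈ LipM M) :
    Measurable fun ω => maxF b (fun u => w u ω) M t D := by
  classical
  unfold maxF
  refine Measurable.iInf fun k => Measurable.iSup fun n => ?_
  refine Measurable.ite ?_ measurable_const measurable_const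
  unfold Cnd
  simp only [Set.setOf_forall]
  refine Finset.measurableSet_biInter _ fun j hj => ?_
  refine measurableSet_le ?_ measurable_const
  have hk : (0:ℝ) < (k:ℝ) + 1 := by positivity
  have hr : t * ((j:ℝ) / ((k:ℝ) + 1)) ∈ Set.Icc 0 t := by
    refine ⟨mul_nonneg ht (by positivity), mul_le_of_le_one_right ht ?_⟩
    rw [div_le_one hk]
    have : j ≤ k + 1 := by have := Finset.mem_range.1 hj; omega
    exact_mod_cast this
  exact (measurable_const.sub (meas_bint hb hwc hwm (lip_cont hM (hD n)) hr)).abs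

end FBMProof

open MeasureTheory ProbabilityTheory Real
namespace FBMProof
open scoped ENNReal Topology
open Filter

theorem bint_diff_le {b g w z : ℝ → ℝ} {M T : ℝ} (hb : Measurable b) (hbM : ∀ x, |b x| ≤ M)
    (hg : Measurable g) (hgM : ∀ x, |g x| ≤ M)
    (hw : Continuous w) (hz : Continuous z) {R : ℝ≥0∞} {t : ℝ} (ht : t ∈ Set.Icc 0 T) {ε : ℝ} (hε : 0 ≤ ε)
    (hR : R ≤ ENNReal.ofReal ε)
    (h : ∫⁻ u in Set.Ioc 0 T, ENNReal.ofReal |b (w u + z u) - g (w u + z u)| ≤ R) :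
    |(∫ u in (0:ℝ)..t, b (w u + z u)) - ∫ u in (0:ℝ)..t, g (w u + z u)| ≤ ε := by
  have hi := (bint hb hbM hw hz 0 t).sub (bint hg hgM hw hz 0 t)
  rw [← intervalIntegral.integral_sub (bint hb hbM hw hz _ _) (bint hg hgM hw hz _ _)]
  refine (intervalIntegral.abs_integral_le_integral_abs ht.1).trans ?_
  rw [intervalIntegral.integral_of_le ht.1, integral_eq_lintegral_of_nonneg_ae]
  · refine ENNReal.toReal_le_of_le_ofReal hε ?_
    refine le_trans ?_ (h.trans hR)
    exact lintegral_mono_set (Set.Ioc_subset_Ioc_right ht.2)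
  · exact Eventually.of_forall fun u => abs_nonneg _
  · exact (((hb.comp (hw.add hz).measurable).sub (hg.comp (hw.add hz).measurable)).abs).aestronglyMeasurable

section
variable {Ω : Type*} [mΩ : MeasurableSpace Ω] {P : Measure Ω} [IsProbabilityMeasure P]
  {H : ℝ} {W : ℝ → Ω → ℝ}

theorem good_ae (hW : IsFractionalBM P H W) (hH : 0 < H) (hH2 : H ≤ 1 / 2) (hW0 : ∀ ω, W 0 ω = 0)
    (hWc : ∀ ω, Continuous fun t => W t ω) {M T : ℝ} (hM : 0 < M) (hT : 0 < T) (x₀ : ℝ)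
    {b : ℝ → ℝ} (hb : Measurable b) (hbi : Integrable b) (hbM : ∀ x, |b x| ≤ M) :
    ∀ᵐ ω ∂P, Good b (fun u => x₀ + W u ω) M T := by
  obtain ⟨g, R, hg, hgM, -, -, hR0, hR⟩ := drift_approx hW hH hH2 hW0 hWc hM hT x₀ hb hbi hbM
  filter_upwards [hR0] with ω hω
  intro z y hz hy hzy t ht
  rw [Metric.tendsto_atTop]
  intro ε hε
  obtain ⟨k, hk⟩ := ((tendsto_order.1 hω).2 (ENNReal.ofReal (ε / 4)) (by simpa using hε)).exists
  have hwc : Continuous fun u => x₀ + W u ω := continuous_const.add (hWc ω)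
  have h1 : ∀ v ∈ LipM M, |(∫ u in (0:ℝ)..t, b (x₀ + W u ω + v u)) - ∫ u in (0:ℝ)..t, g k (x₀ + W u ω + v u)| ≤ ε / 4 :=
    fun v hv => bint_diff_le hb hbM (hg k).measurable (hgM k) hwc (lip_cont hM hv) ht (by positivity) hk.le
      (hR k ω v hv)
  have h2 : Tendsto (fun n => ∫ u in (0:ℝ)..t, g k (x₀ + W u ω + z n u)) atTop
      (𝓝 (∫ u in (0:ℝ)..t, g k (x₀ + W u ω + y u))) := by
    refine intervalIntegral.tendsto_integral_filter_of_dominated_convergence (fun _ => M) ?_ ?_ ?_ ?_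
    · exact Eventually.of_forall fun n => ((hg k).comp (hwc.add (lip_cont hM (hz n)))).aestronglyMeasurable
    · exact Eventually.of_forall fun n => Eventually.of_forall fun u _ => hgM k _
    · exact intervalIntegrable_const
    · exact Eventually.of_forall fun u _ => ((hg k).tendsto _).comp (tendsto_const_nhds.add (hzy u))
  rw [Metric.tendsto_atTop] at h2
  obtain ⟨N, hN⟩ := h2 (ε / 4) (by positivity)
  refine ⟨N, fun n hn => ?_⟩
  have h3 := hN n hn
  have h4 := h1 _ (hz n)
  have h5 := h1 _ hy
  rw [Real.dist_eq] at h3 ⊢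
  rw [abs_le] at h4 h5
  rw [abs_lt] at h3 ⊢
  constructor <;> linarith

theorem lip_stop {M : ℝ} (hM : 0 < M) {z : ℝ → ℝ} (hz : z ∈ LipM M) {T : ℝ} (hT : 0 ≤ T) :
    (fun s => z (max 0 (min s T))) ∈ LipM M := by
  refine ⟨by simp [min_eq_left hT, hz.1], fun s t => (hz.2 _ _).trans ?_⟩
  refine mul_le_mul_of_nonneg_left ?_ hM.le
  have h1 := abs_max_sub_max_le_max 0 (min s T) 0 (min t T)
  have h2 := abs_min_sub_min_le_max s T t T
  simp only [sub_self, abs_zero, abs_nonneg, max_eq_left, max_eq_right] at h1 h2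
  exact h1.trans h2

theorem sol_congr {b w z z' : ℝ → ℝ} {M t : ℝ} (hz : z ∈ Sol b w M t) (hz' : z' ∈ LipM M)
    (h : ∀ s ∈ Set.Icc 0 t, z' s = z s) : z' ∈ Sol b w M t := by
  refine ⟨hz', fun s hs => ?_⟩
  rw [h s hs, hz.2 s hs]
  refine intervalIntegral.integral_congr fun u hu => ?_
  rw [Set.uIcc_of_le hs.1] at hu
  simp only [h u ⟨hu.1, hu.2.trans hs.2⟩]

theorem exists_zmax {M T : ℝ} (hM : 0 < M) (hT : 0 ≤ T) {b : ℝ → ℝ} (hb : Measurable b) (hbM : ∀ x, |b x| ≤ M)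
    {w : ℝ → Ω → ℝ} (hwc : ∀ ω, Continuous fun u => w u ω) (hwM : ∀ t, Measurable (w t))
    (m : ℝ → MeasurableSpace Ω) (hm : ∀ t ∈ Set.Icc 0 T, ∀ s ∈ Set.Icc 0 t, Measurable[m t] (w s))
    (hG : ∀ᵐ ω ∂P, Good b (fun u => w u ω) M T) :
    ∃ z : Ω → ℝ → ℝ, (∀ ω, z ω ∈ LipM M) ∧ (∀ t, Measurable fun ω => z ω t) ∧
      (∀ᵐ ω ∂P, z ω ∈ Sol b (fun u => w u ω) M T ∧
        ∀ z' ∈ Sol b (fun u => w u ω) M T, ∀ t ∈ Set.Icc 0 T, z' t ≤ z ω t) ∧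
      ∀ t ∈ Set.Icc 0 T, ∃ g, Measurable[m t] g ∧ (fun ω => z ω t) =ᵐ[P] g := by
  classical
  obtain ⟨A, hA, hAm, hAG⟩ := hG.exists_measurable_mem
  have hex : ∀ ω ∈ A, ∃ y ∈ Sol b (fun u => w u ω) M T, ∀ t ∈ Set.Icc 0 T, ∀ z ∈ Sol b (fun u => w u ω) M t, z t ≤ y t :=
    fun ω hω => exists_max hM hb hbM (hwc ω) hT (hAG ω hω)
  choose! y hy hmax using hex
  have h0 : (fun _ => (0:ℝ)) ∈ LipM M := (zero_sol (b := b) (w := fun _ => 0) hM).1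
  obtain ⟨D, hD, hDd⟩ := lip_dense hM (LipM M) subset_rfl ⟨_, h0⟩
  have hpr : ∀ t, max 0 (min t T) ∈ Set.Icc 0 T := fun t => ⟨le_max_left _ _, max_le hT (min_le_right _ _)⟩
  have hpr' : ∀ t ∈ Set.Icc 0 T, max 0 (min t T) = t := fun t ht => by
    rw [min_eq_left ht.2, max_eq_right ht.1]
  refine ⟨fun ω s => if ω ∈ A then y ω (max 0 (min s T)) else 0, fun ω => ?_, fun t => ?_, ?_, fun t ht => ?_⟩
  · by_cases h : ω ∈ A
    · simp only [h, if_true]; exact lip_stop hM (hy ω h).1 hT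
    · simp only [h, if_false]; exact h0
  · have : (fun ω => if ω ∈ A then y ω (max 0 (min t T)) else 0) =
      fun ω => if ω ∈ A then maxF b (fun u => w u ω) M (max 0 (min t T)) D else 0 := by
      funext ω
      by_cases h : ω ∈ A
      · simp only [h, if_true]
        exact max_formula hM hb hbM (hwc ω) (hAG ω h) hD hDd (hy ω h) (hmax ω h) (hpr t)
      · simp only [h, if_false]
    rw [this]
    exact Measurable.ite hAm (max_meas hb hwc (hpr t).1 (fun s _ => hwM s) hM hD) measurable_const
  · filter_upwards [hA] with ω h
    simp only [h, if_true]
    have hs : (fun s => y ω (max 0 (min s T))) ∈ Sol b (fun u => w u ω) M T :=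
      sol_congr (hy ω h) (lip_stop hM (hy ω h).1 hT) (fun s hs => by simp only [hpr' s hs])
    refine ⟨hs, fun z' hz' t ht => ?_⟩
    rw [hpr' t ht]
    exact hmax ω h t ht z' ⟨hz'.1, fun s hs => hz'.2 s ⟨hs.1, hs.2.trans ht.2⟩⟩
  · refine ⟨_, max_meas (m := m t) hb hwc ht.1 (hm t ht) hM hD, ?_⟩
    filter_upwards [hA] with ω h
    simp only [h, if_true]
    rw [hpr' t ht]
    exact max_formula hM hb hbM (hwc ω) (hAG ω h) hD hDd (hy ω h) (hmax ω h) ht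

theorem lip_neg {M : ℝ} {z : ℝ → ℝ} (hz : z ∈ LipM M) : (fun s => - z s) ∈ LipM M := by
  refine ⟨by simp [hz.1], fun s t => ?_⟩
  have := hz.2 t s
  rw [abs_sub_comm t s] at this
  have e : - z s - - z t = z t - z s := by ring
  rw [e]; exact this

theorem sol_neg {b w z : ℝ → ℝ} {M t : ℝ} (hz : z ∈ Sol b w M t) :
    (fun s => - z s) ∈ Sol (fun x => - b (-x)) (fun u => - w u) M t := by
  refine ⟨lip_neg hz.1, fun s hs => ?_⟩
  rw [intervalIntegral.integral_neg]
  simp only [neg_add, neg_neg]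
  rw [hz.2 s hs]

theorem good_neg {b w : ℝ → ℝ} {M T : ℝ} (h : Good b w M T) :
    Good (fun x => - b (-x)) (fun u => - w u) M T := by
  intro z y hz hy hl t ht
  have := (h (fun n s => - z n s) (fun s => - y s) (fun n => lip_neg (hz n)) (lip_neg hy) (fun t => (hl t).neg) t ht).neg
  simp only [intervalIntegral.integral_neg, neg_add, neg_neg]
  exact this

theorem exists_zmin {M T : ℝ} (hM : 0 < M) (hT : 0 ≤ T) {b : ℝ → ℝ} (hb : Measurable b) (hbM : ∀ x, |b x| ≤ M)
    {w : ℝ → Ω → ℝ} (hwc : ∀ ω, Continuous fun u => w u ω) (hwM : ∀ t, Measurable (w t))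
    (m : ℝ → MeasurableSpace Ω) (hm : ∀ t ∈ Set.Icc 0 T, ∀ s ∈ Set.Icc 0 t, Measurable[m t] (w s))
    (hG : ∀ᵐ ω ∂P, Good b (fun u => w u ω) M T) :
    ∃ z : Ω → ℝ → ℝ, (∀ ω, z ω ∈ LipM M) ∧ (∀ t, Measurable fun ω => z ω t) ∧
      (∀ᵐ ω ∂P, z ω ∈ Sol b (fun u => w u ω) M T ∧
        ∀ z' ∈ Sol b (fun u => w u ω) M T, ∀ t ∈ Set.Icc 0 T, z ω t ≤ z' t) ∧
      ∀ t ∈ Set.Icc 0 T, ∃ g, Measurable[m t] g ∧ (fun ω => z ω t) =ᵐ[P] g := by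
  obtain ⟨z, h1, h2, h3, h4⟩ := exists_zmax (P := P) hM hT (b := fun x => - b (-x)) (hb.comp measurable_neg).neg
    (fun x => by rw [abs_neg]; exact hbM _) (w := fun u ω => - w u ω) (fun ω => (hwc ω).neg) (fun t => (hwM t).neg)
    m (fun t ht s hs => (hm t ht s hs).neg) (hG.mono fun ω h => good_neg h)
  refine ⟨fun ω s => - z ω s, fun ω => lip_neg (h1 ω), fun t => (h2 t).neg, ?_, fun t ht => ?_⟩
  · filter_upwards [h3] with ω h
    refine ⟨?_, fun z' hz' t ht => ?_⟩
    · have := sol_neg h.1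
      simpa using this
    · have := h.2 _ (sol_neg hz') t ht
      linarith
  · obtain ⟨g, hg, he⟩ := h4 t ht
    exact ⟨fun ω => - g ω, hg.neg, he.mono fun ω h => by simp only; rw [← h]⟩
end
end FBMProof

open MeasureTheory ProbabilityTheory Real
namespace FBMProof
open scoped ENNReal Topology
open Filter

/-- integrated step drift -/
noncomputable def stepC (g : ℝ → ℝ) (t : ℝ) (N : ℕ) (X : ℝ → ℝ) (r : ℝ) : ℝ :=
  ∑ i ∈ Finset.range N, g (X (t / N * (i : ℕ))) * (min r (t / N * ((i + 1 : ℕ) : ℝ)) - min r (t / N * (i : ℕ)))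

/-- step drift -/
noncomputable def stepg (g : ℝ → ℝ) (t : ℝ) (N : ℕ) (X : ℝ → ℝ) (u : ℝ) : ℝ :=
  ∑ i ∈ Finset.range N, (Set.Ioc (t / N * (i : ℕ)) (t / N * ((i + 1 : ℕ) : ℝ))).indicator (fun _ => g (X (t / N * (i : ℕ)))) u

theorem ind_int {a c r : ℝ} (ha : 0 ≤ a) (hac : a ≤ c) (hr : 0 ≤ r) (k : ℝ) :
    ∫ u in (0:ℝ)..r, (Set.Ioc a c).indicator (fun _ => k) u = k * (min r c - min r a) := by
  rw [intervalIntegral.integral_of_le hr, setIntegral_indicator measurableSet_Ioc, Set.Ioc_inter_Ioc,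
    setIntegral_const, max_eq_right ha, smul_eq_mul, mul_comm]
  congr 1
  rw [measureReal_def, Real.volume_Ioc]
  rcases le_total a r with h | h
  · rw [min_eq_right h, ENNReal.toReal_ofReal]
    have := le_min h hac; linarith
  · rw [min_eq_left h, min_eq_left (h.trans hac), ENNReal.ofReal_of_nonpos (by linarith)]; simp

theorem grid_mono {t : ℝ} (ht : 0 < t) (N i j : ℕ) (h : i ≤ j) : t / N * (i:ℝ) ≤ t / N * (j:ℝ) := by
  have : (i:ℝ) ≤ j := by exact_mod_cast h
  exact mul_le_mul_of_nonneg_left this (by positivity)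

theorem grid_last {t : ℝ} {N : ℕ} (hN : 0 < N) : t / N * (N:ℝ) = t := by
  have : (N:ℝ) ≠ 0 := by exact_mod_cast hN.ne'
  field_simp

theorem grid_mem {t : ℝ} (ht : 0 < t) {N : ℕ} (hN : 0 < N) {j : ℕ} (hj : j ≤ N) :
    t / N * (j:ℝ) ∈ Set.Icc 0 t := by
  refine ⟨by positivity, ?_⟩
  have := grid_mono ht N j N hj
  rwa [grid_last hN] at this

theorem step_val (g : ℝ → ℝ) {t : ℝ} (ht : 0 < t) {N : ℕ} (hN : 0 < N) (X : ℝ → ℝ) {u : ℝ} (hu : u ∈ Set.Ioc 0 t) :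
    ∃ i < N, u ∈ Set.Ioc (t / N * (i : ℕ)) (t / N * ((i + 1 : ℕ) : ℝ)) ∧ stepg g t N X u = g (X (t / N * (i : ℕ))) := by
  have hex : ∃ i : ℕ, u ≤ t / N * ((i + 1 : ℕ) : ℝ) := by
    refine ⟨N - 1, ?_⟩
    rw [Nat.sub_add_cancel hN, grid_last hN]; exact hu.2
  classical
  let i := Nat.find hex
  have hi : u ≤ t / N * ((i + 1 : ℕ) : ℝ) := Nat.find_spec hex
  have hiN : i ≤ N - 1 := Nat.find_min' hex (by rw [Nat.sub_add_cancel hN, grid_last hN]; exact hu.2)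
  have hlt : t / N * (i : ℕ) < u := by
    rcases Nat.eq_zero_or_pos i with h0 | h0
    · rw [h0]; simpa using hu.1
    · have := Nat.find_min hex (m := i - 1) (by omega)
      rw [Nat.sub_add_cancel h0] at this
      exact not_le.1 this
  refine ⟨i, by omega, ⟨hlt, hi⟩, ?_⟩
  unfold stepg
  rw [Finset.sum_eq_single i]
  · exact Set.indicator_of_mem (show u ∈ Set.Ioc _ _ from ⟨hlt, hi⟩) _
  · intro j _ hji
    refine Set.indicator_of_notMem ?_ _
    rintro ⟨h1, h2⟩
    rcases lt_or_gt_of_ne hji with h | h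
    · have := grid_mono ht N (j + 1) i h; linarith
    · have := grid_mono ht N (i + 1) j h; linarith
  · intro h; exact absurd (Finset.mem_range.2 (by omega)) h

theorem stepg_meas (g : ℝ → ℝ) (t : ℝ) (N : ℕ) (X : ℝ → ℝ) : Measurable (stepg g t N X) := by
  unfold stepg
  exact Finset.measurable_fun_sum _ fun i _ => measurable_const.indicator measurableSet_Ioc

theorem stepg_ii (g : ℝ → ℝ) (t : ℝ) (N : ℕ) (X : ℝ → ℝ) (r s : ℝ) :
    IntervalIntegrable (stepg g t N X) volume r s := by
  unfold stepg
  have : ∀ i ∈ Finset.range N, IntervalIntegrable ((Set.Ioc (t / N * (i : ℕ)) (t / N * ((i + 1 : ℕ) : ℝ))).indicator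
    (fun _ => g (X (t / N * (i : ℕ))))) volume r s := fun i _ => by
    rw [intervalIntegrable_iff]
    exact (integrableOn_const (by simp)).indicator measurableSet_Ioc
  have h := IntervalIntegrable.sum _ this
  refine h.congr (fun u _ => ?_)
  simp

theorem stepC_int (g : ℝ → ℝ) {t : ℝ} (ht : 0 < t) (N : ℕ) (X : ℝ → ℝ) {r : ℝ} (hr : 0 ≤ r) :
    ∫ u in (0:ℝ)..r, stepg g t N X u = stepC g t N X r := by
  unfold stepg stepC
  rw [intervalIntegral.integral_finsetSum]
  · refine Finset.sum_congr rfl fun i _ => ?_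
    exact ind_int (by positivity) (grid_mono ht N i (i + 1) (by omega)) hr _
  · intro i _
    rw [intervalIntegrable_iff]
    exact (integrableOn_const (by simp)).indicator measurableSet_Ioc

theorem stepC_lip {g : ℝ → ℝ} {M : ℝ} (hgM : ∀ x, |g x| ≤ M) {t : ℝ} (ht : 0 < t) (N : ℕ) (X : ℝ → ℝ) (r s : ℝ) :
    |stepC g t N X r - stepC g t N X s| ≤ M * |r - s| := by
  have hM : 0 ≤ M := (abs_nonneg _).trans (hgM 0)
  have key : ∀ r s : ℝ, s ≤ r → |stepC g t N X r - stepC g t N X s| ≤ M * |r - s| := by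
    intro r s hsr
    unfold stepC
    rw [← Finset.sum_sub_distrib]
    refine (Finset.abs_sum_le_sum_abs _ _).trans ?_
    have h1 : ∀ i ∈ Finset.range N, |g (X (t / N * (i : ℕ))) * (min r (t / N * ((i + 1 : ℕ) : ℝ)) - min r (t / N * (i : ℕ))) -
        g (X (t / N * (i : ℕ))) * (min s (t / N * ((i + 1 : ℕ) : ℝ)) - min s (t / N * (i : ℕ)))| ≤
        M * ((min r (t / N * ((i + 1 : ℕ) : ℝ)) - min s (t / N * ((i + 1 : ℕ) : ℝ))) - (min r (t / N * (i : ℕ)) - min s (t / N * (i : ℕ)))) := by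
      intro i _
      rw [← mul_sub, abs_mul]
      have h2 := grid_mono ht N i (i + 1) (by omega)
      set a := t / N * (i:ℝ)
      set c := t / N * ((i + 1 : ℕ) : ℝ)
      have h3 : 0 ≤ (min r c - min s c) - (min r a - min s a) := by
        rcases min_cases r c with h | h <;> rcases min_cases s c with h' | h' <;>
        rcases min_cases r a with k | k <;> rcases min_cases s a with k' | k' <;> linarith
      have h4 : (min r c - min r a) - (min s c - min s a) = (min r c - min s c) - (min r a - min s a) := by ring
      rw [h4, abs_of_nonneg h3]
      exact mul_le_mul_of_nonneg_right (hgM _) h3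
    refine (Finset.sum_le_sum h1).trans ?_
    rw [← Finset.mul_sum, Finset.sum_range_sub (fun i : ℕ => min r (t / N * (i:ℝ)) - min s (t / N * (i:ℝ)))]
    refine mul_le_mul_of_nonneg_left ?_ hM
    rw [abs_of_nonneg (by linarith : (0:ℝ) ≤ r - s)]
    have a1 : min s (t / N * ((0:ℕ):ℝ)) ≤ min r (t / N * ((0:ℕ):ℝ)) := min_le_min_right _ hsr
    have a2 : min r (t / N * (N:ℝ)) - min s (t / N * (N:ℝ)) ≤ r - s := by
      rcases min_cases r (t / N * (N:ℝ)) with h | h <;> rcases min_cases s (t / N * (N:ℝ)) with h' | h' <;> linarith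
    linarith
  rcases le_total s r with h | h
  · exact key r s h
  · rw [abs_sub_comm, abs_sub_comm r]; exact key s r h

theorem stepC_zero (g : ℝ → ℝ) {t : ℝ} (ht : 0 < t) (N : ℕ) (X : ℝ → ℝ) : stepC g t N X 0 = 0 := by
  rw [← stepC_int g ht N X le_rfl]; simp

theorem stepC_grid (g : ℝ → ℝ) {t : ℝ} (ht : 0 < t) (N : ℕ) (X : ℝ → ℝ) {j : ℕ} (hj : j < N) :
    stepC g t N X (t / N * ((j + 1 : ℕ) : ℝ)) = stepC g t N X (t / N * (j:ℕ)) + t / N * g (X (t / N * (j:ℕ))) := by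
  unfold stepC
  rw [← sub_eq_iff_eq_add', ← Finset.sum_sub_distrib, Finset.sum_eq_single j]
  · rw [min_self, min_eq_right (grid_mono ht N j (j + 1) (by omega)), min_eq_left (grid_mono ht N j (j + 1) (by omega)), min_self]
    push_cast; ring
  · intro i _ hij
    rcases lt_or_gt_of_ne hij with h | h
    · rw [min_eq_right (grid_mono ht N (i + 1) (j + 1) (by omega)), min_eq_right (grid_mono ht N i (j + 1) (by omega)),
       min_eq_right (grid_mono ht N (i + 1) j (by omega)), min_eq_right (grid_mono ht N i j (by omega))]
      ring
    · rw [min_eq_left (grid_mono ht N (j + 1) (i + 1) (by omega)), min_eq_left (grid_mono ht N (j + 1) i (by omega)),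
       min_eq_left (grid_mono ht N j (i + 1) (by omega)), min_eq_left (grid_mono ht N j i (by omega))]
      ring
  · intro h; exact absurd (Finset.mem_range.2 hj) h

/-- Euler scheme -/
noncomputable def eulS (g : ℝ → ℝ) (x₀ δ : ℝ) {m : ℕ} (v : Fin m → ℝ) : ℕ → ℝ
  | 0 => 0
  | j + 1 => eulS g x₀ δ v j + δ * g (x₀ + (if h : j < m then v ⟨j, h⟩ else 0) + eulS g x₀ δ v j)

theorem eulS_cont {g : ℝ → ℝ} (hg : Continuous g) (x₀ δ : ℝ) {m : ℕ} (j : ℕ) :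
    Continuous fun v : Fin m → ℝ => eulS g x₀ δ v j := by
  induction j with
  | zero => exact continuous_const
  | succ j ih =>
    simp only [eulS]
    refine ih.add (continuous_const.mul (hg.comp ((continuous_const.add ?_).add ih)))
    by_cases h : j < m
    · simp only [h, dif_pos]; exact continuous_apply _
    · simp only [h, dif_neg, not_false_eq_true]; exact continuous_const

theorem eulS_eq (g : ℝ → ℝ) (x₀ : ℝ) {t : ℝ} (ht : 0 < t) {N : ℕ} (W z : ℝ → ℝ) (j : ℕ) (hj : j ≤ N) :
    eulS g x₀ (t / N) (fun r : Fin (N + 1) => W (t / N * (r:ℕ)) + (z (t / N * (r:ℕ)) -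
      stepC g t N (fun u => x₀ + W u + z u) (t / N * (r:ℕ)))) j = stepC g t N (fun u => x₀ + W u + z u) (t / N * (j:ℕ)) := by
  induction j with
  | zero => simp only [eulS, Nat.cast_zero, mul_zero]; rw [stepC_zero g ht]
  | succ j ih =>
    simp only [eulS]
    rw [ih (by omega), stepC_grid g ht N _ (by omega), dif_pos (by omega : j < N + 1)]
    congr 3
    ring

end FBMProof

open MeasureTheory ProbabilityTheory Real
namespace FBMProof
open scoped ENNReal Topology
open Filter

section
variable {Ω : Type*} [mΩ : MeasurableSpace Ω] {P : Measure Ω} [IsProbabilityMeasure P]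
  {H : ℝ} {W : ℝ → Ω → ℝ}

theorem X_joint (hW : IsFractionalBM P H W)
    (hWc : ∀ ω, Continuous fun t => W t ω) {M : ℝ} (hM : 0 < M) (x₀ : ℝ) {z : Ω → ℝ → ℝ}
    (hzL : ∀ ω, z ω ∈ LipM M) (hzm : ∀ s, Measurable fun ω => z ω s) :
    Measurable fun q : Ω × ℝ => x₀ + W q.2 q.1 + z q.1 q.2 := by
  have h1 := uncurry_meas hW hWc
  have h2 := (measurable_uncurry_of_continuous_of_measurable (ι := ℝ) (u := fun s ω => z ω s)
    (fun ω => lip_cont hM (hzL ω)) hzm).comp measurable_swap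
  exact (measurable_const.add h1).add h2

theorem stepg_joint (hW : IsFractionalBM P H W) (x₀ : ℝ) {z : Ω → ℝ → ℝ}
    (hzm : ∀ s, Measurable fun ω => z ω s) {g : ℝ → ℝ} (hg : Measurable g) (t : ℝ) (N : ℕ) :
    Measurable fun q : Ω × ℝ => stepg g t N (fun u => x₀ + W u q.1 + z q.1 u) q.2 := by
  unfold stepg
  refine Finset.measurable_fun_sum _ fun i _ => ?_
  have : (fun q : Ω × ℝ => (Set.Ioc (t / N * (i : ℕ)) (t / N * ((i + 1 : ℕ) : ℝ))).indicator
      (fun _ => g (x₀ + W (t / N * (i : ℕ)) q.1 + z q.1 (t / N * (i : ℕ)))) q.2) =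
      (Prod.snd ⁻¹' (Set.Ioc (t / N * (i : ℕ)) (t / N * ((i + 1 : ℕ) : ℝ)))).indicator
      (fun q : Ω × ℝ => g (x₀ + W (t / N * (i : ℕ)) q.1 + z q.1 (t / N * (i : ℕ)))) := by
    funext q; simp [Set.indicator]
  rw [this]
  refine Measurable.indicator ?_ (measurable_snd measurableSet_Ioc)
  exact hg.comp ((measurable_const.add ((hW.1 _).comp measurable_fst)).add ((hzm _).comp measurable_fst))

theorem stepg_le {g : ℝ → ℝ} {M : ℝ} (hgM : ∀ x, |g x| ≤ M) (t : ℝ) (N : ℕ) (X : ℝ → ℝ) (u : ℝ) :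
    |stepg g t N X u| ≤ N * M := by
  unfold stepg
  refine (Finset.abs_sum_le_sum_abs _ _).trans ?_
  have : ∀ i ∈ Finset.range N, |(Set.Ioc (t / N * (i : ℕ)) (t / N * ((i + 1 : ℕ) : ℝ))).indicator (fun _ => g (X (t / N * (i : ℕ)))) u| ≤ M := by
    intro i _
    by_cases h : u ∈ Set.Ioc (t / N * (i : ℕ)) (t / N * ((i + 1 : ℕ) : ℝ))
    · rw [Set.indicator_of_mem h]; exact hgM _
    · rw [Set.indicator_of_notMem h, abs_zero]; exact (abs_nonneg _).trans (hgM 0)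
  refine (Finset.sum_le_sum this).trans ?_
  simp

theorem bdd_int_prod {t : ℝ} {f : Ω × ℝ → ℝ} (hf : Measurable f) {C : ℝ} (hC : ∀ q, |f q| ≤ C) :
    Integrable f (P.prod (volume.restrict (Set.Ioc 0 t))) := by
  refine Integrable.of_bound hf.aestronglyMeasurable C (Eventually.of_forall hC)

theorem euler_core (hW : IsFractionalBM P H W) (hH : 0 < H) (hH2 : H ≤ 1 / 2) (hW0 : ∀ ω, W 0 ω = 0)
    (hWc : ∀ ω, Continuous fun t => W t ω) {M t : ℝ} (hM : 0 < M) (ht : 0 < t) (x₀ : ℝ)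
    {b : ℝ → ℝ} (hb : Measurable b) (hbM : ∀ x, |b x| ≤ M)
    {z : Ω → ℝ → ℝ} (hzL : ∀ ω, z ω ∈ LipM M) (hzm : ∀ s, Measurable fun ω => z ω s)
    (hsol : ∀ᵐ ω ∂P, z ω ∈ Sol b (fun u => x₀ + W u ω) M t)
    (had : ∀ s ∈ Set.Icc 0 t, ∃ g, Measurable[past W s] g ∧ (fun ω => z ω s) =ᵐ[P] g)
    {g : ℝ → ℝ} (hg : Continuous g) (hgM : ∀ x, |g x| ≤ M) {N : ℕ} (hN : 0 < N)
    {θ : ℝ → ℝ} (hθ : Continuous θ) (hθ0 : ∀ x, 0 ≤ θ x) (hθ1 : ∀ x, θ x ≤ 1) :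
    (∫ ω, θ (x₀ + W t ω + z ω t) ∂P - ∫ ω, θ (x₀ + W t ω + eulS g x₀ (t / N) (fun r : Fin (N + 1) => W (t / N * (r:ℕ)) ω) N) ∂P) ^ 2
      ≤ Real.exp (3 * ((2 * M) ^ 2 * t ^ 2 / (2 * H * t ^ (2 * H)))) * √(((2 * M) ^ 2 * t ^ 2 / (2 * H * t ^ (2 * H))) *
        ((2 * M) * t / (2 * H * t ^ (2 * H)) * ∫ q, |b (x₀ + W q.2 q.1 + z q.1 q.2) -
          stepg g t N (fun u => x₀ + W u q.1 + z q.1 u) q.2| ∂(P.prod (volume.restrict (Set.Ioc 0 t))))) := by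
  set X : Ω → ℝ → ℝ := fun ω u => x₀ + W u ω + z ω u with hX
  let h : ℝ → Ω → ℝ := fun r ω => z ω r - stepC g t N (X ω) r
  have hXc : ∀ ω, Continuous (X ω) := fun ω => (continuous_const.add (hWc ω)).add (lip_cont hM (hzL ω))
  have hmeas : Measurable fun q : Ω × ℝ => |b (x₀ + W q.2 q.1 + z q.1 q.2) -
          stepg g t N (fun u => x₀ + W u q.1 + z q.1 u) q.2| :=
    ((hb.comp (X_joint hW hWc hM x₀ hzL hzm)).sub (stepg_joint hW x₀ hzm hg.measurable t N)).abs
  have hintg : Integrable (fun q : Ω × ℝ => |b (x₀ + W q.2 q.1 + z q.1 q.2) -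
          stepg g t N (fun u => x₀ + W u q.1 + z q.1 u) q.2|) (P.prod (volume.restrict (Set.Ioc 0 t))) := by
    refine bdd_int_prod hmeas (C := M + N * M) fun q => ?_
    rw [abs_abs]
    exact (abs_sub _ _).trans (add_le_add (hbM _) (stepg_le hgM t N _ _))
  have hadX : ∀ s ∈ Set.Icc 0 t, ∃ k, Measurable[past W s] k ∧ (fun ω => g (X ω s)) =ᵐ[P] k := by
    intro s hs
    obtain ⟨k, hk, he⟩ := had s hs
    refine ⟨fun ω => g (x₀ + W s ω + k ω), hg.measurable.comp ((measurable_const.add (meas_past ⟨hs.1, le_rfl⟩)).add hk), ?_⟩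
    filter_upwards [he] with ω hω
    simp only [hX]; rw [← hω]
  have key := thmG hW hH hH2 hW0 hWc ht (K := 2 * M) (by positivity) h ?_ ?_ ?_
    (m := N + 1) (fun r => t / N * (r:ℕ)) (fun r => grid_mem ht hN (by have := r.2; omega))
    (fun v => θ (x₀ + v (Fin.last N) + eulS g x₀ (t / N) v N))
    (hθ.comp ((continuous_const.add (continuous_apply _)).add (eulS_cont hg x₀ (t / N) N)))
    (fun _ => hθ0 _) (fun _ => hθ1 _)
  · have key2 := key.2.2 (fun ω => ∫ u in Set.Ioc 0 t, |b (X ω u) - stepg g t N (X ω) u|) hintg.integral_prod_left ?_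
    · rw [integral_prod (f := fun q : Ω × ℝ => |b (x₀ + W q.2 q.1 + z q.1 q.2) -
          stepg g t N (fun u => x₀ + W u q.1 + z q.1 u) q.2|) hintg]
      refine le_trans (le_of_eq ?_) key2
      congr 2
      · refine integral_congr_ae (Eventually.of_forall fun ω => ?_)
        simp only [h, Fin.val_last]
        have h1 := eulS_eq g x₀ ht (N := N) (fun u => W u ω) (z ω) N le_rfl
        simp only [hX]
        rw [h1, grid_last hN]
        congr 1; ring
      · simp only [Fin.val_last, grid_last hN]
    · intro L hL
      filter_upwards [hsol] with ω hω
      have hib : ∀ r s, IntervalIntegrable (fun u => b (X ω u)) volume r s := fun r s =>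
        bint hb hbM (w := fun u => x₀ + W u ω) (continuous_const.add (hWc ω)) (lip_cont hM (hzL ω)) r s
      have hii : ∀ r s, IntervalIntegrable (fun u => b (X ω u) - stepg g t N (X ω) u) volume r s := fun r s =>
        (hib r s).sub (stepg_ii g t N (X ω) r s)
      have hh : ∀ r ∈ Set.Icc 0 t, h r ω = ∫ u in (0:ℝ)..r, (b (X ω u) - stepg g t N (X ω) u) := by
        intro r hr
        rw [intervalIntegral.integral_sub (hib 0 r) (stepg_ii g t N (X ω) 0 r),
          stepC_int g ht N _ hr.1]
        simp only [h]
        rw [hω.2 r hr]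
      have h1 : ∀ j ∈ Finset.range L, |h (t / L * ((j + 1 : ℕ) : ℝ)) ω - h (t / L * (j : ℕ)) ω| ≤
          ∫ u in (t / L * (j : ℕ))..(t / L * ((j + 1 : ℕ) : ℝ)), |b (X ω u) - stepg g t N (X ω) u| := by
        intro j hj
        have hjL := Finset.mem_range.1 hj
        rw [hh _ (grid_mem ht hL (by omega)), hh _ (grid_mem ht hL (by omega)),
          intervalIntegral.integral_interval_sub_left (hii _ _) (hii _ _)]
        exact intervalIntegral.abs_integral_le_integral_abs (grid_mono ht L j (j + 1) (by omega))
      refine (Finset.sum_le_sum h1).trans (le_of_eq ?_)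
      rw [intervalIntegral.sum_integral_adjacent_intervals (a := fun j : ℕ => t / L * (j:ℝ))
        (f := fun u => |b (X ω u) - stepg g t N (X ω) u|) (fun j _ => (hii _ _).abs), grid_last hL]
      rw [Nat.cast_zero, mul_zero, intervalIntegral.integral_of_le ht.le]
  · refine Eventually.of_forall fun ω => ?_
    simp only [h]; rw [(hzL ω).1, stepC_zero g ht, sub_zero]
  · refine Eventually.of_forall fun ω r hr s hs => ?_
    have h1 := (hzL ω).2 s r
    have h2 := stepC_lip hgM ht N (X ω) s r
    have e : h s ω - h r ω = (z ω s - z ω r) - (stepC g t N (X ω) s - stepC g t N (X ω) r) := by simp only [h]; ring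
    rw [e]
    refine (abs_sub _ _).trans ?_
    linarith
  · intro r hr
    obtain ⟨k, hk, he⟩ := had r hr
    have hc : ∀ i : ℕ, ∃ c : Ω → ℝ, i < N → Measurable[past W r] c ∧
        (fun ω => g (X ω (t / N * (i : ℕ))) * (min r (t / N * ((i + 1 : ℕ) : ℝ)) - min r (t / N * (i : ℕ)))) =ᵐ[P] c := by
      intro i
      by_cases hi : i < N
      · by_cases hri : t / N * (i:ℕ) ≤ r
        · obtain ⟨k, hk, he⟩ := hadX _ (grid_mem ht hN hi.le)
          refine ⟨fun ω => k ω * (min r (t / N * ((i + 1 : ℕ) : ℝ)) - min r (t / N * (i : ℕ))), fun _ => ⟨?_, ?_⟩⟩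
          · exact (hk.mono (past_mono hri) le_rfl).mul measurable_const
          · filter_upwards [he] with ω hω
            rw [hω]
        · refine ⟨fun _ => 0, fun _ => ⟨measurable_const, Eventually.of_forall fun ω => ?_⟩⟩
          have h1 := (not_le.1 hri).le
          simp only
          rw [min_eq_left h1, min_eq_left (h1.trans (grid_mono ht N i (i + 1) (by omega)))]; simp
      · exact ⟨0, fun h => absurd h hi⟩
    choose c hc using hc
    refine ⟨fun ω => k ω - ∑ i ∈ Finset.range N, c i ω, hk.sub (Finset.measurable_fun_sum _ fun i hi => (hc i (Finset.mem_range.1 hi)).1), ?_⟩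
    have hall : ∀ᵐ ω ∂P, ∀ i ∈ Finset.range N, g (X ω (t / N * (i : ℕ))) * (min r (t / N * ((i + 1 : ℕ) : ℝ)) - min r (t / N * (i : ℕ))) = c i ω := by
      rw [eventually_all_finset]
      exact fun i hi => (hc i (Finset.mem_range.1 hi)).2
    filter_upwards [he, hall] with ω h1 h2
    simp only [h, stepC]
    rw [Finset.sum_congr rfl h2, h1]

end
end FBMProof

open MeasureTheory ProbabilityTheory Real
namespace FBMProof
open scoped ENNReal Topology
open Filter

section
variable {Ω : Type*} [mΩ : MeasurableSpace Ω] {P : Measure Ω} [IsProbabilityMeasure P]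
  {H : ℝ} {W : ℝ → Ω → ℝ}

theorem stepg_tendsto {g : ℝ → ℝ} (hg : Continuous g) {t : ℝ} (ht : 0 < t) {X : ℝ → ℝ} (hX : Continuous X)
    {u : ℝ} (hu : u ∈ Set.Ioc 0 t) : Tendsto (fun N : ℕ => stepg g t (N + 1) X u) atTop (𝓝 (g (X u))) := by
  have h := fun N : ℕ => step_val g ht (Nat.succ_pos N) X hu
  choose i hi hiu hie using h
  have hlim : Tendsto (fun N : ℕ => t / ((N + 1 : ℕ) : ℝ) * (i N : ℝ)) atTop (𝓝 u) := by
    have h0 : Tendsto (fun N : ℕ => u - t * (1 / ((N:ℝ) + 1))) atTop (𝓝 u) := by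
      have := (tendsto_one_div_add_atTop_nhds_zero_nat (𝕜 := ℝ)).const_mul t
      simpa using tendsto_const_nhds.sub this
    refine tendsto_of_tendsto_of_tendsto_of_le_of_le h0 tendsto_const_nhds (fun N => ?_) (fun N => (hiu N).1.le)
    have := (hiu N).2
    simp only [Nat.succ_eq_add_one] at this ⊢
    push_cast at this ⊢
    have e : t / ((N:ℝ) + 1) * ((i N : ℝ) + 1) = t / ((N:ℝ) + 1) * (i N : ℝ) + t * (1 / ((N:ℝ) + 1)) := by ring
    linarith
  refine (((hg.comp hX).tendsto u).comp hlim).congr fun N => ?_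
  exact (hie N).symm

theorem I_bound (hW : IsFractionalBM P H W)
    (hWc : ∀ ω, Continuous fun t => W t ω) {M t : ℝ} (hM : 0 < M) (ht : 0 < t) (x₀ : ℝ)
    {b : ℝ → ℝ} (hb : Measurable b) (hbM : ∀ x, |b x| ≤ M)
    {z : Ω → ℝ → ℝ} (hzL : ∀ ω, z ω ∈ LipM M) (hzm : ∀ s, Measurable fun ω => z ω s)
    {g : ℝ → ℝ} (hg : Continuous g) (hgM : ∀ x, |g x| ≤ M) {R : Ω → ℝ≥0∞} {ε : ℝ} (hε : 0 < ε)
    (hR : ∫⁻ ω, R ω ∂P ≤ ENNReal.ofReal ε)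
    (hRb : ∀ ω, ∀ z ∈ LipM M, ∫⁻ u in Set.Ioc 0 t,
        ENNReal.ofReal |b (x₀ + W u ω + z u) - g (x₀ + W u ω + z u)| ≤ R ω) :
    ∀ᶠ N : ℕ in atTop, ∫ q, |b (x₀ + W q.2 q.1 + z q.1 q.2) -
          stepg g t (N + 1) (fun u => x₀ + W u q.1 + z q.1 u) q.2| ∂(P.prod (volume.restrict (Set.Ioc 0 t))) ≤ 2 * ε := by
  set μ := P.prod (volume.restrict (Set.Ioc 0 t)) with hμ
  have hXj := X_joint hW hWc hM x₀ hzL hzm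
  have hbj := hb.comp hXj
  have hgj := hg.measurable.comp hXj
  have hbg : Measurable fun q : Ω × ℝ => |b (x₀ + W q.2 q.1 + z q.1 q.2) - g (x₀ + W q.2 q.1 + z q.1 q.2)| := (hbj.sub hgj).abs
  have hsj := fun N : ℕ => stepg_joint (P := P) hW x₀ hzm hg.measurable t (N + 1)
  have hXc : ∀ ω, Continuous fun u => x₀ + W u ω + z ω u := fun ω => (continuous_const.add (hWc ω)).add (lip_cont hM (hzL ω))
  have h1 : ∫ q, |b (x₀ + W q.2 q.1 + z q.1 q.2) - g (x₀ + W q.2 q.1 + z q.1 q.2)| ∂μ ≤ ε := by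
    rw [integral_eq_lintegral_of_nonneg_ae (Eventually.of_forall fun q => abs_nonneg _) hbg.aestronglyMeasurable]
    refine ENNReal.toReal_le_of_le_ofReal hε.le ?_
    rw [hμ, lintegral_prod _ (hbg.ennreal_ofReal.aemeasurable)]
    refine (lintegral_mono fun ω => ?_).trans hR
    exact hRb ω (z ω) (hzL ω)
  have h2 : Tendsto (fun N : ℕ => ∫ q, |g (x₀ + W q.2 q.1 + z q.1 q.2) -
          stepg g t (N + 1) (fun u => x₀ + W u q.1 + z q.1 u) q.2| ∂μ) atTop (𝓝 0) := by
    have hae : ∀ᵐ q ∂μ, q.2 ∈ Set.Ioc 0 t :=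
      (Measure.quasiMeasurePreserving_snd (μ := P) (ν := volume.restrict (Set.Ioc 0 t))).ae (ae_restrict_mem measurableSet_Ioc)
    have := tendsto_integral_of_dominated_convergence (μ := μ) (F := fun (N : ℕ) q => |g (x₀ + W q.2 q.1 + z q.1 q.2) -
          stepg g t (N + 1) (fun u => x₀ + W u q.1 + z q.1 u) q.2|) (f := fun _ => 0) (fun _ => 2 * M)
          (fun N => (hgj.sub (hsj N)).abs.aestronglyMeasurable) (integrable_const _) ?_ ?_
    · simpa using this
    · intro N
      filter_upwards [hae] with q hq
      obtain ⟨i, -, -, he⟩ := step_val g ht (Nat.succ_pos N) (fun u => x₀ + W u q.1 + z q.1 u) hq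
      rw [Real.norm_eq_abs, abs_abs]
      simp only [Nat.succ_eq_add_one] at he
      rw [he]
      refine (abs_sub _ _).trans ?_
      have a1 := hgM (x₀ + W q.2 q.1 + z q.1 q.2)
      have a2 := hgM (x₀ + W (t / ((N + 1 : ℕ) : ℝ) * (i:ℝ)) q.1 + z q.1 (t / ((N + 1 : ℕ) : ℝ) * (i:ℝ)))
      linarith
    · filter_upwards [hae] with q hq
      have h3 := (stepg_tendsto hg ht (hXc q.1) hq)
      have h4 := (tendsto_const_nhds (x := g (x₀ + W q.2 q.1 + z q.1 q.2))).sub h3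
      have h5 := h4.abs
      simpa using h5
  filter_upwards [(tendsto_order.1 h2).2 ε hε] with N hN
  have i1 : Integrable (fun q : Ω × ℝ => |b (x₀ + W q.2 q.1 + z q.1 q.2) - g (x₀ + W q.2 q.1 + z q.1 q.2)|) μ :=
    bdd_int_prod hbg (C := 2 * M) fun q => by
      rw [abs_abs]; refine (abs_sub _ _).trans ?_
      have a1 := hgM (x₀ + W q.2 q.1 + z q.1 q.2)
      have a2 := hbM (x₀ + W q.2 q.1 + z q.1 q.2)
      linarith
  have i2 : Integrable (fun q : Ω × ℝ => |g (x₀ + W q.2 q.1 + z q.1 q.2) -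
          stepg g t (N + 1) (fun u => x₀ + W u q.1 + z q.1 u) q.2|) μ :=
    bdd_int_prod (hgj.sub (hsj N)).abs (C := M + ((N + 1 : ℕ) : ℝ) * M) fun q => by
      rw [abs_abs]; exact (abs_sub _ _).trans (add_le_add (hgM _) (stepg_le hgM t (N + 1) _ _))
  have i3 : Integrable (fun q : Ω × ℝ => |b (x₀ + W q.2 q.1 + z q.1 q.2) -
          stepg g t (N + 1) (fun u => x₀ + W u q.1 + z q.1 u) q.2|) μ :=
    bdd_int_prod (hbj.sub (hsj N)).abs (C := M + ((N + 1 : ℕ) : ℝ) * M) fun q => by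
      rw [abs_abs]; exact (abs_sub _ _).trans (add_le_add (hbM _) (stepg_le hgM t (N + 1) _ _))
  have h6 := integral_mono (μ := μ) i3 (i1.add i2) (fun q => abs_sub_le _ _ _)
  have h7 := integral_add (μ := μ) i1 i2
  have h8 : ∫ q, |b (x₀ + W q.2 q.1 + z q.1 q.2) -
          stepg g t (N + 1) (fun u => x₀ + W u q.1 + z q.1 u) q.2| ∂μ ≤ ∫ q, |b (x₀ + W q.2 q.1 + z q.1 q.2) - g (x₀ + W q.2 q.1 + z q.1 q.2)| ∂μ + ∫ q, |g (x₀ + W q.2 q.1 + z q.1 q.2) -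
          stepg g t (N + 1) (fun u => x₀ + W u q.1 + z q.1 u) q.2| ∂μ := h6.trans (le_of_eq h7)
  linarith

theorem law_unique (hW : IsFractionalBM P H W) (hH : 0 < H) (hH2 : H ≤ 1 / 2) (hW0 : ∀ ω, W 0 ω = 0)
    (hWc : ∀ ω, Continuous fun t => W t ω) {M t : ℝ} (hM : 0 < M) (ht : 0 < t) (x₀ : ℝ)
    {b : ℝ → ℝ} (hb : Measurable b) (hbi : Integrable b) (hbM : ∀ x, |b x| ≤ M)
    {z z' : Ω → ℝ → ℝ} (hzL : ∀ ω, z ω ∈ LipM M) (hzm : ∀ s, Measurable fun ω => z ω s)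
    (hsol : ∀ᵐ ω ∂P, z ω ∈ Sol b (fun u => x₀ + W u ω) M t)
    (had : ∀ s ∈ Set.Icc 0 t, ∃ g, Measurable[past W s] g ∧ (fun ω => z ω s) =ᵐ[P] g)
    (hzL' : ∀ ω, z' ω ∈ LipM M) (hzm' : ∀ s, Measurable fun ω => z' ω s)
    (hsol' : ∀ᵐ ω ∂P, z' ω ∈ Sol b (fun u => x₀ + W u ω) M t)
    (had' : ∀ s ∈ Set.Icc 0 t, ∃ g, Measurable[past W s] g ∧ (fun ω => z' ω s) =ᵐ[P] g)
    {θ : ℝ → ℝ} (hθ : Continuous θ) (hθ0 : ∀ x, 0 ≤ θ x) (hθ1 : ∀ x, θ x ≤ 1) :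
    ∫ ω, θ (x₀ + W t ω + z ω t) ∂P = ∫ ω, θ (x₀ + W t ω + z' ω t) ∂P := by
  obtain ⟨g, R, hg, hgM, -, hRi, -, hR⟩ := drift_approx hW hH hH2 hW0 hWc hM ht x₀ hb hbi hbM
  set C := Real.exp (3 * ((2 * M) ^ 2 * t ^ 2 / (2 * H * t ^ (2 * H)))) with hC
  set Q := ((2 * M) ^ 2 * t ^ 2 / (2 * H * t ^ (2 * H))) with hQ
  set Q' := ((2 * M) * t / (2 * H * t ^ (2 * H))) with hQ'
  have hQ0 : 0 ≤ Q := by positivity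
  have hQ0' : 0 ≤ Q' := by positivity
  set A := ∫ ω, θ (x₀ + W t ω + z ω t) ∂P
  set A' := ∫ ω, θ (x₀ + W t ω + z' ω t) ∂P
  have hle : ∀ n : ℕ, |A - A'| ≤ 2 * √(C * √(Q * (Q' * (2 * (1 / 2) ^ n)))) := by
    intro n
    have hp : (0:ℝ) < (1 / 2) ^ n := by positivity
    obtain ⟨N, h1, h2⟩ := ((I_bound hW hWc hM ht x₀ hb hbM hzL hzm (hg n) (hgM n) hp (hRi n) (hR n)).and
      (I_bound hW hWc hM ht x₀ hb hbM hzL' hzm' (hg n) (hgM n) hp (hRi n) (hR n))).exists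
    have k1 := euler_core hW hH hH2 hW0 hWc hM ht x₀ hb hbM hzL hzm hsol had (hg n) (hgM n) (Nat.succ_pos N) hθ hθ0 hθ1
    have k2 := euler_core hW hH hH2 hW0 hWc hM ht x₀ hb hbM hzL' hzm' hsol' had' (hg n) (hgM n) (Nat.succ_pos N) hθ hθ0 hθ1
    have l1 := abs_le_sqrt (k1.trans (mul_le_mul_of_nonneg_left (Real.sqrt_le_sqrt
      (mul_le_mul_of_nonneg_left (mul_le_mul_of_nonneg_left h1 hQ0') hQ0)) (Real.exp_pos _).le))
    have l2 := abs_le_sqrt (k2.trans (mul_le_mul_of_nonneg_left (Real.sqrt_le_sqrt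
      (mul_le_mul_of_nonneg_left (mul_le_mul_of_nonneg_left h2 hQ0') hQ0)) (Real.exp_pos _).le))
    rw [abs_le] at l1 l2 ⊢
    constructor <;> linarith
  have hlim : Tendsto (fun n : ℕ => 2 * √(C * √(Q * (Q' * (2 * (1 / 2 : ℝ) ^ n))))) atTop (𝓝 0) := by
    have h0 : Tendsto (fun n : ℕ => (1 / 2 : ℝ) ^ n) atTop (𝓝 0) :=
      tendsto_pow_atTop_nhds_zero_of_lt_one (by norm_num) (by norm_num)
    have hc : Continuous fun x : ℝ => 2 * √(C * √(Q * (Q' * (2 * x)))) := by fun_prop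
    have := (hc.tendsto 0).comp h0
    simpa [Function.comp_def] using this
  have h0 : |A - A'| ≤ 0 := ge_of_tendsto hlim (Eventually.of_forall hle)
  exact sub_eq_zero.1 (abs_eq_zero.1 (le_antisymm h0 (abs_nonneg _)))

/-- an increasing continuous function with values in the unit interval -/
noncomputable def thet (x : ℝ) : ℝ := 1 / 2 + Real.arctan x / Real.pi

theorem thet_cont : Continuous thet := by unfold thet; fun_prop
theorem thet_mono : StrictMono thet := fun x y h => by
  unfold thet
  have := Real.arctan_strictMono h
  have hp := Real.pi_pos
  gcongr
theorem thet_bd (x : ℝ) : 0 ≤ thet x ∧ thet x ≤ 1 := by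
  unfold thet
  have h1 := Real.arctan_lt_pi_div_two x
  have h2 := Real.neg_pi_div_two_lt_arctan x
  have hp := Real.pi_pos
  have e : Real.arctan x / Real.pi * Real.pi = Real.arctan x := by field_simp
  constructor <;> nlinarith

/-- Path-by-path uniqueness, together with an adapted solution. -/
theorem path_unique (hW : IsFractionalBM P H W) (hH : 0 < H) (hH2 : H ≤ 1 / 2) (hW0 : ∀ ω, W 0 ω = 0)
    (hWc : ∀ ω, Continuous fun t => W t ω) {M T : ℝ} (hM : 0 < M) (hT : 0 < T) (x₀ : ℝ)
    {b : ℝ → ℝ} (hb : Measurable b) (hbi : Integrable b) (hbM : ∀ x, |b x| ≤ M) :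
    ∃ z : Ω → ℝ → ℝ, (∀ ω, z ω ∈ LipM M) ∧ (∀ s, Measurable fun ω => z ω s) ∧
      (∀ᵐ ω ∂P, z ω ∈ Sol b (fun u => x₀ + W u ω) M T ∧
        ∀ z' ∈ Sol b (fun u => x₀ + W u ω) M T, ∀ t ∈ Set.Icc 0 T, z' t = z ω t) ∧
      ∀ t ∈ Set.Icc 0 T, ∃ g, Measurable[past W t] g ∧ (fun ω => z ω t) =ᵐ[P] g := by
  have hG := good_ae hW hH hH2 hW0 hWc hM hT x₀ hb hbi hbM
  have hwc : ∀ ω, Continuous fun u => x₀ + W u ω := fun ω => continuous_const.add (hWc ω)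
  have hwm : ∀ t, Measurable fun ω => x₀ + W t ω := fun t => measurable_const.add (hW.1 t)
  have hmm : ∀ t ∈ Set.Icc 0 T, ∀ s ∈ Set.Icc 0 t, Measurable[past W t] fun ω => x₀ + W s ω :=
    fun t _ s hs => measurable_const.add (meas_past hs)
  obtain ⟨z, z1, z2, z3, z4⟩ := exists_zmax (P := P) hM hT.le hb hbM (w := fun u ω => x₀ + W u ω) hwc hwm (past W) hmm hG
  obtain ⟨y, y1, y2, y3, y4⟩ := exists_zmin (P := P) hM hT.le hb hbM (w := fun u ω => x₀ + W u ω) hwc hwm (past W) hmm hG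
  refine ⟨z, z1, z2, ?_, z4⟩
  have hsub : ∀ {t : ℝ}, t ∈ Set.Icc 0 T → ∀ {w v : ℝ → ℝ}, v ∈ Sol b w M T → v ∈ Sol b w M t :=
    fun ht w v hv => ⟨hv.1, fun s hs => hv.2 s ⟨hs.1, hs.2.trans ht.2⟩⟩
  have heq : ∀ t ∈ Set.Ioc 0 T, ∀ᵐ ω ∂P, z ω t = y ω t := by
    intro t ht
    have htI : t ∈ Set.Icc 0 T := ⟨ht.1.le, ht.2⟩
    have hE := law_unique hW hH hH2 hW0 hWc hM ht.1 x₀ hb hbi hbM z1 z2 (z3.mono fun ω h => hsub htI h.1)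
      (fun s hs => z4 s ⟨hs.1, hs.2.trans ht.2⟩) y1 y2 (y3.mono fun ω h => hsub htI h.1)
      (fun s hs => y4 s ⟨hs.1, hs.2.trans ht.2⟩) thet_cont (fun x => (thet_bd x).1) (fun x => (thet_bd x).2)
    have hi : ∀ v : Ω → ℝ → ℝ, (∀ s, Measurable fun ω => v ω s) → Integrable (fun ω => thet (x₀ + W t ω + v ω t)) P := by
      intro v hv
      refine Integrable.of_bound (thet_cont.measurable.comp ((hwm t).add (hv t))).aestronglyMeasurable 1 (Eventually.of_forall fun ω => ?_)
      rw [Real.norm_eq_abs, abs_of_nonneg (thet_bd _).1]; exact (thet_bd _).2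
    have hle : (fun ω => thet (x₀ + W t ω + y ω t)) ≤ᵐ[P] fun ω => thet (x₀ + W t ω + z ω t) := by
      filter_upwards [z3, y3] with ω h1 h2
      refine thet_mono.monotone ?_
      have := h2.2 _ h1.1 t htI
      linarith
    have := (integral_eq_iff_of_ae_le (hi y y2) (hi z z2) hle).1 hE.symm
    filter_upwards [this] with ω h
    have := thet_mono.injective h
    linarith
  have hall : ∀ᵐ ω ∂P, ∀ q : ℚ, (q:ℝ) ∈ Set.Ioc 0 T → z ω q = y ω q := by
    rw [ae_all_iff]
    intro q
    by_cases hq : (q:ℝ) ∈ Set.Ioc 0 T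
    · filter_upwards [heq q hq] with ω h _ using h
    · exact Eventually.of_forall fun ω h => absurd h hq
  filter_upwards [z3, y3, hall] with ω h1 h2 h3
  have hzy : ∀ t ∈ Set.Icc 0 T, z ω t = y ω t := by
    intro t ht
    have hcl : IsClosed {t | z ω t = y ω t} := isClosed_eq (lip_cont hM (z1 ω)) (lip_cont hM (y1 ω))
    have hsubset : Set.Icc 0 T ⊆ {t | z ω t = y ω t} := by
      have h4 : Set.Ioo 0 T ⊆ closure (Set.Ioo 0 T ∩ Set.range ((↑) : ℚ → ℝ)) :=
        Rat.denseRange_cast.open_subset_closure_inter isOpen_Ioo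
      have h5 : Set.Icc 0 T ⊆ closure (Set.Ioo 0 T ∩ Set.range ((↑) : ℚ → ℝ)) := by
        rw [← closure_Ioo hT.ne]
        exact closure_minimal h4 isClosed_closure
      refine h5.trans (closure_minimal ?_ hcl)
      rintro _ ⟨hq, q, rfl⟩
      exact h3 q ⟨hq.1, hq.2.le⟩
    exact hsubset ht
  refine ⟨h1.1, fun z' hz' t ht => le_antisymm (h1.2 z' hz' t ht) ?_⟩
  rw [hzy t ht]
  exact h2.2 z' hz' t ht

end
end FBMProof

open MeasureTheory ProbabilityTheory Real
namespace FBMProof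
open scoped ENNReal Topology symmDiff
open Filter

theorem sq_le_closed {m : ℕ} {μ ν : Measure (Fin m → ℝ)} [IsFiniteMeasure μ] [IsFiniteMeasure ν] {C : ℝ}
    (hC : 0 ≤ C)
    (h : ∀ G : (Fin m → ℝ) → ℝ, Continuous G → (∀ y, 0 ≤ G y) → (∀ y, G y ≤ 1) →
      (∫ y, G y ∂ν) ^ 2 ≤ C * ∫ y, G y ∂μ) {F : Set (Fin m → ℝ)} (hF : IsClosed F) :
    (ν F) ^ 2 ≤ ENNReal.ofReal C * μ F := by
  have key : ∀ n, (∫⁻ y, (hF.apprSeq n y : ℝ≥0∞) ∂ν) ^ 2 ≤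
      ENNReal.ofReal C * ∫⁻ y, (hF.apprSeq n y : ℝ≥0∞) ∂μ := by
    intro n
    have hc : Continuous fun y => ((hF.apprSeq n y : NNReal) : ℝ) :=
      NNReal.continuous_coe.comp (hF.apprSeq n).continuous
    have h1 : ∀ y, ((hF.apprSeq n y : NNReal) : ℝ) ≤ 1 := fun y => by
      exact_mod_cast HasOuterApproxClosed.apprSeq_apply_le_one hF n y
    have h2 := h (fun y => ((hF.apprSeq n y : NNReal) : ℝ)) hc (fun y => NNReal.coe_nonneg _) h1
    have h3 : ∀ ρ : Measure (Fin m → ℝ), IsFiniteMeasure ρ → ∫⁻ y, (hF.apprSeq n y : ℝ≥0∞) ∂ρ =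
        ENNReal.ofReal (∫ y, ((hF.apprSeq n y : NNReal) : ℝ) ∂ρ) := by
      intro ρ hρ
      rw [ofReal_integral_eq_lintegral_ofReal]
      · simp
      · refine Integrable.of_bound hc.aestronglyMeasurable 1 (Eventually.of_forall fun y => ?_)
        rw [Real.norm_of_nonneg (NNReal.coe_nonneg _)]; exact h1 y
      · exact Eventually.of_forall fun y => NNReal.coe_nonneg _
    rw [h3 ν inferInstance, h3 μ inferInstance, ← ENNReal.ofReal_pow (integral_nonneg fun y => NNReal.coe_nonneg _),
      ← ENNReal.ofReal_mul hC]
    exact ENNReal.ofReal_le_ofReal h2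
  have t1 := (HasOuterApproxClosed.tendsto_lintegral_apprSeq hF μ)
  have t2 := (HasOuterApproxClosed.tendsto_lintegral_apprSeq hF ν)
  refine le_of_tendsto_of_tendsto' (ENNReal.Tendsto.pow t2) (ENNReal.Tendsto.const_mul t1 (Or.inr ENNReal.ofReal_ne_top)) key

theorem sq_le_borel {m : ℕ} {μ ν : Measure (Fin m → ℝ)} [IsFiniteMeasure μ] [IsFiniteMeasure ν] {C : ℝ}
    (hC : 0 ≤ C)
    (h : ∀ G : (Fin m → ℝ) → ℝ, Continuous G → (∀ y, 0 ≤ G y) → (∀ y, G y ≤ 1) →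
      (∫ y, G y ∂ν) ^ 2 ≤ C * ∫ y, G y ∂μ) {S : Set (Fin m → ℝ)} (hS : MeasurableSet S) :
    (ν S) ^ 2 ≤ ENNReal.ofReal C * μ S := by
  have key : ∀ n : ℕ, ν S ≤ (ENNReal.ofReal C * μ S) ^ (1/2 : ℝ) + ((n:ℝ≥0∞) + 1)⁻¹ := by
    intro n
    obtain ⟨F, h1, h2, h3⟩ := hS.exists_isClosed_lt_add (measure_ne_top ν S) (ε := ((n:ℝ≥0∞) + 1)⁻¹)
      (ENNReal.inv_ne_zero.2 (by finiteness))
    refine h3.le.trans (add_le_add ?_ le_rfl)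
    have h4 := (sq_le_closed hC h h2).trans (mul_le_mul' le_rfl (measure_mono h1))
    have h5 := ENNReal.rpow_le_rpow h4 (by norm_num : (0:ℝ) ≤ 1/2)
    rwa [← ENNReal.rpow_natCast, ← ENNReal.rpow_mul, show ((2:ℕ):ℝ) * (1/2) = 1 by norm_num, ENNReal.rpow_one] at h5
  have ht : Tendsto (fun n : ℕ => (ENNReal.ofReal C * μ S) ^ (1/2 : ℝ) + ((n:ℝ≥0∞) + 1)⁻¹) atTop
      (𝓝 ((ENNReal.ofReal C * μ S) ^ (1/2 : ℝ) + 0)) := by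
    refine tendsto_const_nhds.add ?_
    have := (tendsto_add_atTop_iff_nat 1).2 ENNReal.tendsto_inv_nat_nhds_zero
    simpa using this
  have h6 := ge_of_tendsto' ht key
  rw [add_zero] at h6
  calc ν S ^ 2 ≤ ((ENNReal.ofReal C * μ S) ^ (1/2 : ℝ)) ^ 2 := pow_le_pow_left' h6 2
    _ = _ := by
      rw [← ENNReal.rpow_natCast, ← ENNReal.rpow_mul]; norm_num

/-- Absolute continuity from a quantitative bound on cylinders. -/
theorem ac_of_cyl {ι : Type*} {μ ν : Measure (ι → ℝ)} [IsFiniteMeasure μ] [IsFiniteMeasure ν] {C : ℝ≥0∞}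
    (hC : C ≠ ∞) (h : ∀ A ∈ measurableCylinders (fun _ : ι => ℝ), (ν A) ^ 2 ≤ C * μ A) : ν ≪ μ := by
  refine Measure.AbsolutelyContinuous.mk fun A hA h0 => ?_
  have key : ∀ n : ℕ, ν A ≤ ((n:ℝ≥0∞) + 1)⁻¹ + (C * ((n:ℝ≥0∞) + 1)⁻¹) ^ (1/2 : ℝ) := by
    intro n
    obtain ⟨D, hD, hDA⟩ := exists_measure_symmDiff_lt_of_generateFrom_isSetRing (μ := μ + ν)
      (isSetRing_measurableCylinders (α := fun _ : ι => ℝ))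
      ⟨{Set.univ}, Set.countable_singleton _, Set.singleton_subset_iff.2 (univ_mem_measurableCylinders (fun _ : ι => ℝ)), by simp⟩
      generateFrom_measurableCylinders.symm hA (ε := ((n:ℝ≥0∞) + 1)⁻¹)
      (ENNReal.inv_pos.2 (by finiteness))
    rw [Measure.add_apply] at hDA
    have h1 : μ D ≤ ((n:ℝ≥0∞) + 1)⁻¹ := by
      calc μ D ≤ μ ((D ∆ A) ∪ A) := measure_mono fun x hx => by
            by_cases hxA : x ∈ A
            · exact Or.inr hxA
            · exact Or.inl (Or.inl ⟨hx, hxA⟩)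
        _ ≤ μ (D ∆ A) + μ A := measure_union_le _ _
        _ = μ (D ∆ A) := by rw [h0, add_zero]
        _ ≤ _ := le_self_add.trans hDA.le
    have h2 := (h D hD).trans (mul_le_mul' le_rfl h1)
    have h5 := ENNReal.rpow_le_rpow h2 (by norm_num : (0:ℝ) ≤ 1/2)
    rw [← ENNReal.rpow_natCast, ← ENNReal.rpow_mul, show ((2:ℕ):ℝ) * (1/2) = 1 by norm_num, ENNReal.rpow_one] at h5
    calc ν A ≤ ν ((D ∆ A) ∪ D) := measure_mono fun x hx => by
            by_cases hxA : x ∈ D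
            · exact Or.inr hxA
            · exact Or.inl (Or.inr ⟨hx, hxA⟩)
      _ ≤ ν (D ∆ A) + ν D := measure_union_le _ _
      _ ≤ _ := add_le_add (le_add_self.trans hDA.le) h5
  have h0t : Tendsto (fun n : ℕ => ((n:ℝ≥0∞) + 1)⁻¹) atTop (𝓝 0) := by
    have := (tendsto_add_atTop_iff_nat 1).2 ENNReal.tendsto_inv_nat_nhds_zero
    simpa using this
  have ht : Tendsto (fun n : ℕ => ((n:ℝ≥0∞) + 1)⁻¹ + (C * ((n:ℝ≥0∞) + 1)⁻¹) ^ (1/2 : ℝ)) atTop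
      (𝓝 (0 + (C * 0) ^ (1/2 : ℝ))) :=
    h0t.add ((ENNReal.continuous_rpow_const.tendsto _).comp
      (ENNReal.Tendsto.const_mul h0t (Or.inr hC)))
  have h6 := ge_of_tendsto' ht key
  simpa using h6

section
variable {Ω : Type*} [mΩ : MeasurableSpace Ω] {P : Measure Ω} [IsProbabilityMeasure P]

theorem ac_of_fdd {T C : ℝ} (hC : 0 ≤ C) {Y Z : ℝ → Ω → ℝ} (hY : ∀ t ∈ Set.Icc 0 T, Measurable (Y t))
    (hZ : ∀ t ∈ Set.Icc 0 T, Measurable (Z t))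
    (h : ∀ (m : ℕ) (τ : Fin m → ℝ), (∀ r, τ r ∈ Set.Icc 0 T) → ∀ G : (Fin m → ℝ) → ℝ, Continuous G →
      (∀ y, 0 ≤ G y) → (∀ y, G y ≤ 1) →
      (∫ ω, G (fun r => Y (τ r) ω) ∂P) ^ 2 ≤ C * ∫ ω, G (fun r => Z (τ r) ω) ∂P) :
    processLaw P T Y ≪ processLaw P T Z := by
  have mY : Measurable fun ω => fun t : Set.Icc (0 : ℝ) T => Y t ω := measurable_pi_iff.2 fun t => hY t t.2
  have mZ : Measurable fun ω => fun t : Set.Icc (0 : ℝ) T => Z t ω := measurable_pi_iff.2 fun t => hZ t t.2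
  unfold processLaw
  have : IsProbabilityMeasure (P.map fun ω => fun t : Set.Icc (0 : ℝ) T => Y t ω) :=
    Measure.isProbabilityMeasure_map mY.aemeasurable
  have : IsProbabilityMeasure (P.map fun ω => fun t : Set.Icc (0 : ℝ) T => Z t ω) :=
    Measure.isProbabilityMeasure_map mZ.aemeasurable
  refine ac_of_cyl (C := ENNReal.ofReal C) ENNReal.ofReal_ne_top fun A hA => ?_
  obtain ⟨I, S, hS, rfl⟩ := (mem_measurableCylinders A).1 hA
  let e := I.equivFin
  let τ : Fin I.card → ℝ := fun r => ((e.symm r : I) : Set.Icc (0:ℝ) T)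
  have hτ : ∀ r, τ r ∈ Set.Icc 0 T := fun r => ((e.symm r : I) : Set.Icc (0:ℝ) T).2
  have mY' : Measurable fun ω => fun r => Y (τ r) ω := measurable_pi_iff.2 fun r => hY _ (hτ r)
  have mZ' : Measurable fun ω => fun r => Z (τ r) ω := measurable_pi_iff.2 fun r => hZ _ (hτ r)
  let S' : Set (Fin I.card → ℝ) := (fun v : Fin I.card → ℝ => fun i : I => v (e i)) ⁻¹' S
  have hS' : MeasurableSet S' := by
    refine (measurable_pi_iff.2 fun i => measurable_pi_apply _) hS
  have : IsProbabilityMeasure (P.map fun ω => fun r => Y (τ r) ω) :=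
    Measure.isProbabilityMeasure_map mY'.aemeasurable
  have : IsProbabilityMeasure (P.map fun ω => fun r => Z (τ r) ω) :=
    Measure.isProbabilityMeasure_map mZ'.aemeasurable
  have key := sq_le_borel (μ := P.map fun ω => fun r => Z (τ r) ω) (ν := P.map fun ω => fun r => Y (τ r) ω) hC
    (fun G hG h0 h1 => by
      rw [integral_map mY'.aemeasurable hG.aestronglyMeasurable, integral_map mZ'.aemeasurable hG.aestronglyMeasurable]
      exact h _ τ hτ G hG h0 h1) hS'
  rw [Measure.map_apply mY' hS', Measure.map_apply mZ' hS'] at key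
  have hc : MeasurableSet (cylinder I S) := MeasurableSet.cylinder (α := fun _ => ℝ) I hS
  rw [Measure.map_apply mY hc, Measure.map_apply mZ hc]
  have e1 : ∀ V : ℝ → Ω → ℝ, (fun ω => fun t : Set.Icc (0 : ℝ) T => V t ω) ⁻¹' (cylinder I S) =
      (fun ω => fun r => V (τ r) ω) ⁻¹' S' := by
    intro V; ext ω
    simp only [Set.mem_preimage, mem_cylinder, S', τ]
    have : (I.restrict fun t : Set.Icc (0 : ℝ) T => V t ω) = fun i : I => V ((e.symm (e i) : I) : Set.Icc (0:ℝ) T) ω := by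
      ext i; simp
    rw [this]
  rw [e1, e1]
  exact key

theorem equiv_shift {H : ℝ} {W : ℝ → Ω → ℝ} (hW : IsFractionalBM P H W) (hH : 0 < H) (hH2 : H ≤ 1 / 2)
    (hW0 : ∀ ω, W 0 ω = 0) (hWc : ∀ ω, Continuous fun t => W t ω) {M T : ℝ} (hM : 0 < M) (hT : 0 < T) (x₀ : ℝ)
    {z : Ω → ℝ → ℝ} (hz : ∀ ω, z ω ∈ LipM M) (hzm : ∀ s, Measurable fun ω => z ω s)
    (had : ∀ t ∈ Set.Icc 0 T, ∃ g, Measurable[past W t] g ∧ (fun ω => z ω t) =ᵐ[P] g) :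
    processLaw P T (fun t ω => x₀ + W t ω + z ω t) ≪ processLaw P T (fun t ω => x₀ + W t ω) ∧
    processLaw P T (fun t ω => x₀ + W t ω) ≪ processLaw P T (fun t ω => x₀ + W t ω + z ω t) := by
  have m1 : ∀ t ∈ Set.Icc 0 T, Measurable fun ω => x₀ + W t ω := fun t _ => measurable_const.add (hW.1 t)
  have m2 : ∀ t ∈ Set.Icc 0 T, Measurable fun ω => x₀ + W t ω + z ω t := fun t ht => (m1 t ht).add (hzm t)
  have key := fun (m : ℕ) (τ : Fin m → ℝ) (hτ : ∀ r, τ r ∈ Set.Icc 0 T) (G : (Fin m → ℝ) → ℝ)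
    (hG : Continuous G) (hG0 : ∀ y, 0 ≤ G y) (hG1 : ∀ y, G y ≤ 1) =>
    thmG hW hH hH2 hW0 hWc hT hM.le (fun r ω => z ω r) (Eventually.of_forall fun ω => (hz ω).1)
      (Eventually.of_forall fun ω s _ t _ => (hz ω).2 t s) had τ hτ
      (fun y => G (fun r => x₀ + y r)) (hG.comp (by fun_prop)) (fun y => hG0 _) (fun y => hG1 _)
  constructor
  · refine ac_of_fdd (exp_pos (M ^ 2 * T ^ 2 / (2 * H * T ^ (2 * H)))).le m2 m1 fun m τ hτ G hG hG0 hG1 => ?_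
    have := (key m τ hτ G hG hG0 hG1).1
    simp only [← add_assoc] at this
    exact this
  · refine ac_of_fdd (exp_pos (M ^ 2 * T ^ 2 / (2 * H * T ^ (2 * H)))).le m1 m2 fun m τ hτ G hG hG0 hG1 => ?_
    have := (key m τ hτ G hG hG0 hG1).2.1
    simp only [← add_assoc] at this
    exact this
end
end FBMProof

open MeasureTheory ProbabilityTheory Real
namespace FBMProof
open scoped ENNReal Topology
open Filter

section
variable {Ω : Type*} [mΩ : MeasurableSpace Ω] {P : Measure Ω} [IsProbabilityMeasure P] {H : ℝ} {W : ℝ → Ω → ℝ}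

theorem exists_modification (hW : IsFractionalBM P H W) : ∃ W' : ℝ → Ω → ℝ, IsFractionalBM P H W' ∧
    (∀ ω, W' 0 ω = 0) ∧ (∀ ω, Continuous fun t => W' t ω) ∧ ∀ᵐ ω ∂P, ∀ t, 0 ≤ t → W' t ω = W t ω := by
  classical
  let B : Set Ω := toMeasurable P {ω | ¬ (ContinuousOn (fun t => W t ω) (Set.Ici 0) ∧ W 0 ω = 0)}
  have hB : MeasurableSet B := measurableSet_toMeasurable _ _
  have hB0 : P B = 0 := by
    rw [measure_toMeasurable]; exact hW.2.1
  have hBc : ∀ ω, ω ∉ B → ContinuousOn (fun t => W t ω) (Set.Ici 0) ∧ W 0 ω = 0 := by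
    intro ω hω
    by_contra h
    exact hω (subset_toMeasurable _ _ h)
  let W' : ℝ → Ω → ℝ := fun t => B.piecewise (fun _ => 0) (W (max t 0))
  have e0 : ∀ ω ∈ B, ∀ t, W' t ω = 0 := fun ω hω t => Set.piecewise_eq_of_mem _ _ _ hω
  have e1 : ∀ ω, ω ∉ B → ∀ t, W' t ω = W (max t 0) ω := fun ω hω t => Set.piecewise_eq_of_notMem _ _ _ hω
  have hc : ∀ ω, Continuous fun t => W' t ω := by
    intro ω
    by_cases hω : ω ∈ B
    · simp only [e0 ω hω]; exact continuous_const
    · simp only [e1 ω hω]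
      exact (hBc ω hω).1.comp_continuous (by fun_prop) fun t => Set.mem_Ici.2 (le_max_right t 0)
  have h0 : ∀ ω, W' 0 ω = 0 := by
    intro ω
    by_cases hω : ω ∈ B
    · exact e0 ω hω 0
    · rw [e1 ω hω, max_self]; exact (hBc ω hω).2
  have hae : ∀ᵐ ω ∂P, ∀ t, 0 ≤ t → W' t ω = W t ω := by
    have : ∀ᵐ ω ∂P, ω ∉ B := measure_eq_zero_iff_ae_notMem.1 hB0
    filter_upwards [this] with ω hω t ht
    rw [e1 ω hω, max_eq_left ht]
  refine ⟨W', ⟨fun t => Measurable.piecewise hB measurable_const (hW.1 _),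
    Eventually.of_forall fun ω => ⟨(hc ω).continuousOn, h0 ω⟩, fun n t ht c => ?_⟩, h0, hc, hae⟩
  rw [← hW.2.2 n t ht c]
  refine Measure.map_congr ?_
  filter_upwards [hae] with ω hω
  exact Finset.sum_congr rfl fun i _ => by rw [hω _ (ht i)]

/-- Uniqueness on every sub-interval. -/
theorem path_unique_sub (hW : IsFractionalBM P H W) (hH : 0 < H) (hH2 : H ≤ 1 / 2) (hW0 : ∀ ω, W 0 ω = 0)
    (hWc : ∀ ω, Continuous fun t => W t ω) {M T : ℝ} (hM : 0 < M) (hT : 0 < T) (x₀ : ℝ)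
    {b : ℝ → ℝ} (hb : Measurable b) (hbi : Integrable b) (hbM : ∀ x, |b x| ≤ M) :
    ∃ z : Ω → ℝ → ℝ, (∀ ω, z ω ∈ LipM M) ∧ (∀ s, Measurable fun ω => z ω s) ∧
      (∀ᵐ ω ∂P, ∀ t ∈ Set.Icc 0 T, ∀ z' ∈ Sol b (fun u => x₀ + W u ω) M t, ∀ s ∈ Set.Icc 0 t, z' s = z ω s) ∧
      ∀ t ∈ Set.Icc 0 T, ∃ g, Measurable[past W t] g ∧ (fun ω => z ω t) =ᵐ[P] g := by
  obtain ⟨z, z1, z2, z3, z4⟩ := path_unique hW hH hH2 hW0 hWc hM hT x₀ hb hbi hbM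
  refine ⟨z, z1, z2, ?_, z4⟩
  filter_upwards [z3, good_ae hW hH hH2 hW0 hWc hM hT x₀ hb hbi hbM] with ω h1 h2 t ht z' hz' s hs
  obtain ⟨y, hy, hyz⟩ := ext_sol hM hb hbM (continuous_const.add (hWc ω)) h2 ht.1 hz'
  rw [← hyz s hs.2]
  exact h1.2 y hy s ⟨hs.1, hs.2.trans ht.2⟩

/-- A solution of the original equation that stays in a compact solves the truncated equation. -/
theorem sol_of_bounded {b : ℝ → ℝ} (hb : Measurable b) {w x : ℝ → ℝ} {R M t : ℝ} (hM : 0 < M)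
    (hbM : ∀ y ∈ Set.Icc (-R) R, |b y| ≤ M) (ht : 0 ≤ t) (hx : ContinuousOn x (Set.Icc 0 t))
    (hxR : ∀ s ∈ Set.Icc 0 t, |x s| ≤ R) (he : ∀ s ∈ Set.Icc 0 t, x s = w s + ∫ u in (0:ℝ)..s, b (x u)) :
    ∃ z ∈ Sol ((Set.Icc (-R) R).indicator b) w M t, ∀ s ∈ Set.Icc 0 t, x s = w s + z s := by
  let c : ℝ → ℝ := fun s => max 0 (min s t)
  have hc : ∀ s, c s ∈ Set.Icc 0 t := fun s => ⟨le_max_left _ _, max_le ht (min_le_right _ _)⟩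
  have hcs : ∀ s ∈ Set.Icc 0 t, c s = s := fun s hs => by
    simp only [c]; rw [min_eq_left hs.2, max_eq_right hs.1]
  have hcc : Continuous c := by fun_prop
  have hy : Continuous fun s => x (c s) := hx.comp_continuous hcc hc
  let f : ℝ → ℝ := fun u => (Set.Icc (-R) R).indicator b (x (c u))
  have hfm : Measurable f := (hb.indicator measurableSet_Icc).comp hy.measurable
  have hfM : ∀ u, |f u| ≤ M := by
    intro u
    have : x (c u) ∈ Set.Icc (-R) R := abs_le.1 (hxR _ (hc u))
    simp only [f]; rw [Set.indicator_of_mem this]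
    exact hbM _ this
  have hfi : ∀ r s, IntervalIntegrable f volume r s := fun r s => by
    refine (intervalIntegrable_const (c := M)).mono_fun hfm.aestronglyMeasurable (Eventually.of_forall fun u => ?_)
    exact (hfM u).trans (le_abs_self M)
  let z0 : ℝ → ℝ := fun s => ∫ u in (0:ℝ)..s, f u
  have hz0 : z0 ∈ LipM M := by
    refine ⟨by simp [z0], fun r s => ?_⟩
    simp only [z0]
    rw [intervalIntegral.integral_interval_sub_left (hfi _ _) (hfi _ _), ← Real.norm_eq_abs]
    exact intervalIntegral.norm_integral_le_of_norm_le_const fun u _ => hfM u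
  have hxz : ∀ s ∈ Set.Icc 0 t, x s = w s + z0 s := by
    intro s hs
    rw [he s hs]
    congr 1
    refine intervalIntegral.integral_congr fun u hu => ?_
    rw [Set.uIcc_of_le hs.1] at hu
    have hu' : u ∈ Set.Icc 0 t := ⟨hu.1, hu.2.trans hs.2⟩
    simp only [f]
    have hm : x u ∈ Set.Icc (-R) R := abs_le.1 (hxR u hu')
    rw [hcs u hu', Set.indicator_of_mem hm]
  refine ⟨z0, ⟨hz0, fun s hs => ?_⟩, hxz⟩
  refine intervalIntegral.integral_congr fun u hu => ?_
  rw [Set.uIcc_of_le hs.1] at hu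
  have hu' : u ∈ Set.Icc 0 t := ⟨hu.1, hu.2.trans hs.2⟩
  simp only [f]
  rw [hcs u hu', hxz u hu']

/-- Pathwise identification. -/
theorem ident_path {x y : ℝ → ℝ} {N T : ℝ} (hxy : x 0 = y 0) (hT : 0 ≤ T) (hx : ContinuousOn x (Set.Icc 0 T))
    (h : ∀ t ∈ Set.Icc 0 T, (∀ s ∈ Set.Icc 0 t, |x s| ≤ N + 1) → ∀ s ∈ Set.Icc 0 t, x s = y s)
    (hy : (∀ s ∈ Set.Icc 0 T, |x s| ≤ N) ∨ (∀ s ∈ Set.Icc 0 T, |y s| ≤ N)) :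
    ∀ s ∈ Set.Icc 0 T, x s = y s := by
  rcases hy with hy | hy
  · exact h T ⟨hT, le_rfl⟩ fun s hs => (hy s hs).trans (by linarith)
  · by_cases hb : ∀ s ∈ Set.Icc 0 T, |x s| ≤ N + 1
    · exact h T ⟨hT, le_rfl⟩ hb
    exfalso
    push Not at hb
    obtain ⟨r, hr, hr1⟩ := hb
    let S : Set ℝ := Set.Icc 0 T ∩ {s | N + 1 ≤ |x s|}
    have hSc : IsClosed S := by
      have := hx.abs.preimage_isClosed_of_isClosed isClosed_Icc (isClosed_Ici (a := N + 1))
      exact this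
    have hSb : BddBelow S := ⟨0, fun s hs => hs.1.1⟩
    have hm : sInf S ∈ S := hSc.csInf_mem ⟨r, hr, hr1.le⟩ hSb
    have hlt : ∀ s ∈ Set.Icc 0 T, s < sInf S → |x s| ≤ N + 1 := by
      intro s hs hlt
      by_contra hh
      exact absurd (csInf_le hSb (show s ∈ S from ⟨hs, (not_le.1 hh).le⟩)) (not_le.2 hlt)
    set σ := sInf S
    have hσ : |x σ| ≤ N + 1 := by
      rcases hm.1.1.eq_or_lt with h0 | h0
      · rw [← h0, hxy, h0]
        exact (hy σ hm.1).trans (by linarith)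
      · have ht : Tendsto (fun s => |x s|) (𝓝[Set.Ico 0 σ] σ) (𝓝 |x σ|) :=
          ((hx σ hm.1).mono_left (nhdsWithin_mono _ fun s hs => ⟨hs.1, hs.2.le.trans hm.1.2⟩)).abs
        have : (𝓝[Set.Ico 0 σ] σ).NeBot := by
          rw [← mem_closure_iff_nhdsWithin_neBot, closure_Ico h0.ne]
          exact ⟨h0.le, le_rfl⟩
        refine le_of_tendsto ht ?_
        filter_upwards [self_mem_nhdsWithin] with s hs
        exact hlt s ⟨hs.1, hs.2.le.trans hm.1.2⟩ hs.2
    have := h σ hm.1 (fun s hs => by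
      rcases hs.2.eq_or_lt with h1 | h1
      · rw [h1]; exact hσ
      · exact hlt s ⟨hs.1, hs.2.trans hm.1.2⟩ h1) σ ⟨hm.1.1, le_rfl⟩
    have h1 := hy σ hm.1
    have h2 : N + 1 ≤ |x σ| := hm.2
    rw [this] at h2
    linarith
end
end FBMProof

open MeasureTheory ProbabilityTheory Real
namespace FBMProof
open scoped ENNReal Topology
open Filter

section
variable {Ω : Type*} [mΩ : MeasurableSpace Ω] {P : Measure Ω} [IsProbabilityMeasure P] {H : ℝ} {W : ℝ → Ω → ℝ}

/-- Paths bounded by N on a measurable (countable) set of times, measurably. -/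
theorem exists_ball (T : ℝ) : ∃ B : ℕ → Set (Set.Icc (0:ℝ) T → ℝ), (∀ N, MeasurableSet (B N)) ∧
    (∀ p, Continuous p → ∀ N : ℕ, (p ∈ B N ↔ ∀ s, |p s| ≤ N)) ∧ ∀ p, Continuous p → ∃ N, p ∈ B N := by
  obtain ⟨D, hDc, hD⟩ := TopologicalSpace.exists_countable_dense (Set.Icc (0:ℝ) T)
  let B : ℕ → Set (Set.Icc (0:ℝ) T → ℝ) := fun N => ⋂ q ∈ D, {p | |p q| ≤ N}
  have key : ∀ p, Continuous p → ∀ N : ℕ, (p ∈ B N ↔ ∀ s, |p s| ≤ N) := by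
    intro p hp N
    simp only [B, Set.mem_iInter, Set.mem_setOf_eq]
    refine ⟨fun h s => ?_, fun h s _ => h s⟩
    have hcl : IsClosed {s | |p s| ≤ (N:ℝ)} := isClosed_le hp.abs continuous_const
    have : closure D ⊆ {s | |p s| ≤ (N:ℝ)} := closure_minimal (fun s hs => h s hs) hcl
    rw [hD.closure_eq] at this
    exact this (Set.mem_univ s)
  refine ⟨B, fun N => MeasurableSet.biInter hDc fun q _ => ?_, key, fun p hp => ?_⟩
  · exact measurableSet_le (measurable_pi_apply q).abs measurable_const
  · obtain ⟨C, hC⟩ := (isCompact_range hp.abs).bddAbove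
    obtain ⟨N, hN⟩ := exists_nat_ge C
    exact ⟨N, (key p hp N).2 fun s => (hC ⟨s, rfl⟩).trans hN⟩

theorem ac_local {S : Type*} [MeasurableSpace S] {μ : Measure S} {U : Ω → S} (hU : Measurable U)
    {B : ℕ → Set S} (hB : ∀ᵐ ω ∂P, ∃ N, U ω ∈ B N)
    (h : ∀ N A, MeasurableSet A → μ A = 0 → P {ω | U ω ∈ A ∧ U ω ∈ B N} = 0) : P.map U ≪ μ := by
  refine Measure.AbsolutelyContinuous.mk fun A hA h0 => ?_
  rw [Measure.map_apply hU hA]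
  have h1 : ∀ᵐ ω ∂P, ∀ N, ¬ (U ω ∈ A ∧ U ω ∈ B N) := by
    rw [ae_all_iff]; intro N
    exact measure_eq_zero_iff_ae_notMem.1 (h N A hA h0)
  refine measure_eq_zero_iff_ae_notMem.2 ?_
  filter_upwards [hB, h1] with ω ⟨N, hN⟩ h2 h3
  exact h2 N ⟨h3, hN⟩

theorem main_cont (hW : IsFractionalBM P H W) (hH : 0 < H) (hH2 : H ≤ 1 / 2)
    (hW0 : ∀ ω, W 0 ω = 0) (hWc : ∀ ω, Continuous fun t => W t ω) {T : ℝ} (hT : 0 < T) (x₀ : ℝ)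
    {b : ℝ → ℝ} (hb : Measurable b)
    (hbloc : ∀ K : Set ℝ, IsCompact K → ∃ M : ℝ, ∀ x ∈ K, |b x| ≤ M)
    (X : ℝ → Ω → ℝ) (hXm : ∀ t, Measurable (X t))
    (hXc : ∀ᵐ ω ∂P, ContinuousOn (fun t => X t ω) (Set.Icc (0 : ℝ) T))
    (hXeq : ∀ᵐ ω ∂P, ∀ t ∈ Set.Icc (0 : ℝ) T, X t ω = x₀ + W t ω + ∫ s in (0 : ℝ)..t, b (X s ω)) :
    processLaw P T X ≪ processLaw P T (fun t ω => x₀ + W t ω) ∧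
      processLaw P T (fun t ω => x₀ + W t ω) ≪ processLaw P T X := by
  have step : ∀ N : ℕ, ∃ Y : ℝ → Ω → ℝ, (∀ t, Measurable (Y t)) ∧ (∀ ω, Continuous fun t => Y t ω) ∧
      (processLaw P T Y ≪ processLaw P T (fun t ω => x₀ + W t ω) ∧
        processLaw P T (fun t ω => x₀ + W t ω) ≪ processLaw P T Y) ∧
      ∀ᵐ ω ∂P, ((∀ s ∈ Set.Icc 0 T, |X s ω| ≤ N) ∨ (∀ s ∈ Set.Icc 0 T, |Y s ω| ≤ N)) →
        ∀ s ∈ Set.Icc 0 T, X s ω = Y s ω := by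
    intro N
    obtain ⟨M0, hM0⟩ := hbloc (Set.Icc (-((N:ℝ) + 1)) (N + 1)) isCompact_Icc
    let M := max M0 1
    have hM : 0 < M := lt_max_of_lt_right one_pos
    have hM1 : ∀ x ∈ Set.Icc (-((N:ℝ) + 1)) (N + 1), |b x| ≤ M := fun x hx => (hM0 x hx).trans (le_max_left _ _)
    let c : ℝ → ℝ := (Set.Icc (-((N:ℝ) + 1)) (N + 1)).indicator b
    have hc : Measurable c := hb.indicator measurableSet_Icc
    have hcM : ∀ x, |c x| ≤ M := by
      intro x
      by_cases hx : x ∈ Set.Icc (-((N:ℝ) + 1)) (N + 1)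
      · simp only [c]; rw [Set.indicator_of_mem hx]; exact hM1 x hx
      · simp only [c]; rw [Set.indicator_of_notMem hx, abs_zero]; exact hM.le
    have hci : Integrable c := by
      rw [integrable_indicator_iff measurableSet_Icc]
      refine Measure.integrableOn_of_bounded (M := M) (by simp) hb.aestronglyMeasurable ?_
      filter_upwards [ae_restrict_mem measurableSet_Icc] with x hx
      exact hM1 x hx
    obtain ⟨z, z1, z2, z3, z4⟩ := path_unique_sub hW hH hH2 hW0 hWc hM hT x₀ hc hci hcM
    refine ⟨fun t ω => x₀ + W t ω + z ω t, fun t => (measurable_const.add (hW.1 t)).add (z2 t),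
      fun ω => (continuous_const.add (hWc ω)).add (lip_cont hM (z1 ω)),
      equiv_shift hW hH hH2 hW0 hWc hM hT x₀ z1 z2 z4, ?_⟩
    filter_upwards [hXc, hXeq, z3] with ω h1 h2 h3
    refine ident_path (x := fun t => X t ω) (y := fun t => x₀ + W t ω + z ω t) ?_ hT.le h1 ?_
    · have := h2 0 ⟨le_rfl, hT.le⟩
      simp only [intervalIntegral.integral_same] at this
      simp only [this, (z1 ω).1]
    · intro t ht hbd s hs
      obtain ⟨y, hy, hyx⟩ := sol_of_bounded (x := fun t => X t ω) (w := fun u => x₀ + W u ω) hb hM hM1 ht.1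
        (h1.mono (Set.Icc_subset_Icc_right ht.2)) hbd (fun s hs => h2 s ⟨hs.1, hs.2.trans ht.2⟩)
      have := hyx s hs
      rw [h3 t ht y hy s hs] at this
      exact this
  obtain ⟨B, hB1, hB2, hB3⟩ := exists_ball T
  have mX : Measurable fun ω => fun t : Set.Icc (0 : ℝ) T => X t ω := measurable_pi_iff.2 fun t => hXm t
  have mW : Measurable fun ω => fun t : Set.Icc (0 : ℝ) T => x₀ + W t ω :=
    measurable_pi_iff.2 fun t => measurable_const.add (hW.1 t)
  have cX : ∀ᵐ ω ∂P, Continuous fun t : Set.Icc (0 : ℝ) T => X t ω := by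
    filter_upwards [hXc] with ω h
    exact continuousOn_iff_continuous_restrict.1 h
  have cW : ∀ ω, Continuous fun t : Set.Icc (0 : ℝ) T => x₀ + W t ω := fun ω =>
    continuous_const.add ((hWc ω).comp continuous_subtype_val)
  constructor
  · refine ac_local mX (B := B) (cX.mono fun ω h => hB3 _ h) fun N A hA h0 => ?_
    obtain ⟨Y, y1, y2, y3, y4⟩ := step N
    have mY : Measurable fun ω => fun t : Set.Icc (0 : ℝ) T => Y t ω := measurable_pi_iff.2 fun t => y1 t
    have h1 := y3.1 h0
    rw [processLaw, Measure.map_apply mY hA] at h1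
    have h2 := measure_eq_zero_iff_ae_notMem.1 h1
    refine measure_eq_zero_iff_ae_notMem.2 ?_
    filter_upwards [h2, cX, y4] with ω h3 h4 h5 h6
    have h7 := (hB2 _ h4 N).1 h6.2
    have h8 := h5 (Or.inl fun s hs => h7 ⟨s, hs⟩)
    refine h3 ?_
    have h9 : (fun t : Set.Icc (0 : ℝ) T => Y t ω) = fun t : Set.Icc (0 : ℝ) T => X t ω :=
      funext fun t => (h8 t t.2).symm
    rw [Set.mem_preimage, h9]; exact h6.1
  · refine ac_local mW (B := B) (Eventually.of_forall fun ω => hB3 _ (cW ω)) fun N A hA h0 => ?_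
    obtain ⟨Y, y1, y2, y3, y4⟩ := step N
    have mY : Measurable fun ω => fun t : Set.Icc (0 : ℝ) T => Y t ω := measurable_pi_iff.2 fun t => y1 t
    have cY : ∀ ω, Continuous fun t : Set.Icc (0 : ℝ) T => Y t ω := fun ω => (y2 ω).comp continuous_subtype_val
    rw [processLaw, Measure.map_apply mX hA] at h0
    have h2 := measure_eq_zero_iff_ae_notMem.1 h0
    have h1 : processLaw P T Y (A ∩ B N) = 0 := by
      rw [processLaw, Measure.map_apply mY (hA.inter (hB1 N))]
      refine measure_eq_zero_iff_ae_notMem.2 ?_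
      filter_upwards [h2, y4] with ω h3 h5 h6
      have h7 := (hB2 _ (cY ω) N).1 h6.2
      have h8 := h5 (Or.inr fun s hs => h7 ⟨s, hs⟩)
      refine h3 ?_
      have h9 : (fun t : Set.Icc (0 : ℝ) T => X t ω) = fun t : Set.Icc (0 : ℝ) T => Y t ω :=
        funext fun t => (h8 t t.2)
      rw [Set.mem_preimage, h9]; exact h6.1
    have h3 := y3.2 h1
    rw [processLaw, Measure.map_apply mW (hA.inter (hB1 N))] at h3
    exact h3
end
end FBMProof


theorem equivalence_fbm_sde_small_hurst
    {Ω : Type*} [MeasurableSpace Ω] (P : Measure Ω) [IsProbabilityMeasure P]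
    (H : ℝ) (hH : H ∈ Set.Ioc (0 : ℝ) (1 / 2))
    (W : ℝ → Ω → ℝ) (hW : IsFractionalBM P H W)
    (x₀ T : ℝ) (hT : 0 < T)
    (b : ℝ → ℝ) (hbmeas : Measurable b)
    (hbloc : ∀ K : Set ℝ, IsCompact K → ∃ M : ℝ, ∀ x ∈ K, |b x| ≤ M)
    (X : ℝ → Ω → ℝ)
    (hXcont : ∀ᵐ ω ∂P, ContinuousOn (fun t => X t ω) (Set.Icc (0 : ℝ) T))
    (hXadapted : Adapted
      (Filtration.natural W fun t => ((hW.1 t).stronglyMeasurable)) X)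
    (hXeq : ∀ᵐ ω ∂P, ∀ t ∈ Set.Icc (0 : ℝ) T,
      X t ω = x₀ + W t ω + ∫ s in (0 : ℝ)..t, b (X s ω)) :
    processLaw P T X ≪ processLaw P T (fun t ω => x₀ + W t ω) ∧
      processLaw P T (fun t ω => x₀ + W t ω) ≪ processLaw P T X := by
  obtain ⟨W', h1, h2, h3, h4⟩ := FBMProof.exists_modification hW
  have hXm : ∀ t, Measurable (X t) := fun t =>
    (hXadapted t).mono ((Filtration.natural W fun t => ((hW.1 t).stronglyMeasurable)).le t) le_rfl
  have e : processLaw P T (fun t ω => x₀ + W t ω) = processLaw P T (fun t ω => x₀ + W' t ω) := by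
    unfold processLaw
    refine Measure.map_congr ?_
    filter_upwards [h4] with ω hω
    funext t
    rw [hω t t.2.1]
  rw [e]
  refine FBMProof.main_cont h1 hH.1 hH.2 h2 h3 hT x₀ hbmeas hbloc X hXm hXcont ?_
  filter_upwards [hXeq, h4] with ω h5 h6 t ht
  rw [h6 t ht.1]
  exact h5 t ht
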